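/- Any weak solution (X₁(·),X₂(·)) of the system (1.1)–(1.2) admits the skew representation: with μ := gρ² − hσ², γ := ρ² − σ², y := x₁ − x₂, one has X₁(t) = x₁ + μt + ρ²(Y⁺(t) − y⁺) − σ²(Y⁻(t) − y⁻) − γL^Y(t) + ρσQ(t) and X₂(t) = x₂ + μt − σ²(Y⁺(t) − y⁺) + ρ²(Y⁻(t) − y⁻) − γL^Y(t) + ρσQ(t), for all 0 ≤ t < ∞, where Y(·) is the pathwise unique strong solution of Y(t) = y − (g+h)∫₀ᵗ sgn(Y(s)) ds + W(t) for a standard Brownian motion W(·), L^Y(·) is the local time of Y at the origin, and Q(·) is a standard Brownian motion independent of W(·) and hence of Y(·). -/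

import Mathlib

open MeasureTheory ProbabilityTheory Filter Set

noncomputable section

namespace SDEPaper

/-- The signum convention of the paper: `psgn y = 1` for `y > 0`, `= -1` for `y ≤ 0`. -/
def psgn (y : ℝ) : ℝ := if 0 < y then 1 else -1

variable {Ω : Type*} [m : MeasurableSpace Ω]

/-- The σ-algebra generated by the process `Ξ` on the time interval `[0, t]`. -/
def natSA {E : Type*} [MeasurableSpace E] (Ξ : ℝ → Ω → E) (t : ℝ) : MeasurableSpace Ω :=
  ⨆ s ∈ Icc (0 : ℝ) t, MeasurableSpace.comap (Ξ s) inferInstance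

/-- The `μ`-augmentation of a σ-algebra. -/
def augSA (μ : Measure Ω) (m' : MeasurableSpace Ω) : MeasurableSpace Ω :=
  m' ⊔ MeasurableSpace.generateFrom {A : Set Ω | μ A = 0}

/-- `𝔉^Ξ(t)`: the `μ`-augmented σ-algebra generated by the process `Ξ` up to time `t`. -/
def natFilt {E : Type*} [MeasurableSpace E] (μ : Measure Ω) (Ξ : ℝ → Ω → E) (t : ℝ) :
    MeasurableSpace Ω := augSA μ (natSA Ξ t)

/-- Dyadic left-point Riemann sum of `H` against `X` on `[0,t]`. -/
def rsum (H X : ℝ → Ω → ℝ) (t : ℝ) (n : ℕ) (ω : Ω) : ℝ :=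
  ∑ i ∈ Finset.range (2 ^ n),
    H (t * i / 2 ^ n) ω * (X (t * (i + 1) / 2 ^ n) ω - X (t * i / 2 ^ n) ω)

/-- `I = ∫₀^· H dX`: dyadic Riemann sums converge in probability, and `I 0 = 0` a.s. -/
def IsSI (μ : Measure Ω) (H X I : ℝ → Ω → ℝ) : Prop :=
  (∀ᵐ ω ∂μ, I 0 ω = 0) ∧
  ∀ t : ℝ, 0 ≤ t → TendstoInMeasure μ (fun n => rsum H X t n) atTop (I t)

/-- `I = ∫₀^· H₁ dX₁ + ∫₀^· H₂ dX₂` in the sense of convergence in probability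
of dyadic Riemann sums. -/
def IsSI2 (μ : Measure Ω) (H₁ X₁ H₂ X₂ I : ℝ → Ω → ℝ) : Prop :=
  (∀ᵐ ω ∂μ, I 0 ω = 0) ∧
  ∀ t : ℝ, 0 ≤ t →
    TendstoInMeasure μ (fun n ω => rsum H₁ X₁ t n ω + rsum H₂ X₂ t n ω) atTop (I t)

/-- Dyadic sums of products of increments. -/
def qsum (X Y : ℝ → Ω → ℝ) (t : ℝ) (n : ℕ) (ω : Ω) : ℝ :=
  ∑ i ∈ Finset.range (2 ^ n),
    (X (t * (i + 1) / 2 ^ n) ω - X (t * i / 2 ^ n) ω) *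
      (Y (t * (i + 1) / 2 ^ n) ω - Y (t * i / 2 ^ n) ω)

/-- `C = ⟨X,Y⟩`: the quadratic covariation, as a limit in probability of dyadic sums. -/
def IsQV (μ : Measure Ω) (X Y C : ℝ → Ω → ℝ) : Prop :=
  ∀ t : ℝ, 0 ≤ t → TendstoInMeasure μ (fun n => qsum X Y t n) atTop (C t)

/-- `W` is a standard one-dimensional Brownian motion with respect to the family of
σ-algebras `F` (a filtration contained in the ambient σ-algebra). -/
structure IsBM (μ : Measure Ω) (F : ℝ → MeasurableSpace Ω) (W : ℝ → Ω → ℝ) : Prop where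
  le : ∀ t : ℝ, F t ≤ m
  mono : Monotone F
  adapted : ∀ t : ℝ, 0 ≤ t → MeasurableSpace.comap (W t) inferInstance ≤ F t
  init : ∀ᵐ ω ∂μ, W 0 ω = 0
  cont : ∀ᵐ ω ∂μ, Continuous fun t => W t ω
  law : ∀ s t : ℝ, 0 ≤ s → s ≤ t →
    μ.map (fun ω => W t ω - W s ω) = gaussianReal 0 ((t - s).toNNReal)
  indep : ∀ s t : ℝ, 0 ≤ s → s ≤ t →
    Indep (MeasurableSpace.comap (fun ω => W t ω - W s ω) inferInstance) (F s) μ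

/-- `(B₁, B₂)` is a planar Brownian motion: two independent standard Brownian motions
with respect to the common filtration `F`. -/
def IsPlanarBM (μ : Measure Ω) (F : ℝ → MeasurableSpace Ω) (B₁ B₂ : ℝ → Ω → ℝ) : Prop :=
  IsBM μ F B₁ ∧ IsBM μ F B₂ ∧
    IndepFun (fun ω => (fun t => B₁ t ω)) (fun ω => (fun t => B₂ t ω)) μ

/-- `L` is the (right) local time at the origin of the process `Y`:
`L t = lim_{ε ↓ 0} (4ε)⁻¹ ∫₀ᵗ 1{|Y(s)| < ε} ds`. -/
def IsLocalTime (μ : Measure Ω) (Y L : ℝ → Ω → ℝ) : Prop :=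
  ∀ᵐ ω ∂μ, ∀ t : ℝ, 0 ≤ t →
    Tendsto (fun ε : ℝ =>
        (4 * ε)⁻¹ * ∫ s in (0:ℝ)..t, (if |Y s ω| < ε then (1:ℝ) else 0))
      (nhdsWithin 0 (Ioi 0)) (nhds (L t ω))

/-- A continuous local martingale with respect to the filtration `F`. -/
def IsContLocMart (μ : Measure Ω) (F : Filtration ℝ m) (M : ℝ → Ω → ℝ) : Prop :=
  (∀ᵐ ω ∂μ, Continuous fun t => M t ω) ∧ StronglyAdapted F M ∧
    ∃ τ : ℕ → Ω → ℝ, (∀ n, IsStoppingTime F (fun ω => (τ n ω : WithTop ℝ))) ∧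
      (∀ᵐ ω ∂μ, Tendsto (fun n => τ n ω) atTop atTop) ∧
      ∀ n, Martingale (fun t ω => M (min t (τ n ω)) ω) F μ

/-- Orthogonality: the cross-variation `⟨M,N⟩` vanishes identically. -/
def Orthogonal (μ : Measure Ω) (M N : ℝ → Ω → ℝ) : Prop :=
  IsQV μ M N fun _ _ => 0

/-- Domination: `⟨M⟩(t) = ∫₀ᵗ q(s) d⟨N⟩(s)` for a progressively measurable
process `q` with values in `[0,c]`. -/
def Dominated (μ : Measure Ω) (F : Filtration ℝ m) (M N : ℝ → Ω → ℝ) (c : ℝ) : Prop :=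
  ∃ QM QN q : ℝ → Ω → ℝ, IsQV μ M M QM ∧ IsQV μ N N QN ∧
    ProgMeasurable F q ∧ (∀ t ω, q t ω ∈ Icc (0:ℝ) c) ∧
    ∀ᵐ ω ∂μ, ∃ ν : Measure ℝ,
      (∀ a b : ℝ, 0 ≤ a → a ≤ b → ν (Ioc a b) = ENNReal.ofReal (QN b ω - QN a ω)) ∧
      ∀ t : ℝ, 0 ≤ t → QM t ω = ∫ s in Ioc (0:ℝ) t, q s ω ∂ν

/-- The law of the two-dimensional process `(X₁, X₂)` on path space. -/
def pathLaw (μ : Measure Ω) (X₁ X₂ : ℝ → Ω → ℝ) : Measure (ℝ → ℝ × ℝ) :=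
  μ.map fun ω => (fun t => (X₁ t ω, X₂ t ω))
/-- `(X₁, X₂)` solves the system (1.1)-(1.2) driven by `(B₁, B₂)`. -/
def Solves11 (μ : Measure Ω) (F : ℝ → MeasurableSpace Ω) (g h ρ σ x₁ x₂ : ℝ)
    (B₁ B₂ X₁ X₂ : ℝ → Ω → ℝ) : Prop :=
  (∀ t : ℝ, 0 ≤ t →
    MeasurableSpace.comap (fun ω => (X₁ t ω, X₂ t ω)) inferInstance ≤ F t) ∧
  (∀ᵐ ω ∂μ, Continuous (fun t => X₁ t ω) ∧ Continuous (fun t => X₂ t ω)) ∧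
  ∃ I₁ I₂ : ℝ → Ω → ℝ,
    IsSI μ (fun s ω => if X₁ s ω ≤ X₂ s ω then σ else ρ) B₁ I₁ ∧
    IsSI μ (fun s ω => if X₁ s ω ≤ X₂ s ω then ρ else σ) B₂ I₂ ∧
    ∀ᵐ ω ∂μ, ∀ t : ℝ, 0 ≤ t →
      X₁ t ω = x₁ + (∫ s in (0:ℝ)..t, (if X₁ s ω ≤ X₂ s ω then g else -h)) + I₁ t ω ∧
      X₂ t ω = x₂ + (∫ s in (0:ℝ)..t, (if X₁ s ω ≤ X₂ s ω then -h else g)) + I₂ t ω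

/-- `(X₁, X₂)` solves the system (4.7)-(4.8), driven by the single Brownian motion `W`. -/
def Solves47 (μ : Measure Ω) (F : ℝ → MeasurableSpace Ω) (g h x₁ x₂ : ℝ)
    (W X₁ X₂ : ℝ → Ω → ℝ) : Prop :=
  (∀ t : ℝ, 0 ≤ t →
    MeasurableSpace.comap (fun ω => (X₁ t ω, X₂ t ω)) inferInstance ≤ F t) ∧
  (∀ᵐ ω ∂μ, Continuous (fun t => X₁ t ω) ∧ Continuous (fun t => X₂ t ω)) ∧
  ∃ I₁ I₂ : ℝ → Ω → ℝ,
    IsSI μ (fun s ω => if X₁ s ω ≤ X₂ s ω then (0:ℝ) else 1) W I₁ ∧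
    IsSI μ (fun s ω => if X₁ s ω ≤ X₂ s ω then (-1:ℝ) else 0) W I₂ ∧
    ∀ᵐ ω ∂μ, ∀ t : ℝ, 0 ≤ t →
      X₁ t ω = x₁ + (∫ s in (0:ℝ)..t, (if X₁ s ω ≤ X₂ s ω then g else -h)) + I₁ t ω ∧
      X₂ t ω = x₂ + (∫ s in (0:ℝ)..t, (if X₁ s ω ≤ X₂ s ω then -h else g)) + I₂ t ω

/-- `(X₁, X₂)` solves the system (4.9)-(4.10), driven by the single Brownian motion `V`. -/
def Solves49 (μ : Measure Ω) (F : ℝ → MeasurableSpace Ω) (g h x₁ x₂ : ℝ)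
    (V X₁ X₂ : ℝ → Ω → ℝ) : Prop :=
  (∀ t : ℝ, 0 ≤ t →
    MeasurableSpace.comap (fun ω => (X₁ t ω, X₂ t ω)) inferInstance ≤ F t) ∧
  (∀ᵐ ω ∂μ, Continuous (fun t => X₁ t ω) ∧ Continuous (fun t => X₂ t ω)) ∧
  ∃ I₁ I₂ : ℝ → Ω → ℝ,
    IsSI μ (fun s ω => if X₁ s ω ≤ X₂ s ω then (0:ℝ) else 1) V I₁ ∧
    IsSI μ (fun s ω => if X₁ s ω ≤ X₂ s ω then (1:ℝ) else 0) V I₂ ∧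
    ∀ᵐ ω ∂μ, ∀ t : ℝ, 0 ≤ t →
      X₁ t ω = x₁ + (∫ s in (0:ℝ)..t, (if X₁ s ω ≤ X₂ s ω then g else -h)) + I₁ t ω ∧
      X₂ t ω = x₂ + (∫ s in (0:ℝ)..t, (if X₁ s ω ≤ X₂ s ω then -h else g)) + I₂ t ω

/-- `(X₁, X₂)` solves the system (2.12)-(2.13), driven by the planar BM `(W₁, W₂)`. -/
def Solves212 (μ : Measure Ω) (F : ℝ → MeasurableSpace Ω) (g h ρ σ x₁ x₂ : ℝ)
    (W₁ W₂ X₁ X₂ : ℝ → Ω → ℝ) : Prop :=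
  (∀ t : ℝ, 0 ≤ t →
    MeasurableSpace.comap (fun ω => (X₁ t ω, X₂ t ω)) inferInstance ≤ F t) ∧
  (∀ᵐ ω ∂μ, Continuous (fun t => X₁ t ω) ∧ Continuous (fun t => X₂ t ω)) ∧
  ∃ I₁ I₂ : ℝ → Ω → ℝ,
    IsSI2 μ (fun s ω => if X₁ s ω ≤ X₂ s ω then 0 else ρ) W₁
            (fun s ω => if X₁ s ω ≤ X₂ s ω then σ else 0) W₂ I₁ ∧
    IsSI2 μ (fun s ω => if X₁ s ω ≤ X₂ s ω then -ρ else 0) W₁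
            (fun s ω => if X₁ s ω ≤ X₂ s ω then 0 else -σ) W₂ I₂ ∧
    ∀ᵐ ω ∂μ, ∀ t : ℝ, 0 ≤ t →
      X₁ t ω = x₁ + (∫ s in (0:ℝ)..t, (if X₁ s ω ≤ X₂ s ω then g else -h)) + I₁ t ω ∧
      X₂ t ω = x₂ + (∫ s in (0:ℝ)..t, (if X₁ s ω ≤ X₂ s ω then -h else g)) + I₂ t ω

/-- `(X₁, X₂)` solves the system (2.14)-(2.15), driven by the planar BM `(V₁, V₂)`. -/
def Solves214 (μ : Measure Ω) (F : ℝ → MeasurableSpace Ω) (g h ρ σ x₁ x₂ : ℝ)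
    (V₁ V₂ X₁ X₂ : ℝ → Ω → ℝ) : Prop :=
  (∀ t : ℝ, 0 ≤ t →
    MeasurableSpace.comap (fun ω => (X₁ t ω, X₂ t ω)) inferInstance ≤ F t) ∧
  (∀ᵐ ω ∂μ, Continuous (fun t => X₁ t ω) ∧ Continuous (fun t => X₂ t ω)) ∧
  ∃ I₁ I₂ : ℝ → Ω → ℝ,
    IsSI2 μ (fun s ω => if X₁ s ω ≤ X₂ s ω then 0 else ρ) V₁
            (fun s ω => if X₁ s ω ≤ X₂ s ω then σ else 0) V₂ I₁ ∧
    IsSI2 μ (fun s ω => if X₁ s ω ≤ X₂ s ω then ρ else 0) V₁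
            (fun s ω => if X₁ s ω ≤ X₂ s ω then 0 else σ) V₂ I₂ ∧
    ∀ᵐ ω ∂μ, ∀ t : ℝ, 0 ≤ t →
      X₁ t ω = x₁ + (∫ s in (0:ℝ)..t, (if X₁ s ω ≤ X₂ s ω then g else -h)) + I₁ t ω ∧
      X₂ t ω = x₂ + (∫ s in (0:ℝ)..t, (if X₁ s ω ≤ X₂ s ω then -h else g)) + I₂ t ω

/-- `(X₁, X₂)` solves the system `dX = Σ(X) dU + G(X) dt` of (eq:xSigma), where
`Σ(x) = Σ₊ 1{x₁ > x₂} + Σ₋ 1{x₁ ≤ x₂}`. -/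
def SolvesGen (μ : Measure Ω) (F : ℝ → MeasurableSpace Ω) (g h : ℝ)
    (Sp Sm : Matrix (Fin 2) (Fin 2) ℝ) (x₁ x₂ : ℝ)
    (U₁ U₂ X₁ X₂ : ℝ → Ω → ℝ) : Prop :=
  (∀ t : ℝ, 0 ≤ t →
    MeasurableSpace.comap (fun ω => (X₁ t ω, X₂ t ω)) inferInstance ≤ F t) ∧
  (∀ᵐ ω ∂μ, Continuous (fun t => X₁ t ω) ∧ Continuous (fun t => X₂ t ω)) ∧
  ∃ I₁ I₂ : ℝ → Ω → ℝ,
    IsSI2 μ (fun s ω => if X₁ s ω ≤ X₂ s ω then Sm 0 0 else Sp 0 0) U₁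
            (fun s ω => if X₁ s ω ≤ X₂ s ω then Sm 0 1 else Sp 0 1) U₂ I₁ ∧
    IsSI2 μ (fun s ω => if X₁ s ω ≤ X₂ s ω then Sm 1 0 else Sp 1 0) U₁
            (fun s ω => if X₁ s ω ≤ X₂ s ω then Sm 1 1 else Sp 1 1) U₂ I₂ ∧
    ∀ᵐ ω ∂μ, ∀ t : ℝ, 0 ≤ t →
      X₁ t ω = x₁ + (∫ s in (0:ℝ)..t, (if X₁ s ω ≤ X₂ s ω then g else -h)) + I₁ t ω ∧
      X₂ t ω = x₂ + (∫ s in (0:ℝ)..t, (if X₁ s ω ≤ X₂ s ω then -h else g)) + I₂ t ω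



-- Basic facts on Brownian motions

lemma IsBM.meas {μ : Measure Ω} {F : ℝ → MeasurableSpace Ω} {B : ℝ → Ω → ℝ} (h : IsBM μ F B)
    {t u : ℝ} (ht : 0 ≤ t) (htu : t ≤ u) : Measurable[F u] (B t) :=
  (measurable_iff_comap_le.2 (h.adapted t ht)).mono (h.mono htu) le_rfl

lemma IsBM.meas' {μ : Measure Ω} {F : ℝ → MeasurableSpace Ω} {B : ℝ → Ω → ℝ} (h : IsBM μ F B)
    {t : ℝ} (ht : 0 ≤ t) : Measurable (B t) :=
  (h.meas ht le_rfl).mono (h.le t) le_rfl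

lemma IsBM.inc_meas {μ : Measure Ω} {F : ℝ → MeasurableSpace Ω} {B : ℝ → Ω → ℝ} (h : IsBM μ F B)
    {s t u : ℝ} (hs : 0 ≤ s) (ht : 0 ≤ t) (hsu : s ≤ u) (htu : t ≤ u) :
    Measurable[F u] (fun ω => B t ω - B s ω) :=
  Measurable.sub (h.meas ht htu) (h.meas hs hsu)

lemma IsBM.inc_meas' {μ : Measure Ω} {F : ℝ → MeasurableSpace Ω} {B : ℝ → Ω → ℝ} (h : IsBM μ F B)
    {s t : ℝ} (hs : 0 ≤ s) (ht : 0 ≤ t) : Measurable (fun ω => B t ω - B s ω) :=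
  (h.meas' ht).sub (h.meas' hs)

lemma IsBM.indepFun {μ : Measure Ω} {F : ℝ → MeasurableSpace Ω} {B : ℝ → Ω → ℝ} (h : IsBM μ F B)
    {s t : ℝ} (hs : 0 ≤ s) (hst : s ≤ t) {β : Type*} [MeasurableSpace β] {ξ : Ω → β}
    (hξ : Measurable[F s] ξ) : IndepFun ξ (fun ω => B t ω - B s ω) μ := by
  have h1 := (h.indep s t hs hst).symm
  exact indep_of_indep_of_le_left h1 (measurable_iff_comap_le.1 hξ)

/-- Product formula with an increment. -/
lemma IsBM.integral_mul {μ : Measure Ω} {F : ℝ → MeasurableSpace Ω} {B : ℝ → Ω → ℝ}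
    (h : IsBM μ F B) {𝕜 : Type*} [RCLike 𝕜]
    {s t : ℝ} (hs : 0 ≤ s) (hst : s ≤ t) {ξ : Ω → 𝕜}
    (hξ : Measurable[F s] ξ) {g : ℝ → 𝕜} (hg : Measurable g) :
    ∫ ω, ξ ω * g (B t ω - B s ω) ∂μ = (∫ ω, ξ ω ∂μ) * ∫ ω, g (B t ω - B s ω) ∂μ := by
  have hi := (h.indepFun hs hst hξ).comp (measurable_id (α := 𝕜)) hg
  exact hi.integral_fun_mul_eq_mul_integral
    (hξ.mono (h.le s) le_rfl).aestronglyMeasurable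
    (hg.comp (h.inc_meas' hs (hs.trans hst))).aestronglyMeasurable

lemma IsBM.integral_inc {μ : Measure Ω} {F : ℝ → MeasurableSpace Ω} {B : ℝ → Ω → ℝ}
    (h : IsBM μ F B) {E : Type*} [NormedAddCommGroup E] [NormedSpace ℝ E]
    {s t : ℝ} (hs : 0 ≤ s) (hst : s ≤ t) {g : ℝ → E} (hg : StronglyMeasurable g) :
    ∫ ω, g (B t ω - B s ω) ∂μ = ∫ x, g x ∂(gaussianReal 0 (t - s).toNNReal) := by
  rw [← h.law s t hs hst, integral_map (h.inc_meas' hs (hs.trans hst)).aemeasurable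
    hg.aestronglyMeasurable]

lemma IsBM.memLp_inc {μ : Measure Ω} {F : ℝ → MeasurableSpace Ω} {B : ℝ → Ω → ℝ}
    (h : IsBM μ F B) {s t : ℝ} (hs : 0 ≤ s) (hst : s ≤ t) {p : ENNReal} (hp : p ≠ ⊤) :
    MemLp (fun ω => B t ω - B s ω) p μ := by
  have h1 := memLp_id_gaussianReal' (μ := 0) (v := (t - s).toNNReal) p hp
  rw [← h.law s t hs hst] at h1
  exact h1.comp_of_map (h.inc_meas' hs (hs.trans hst)).aemeasurable

lemma IsBM.integral_inc_one {μ : Measure Ω} {F : ℝ → MeasurableSpace Ω} {B : ℝ → Ω → ℝ}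
    (h : IsBM μ F B) {s t : ℝ} (hs : 0 ≤ s) (hst : s ≤ t) :
    ∫ ω, (B t ω - B s ω) ∂μ = 0 := by
  rw [h.integral_inc hs hst (g := fun x => x) measurable_id.stronglyMeasurable]
  exact integral_id_gaussianReal

lemma IsBM.integral_inc_sq {μ : Measure Ω} {F : ℝ → MeasurableSpace Ω} {B : ℝ → Ω → ℝ}
    (h : IsBM μ F B) {s t : ℝ} (hs : 0 ≤ s) (hst : s ≤ t) :
    ∫ ω, (B t ω - B s ω) ^ 2 ∂μ = t - s := by
  rw [h.integral_inc hs hst (g := fun x => x ^ 2) (by fun_prop)]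
  have := variance_fun_id_gaussianReal (μ := 0) (v := (t - s).toNNReal)
  rw [variance_eq_integral (by fun_prop)] at this
  simpa [integral_id_gaussianReal, sub_nonneg.2 hst] using this

/-- fourth moment of the standard Gaussian -/
def m4 : ℝ := ∫ x, x ^ 4 ∂(gaussianReal 0 1)

lemma m4_nonneg : 0 ≤ m4 := integral_nonneg fun x => by positivity

lemma IsBM.integral_inc_four {μ : Measure Ω} {F : ℝ → MeasurableSpace Ω} {B : ℝ → Ω → ℝ}
    (h : IsBM μ F B) {s t : ℝ} (hs : 0 ≤ s) (hst : s ≤ t) :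
    ∫ ω, (B t ω - B s ω) ^ 4 ∂μ = m4 * (t - s) ^ 2 := by
  rw [h.integral_inc hs hst (g := fun x => x ^ 4) (by fun_prop)]
  have h0 : 0 ≤ t - s := sub_nonneg.2 hst
  have hm := gaussianReal_map_const_mul (μ := 0) (v := 1) (Real.sqrt (t - s))
  have h3 : (⟨Real.sqrt (t - s) ^ 2, sq_nonneg _⟩ : NNReal) * 1 = (t - s).toNNReal := by
    ext; simp [Real.sq_sqrt h0, h0]
  rw [mul_zero] at hm
  have : gaussianReal 0 (t - s).toNNReal = (gaussianReal 0 1).map (fun x => Real.sqrt (t - s) * x) := by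
    rw [hm]; congr 1; exact h3.symm
  rw [this, integral_map (by fun_prop) (by fun_prop)]
  simp_rw [mul_pow]
  rw [integral_const_mul, m4, mul_comm]
  congr 1
  have := Real.sq_sqrt h0
  calc Real.sqrt (t-s) ^ 4 = (Real.sqrt (t-s) ^ 2)^2 := by ring
    _ = _ := by rw [this]

lemma IsBM.integral_cexp {μ : Measure Ω} {F : ℝ → MeasurableSpace Ω} {B : ℝ → Ω → ℝ}
    (h : IsBM μ F B) {s t : ℝ} (hs : 0 ≤ s) (hst : s ≤ t) (θ : ℝ) :
    ∫ ω, Complex.exp (((θ * (B t ω - B s ω) : ℝ) : ℂ) * Complex.I) ∂μ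
      = Complex.exp (((-(θ ^ 2 * (t - s) / 2) : ℝ)) : ℂ) := by
  have h1 := h.integral_inc hs hst (g := fun x => Complex.exp (((θ * x : ℝ) : ℂ) * Complex.I))
    (by apply Measurable.stronglyMeasurable; fun_prop)
  rw [h1]
  have h2 := charFun_gaussianReal (μ := 0) (v := (t - s).toNNReal) θ
  rw [charFun_apply_real] at h2
  simp only [Complex.ofReal_mul]
  rw [h2]
  congr 1
  have h0 : 0 ≤ t - s := sub_nonneg.2 hst
  have : (((t - s).toNNReal : ℝ) : ℂ) = ((t - s : ℝ) : ℂ) := by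
    rw [Real.coe_toNNReal _ h0]
  push_cast at this ⊢
  rw [this]; push_cast; ring

/-- joint conditional characteristic function of a planar Brownian motion -/
def JointCF (μ : Measure Ω) (F : ℝ → MeasurableSpace Ω) (W Q : ℝ → Ω → ℝ) : Prop :=
  ∀ θ η s t : ℝ, 0 ≤ s → s ≤ t → ∀ (ξ : Ω → ℂ) (C : ℝ), Measurable[F s] ξ → (∀ ω, ‖ξ ω‖ ≤ C) →
    ∫ ω, ξ ω * Complex.exp (((θ * (W t ω - W s ω) + η * (Q t ω - Q s ω) : ℝ) : ℂ) * Complex.I) ∂μ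
      = (∫ ω, ξ ω ∂μ) * Complex.exp (((-((θ ^ 2 + η ^ 2) * (t - s) / 2) : ℝ)) : ℂ)

-- Joint characteristic function of the driving planar Brownian motion

/-- compensated complex exponential -/
def cE (θ x c : ℝ) : ℂ := Complex.exp (((θ * x : ℝ) : ℂ) * Complex.I + ((θ ^ 2 * c / 2 : ℝ) : ℂ))

lemma cE_add (θ x y c d : ℝ) : cE θ (x + y) (c + d) = cE θ x c * cE θ y d := by
  rw [cE, cE, cE, ← Complex.exp_add]; congr 1; push_cast; ring

lemma norm_cE (θ x c : ℝ) : ‖cE θ x c‖ = Real.exp (θ ^ 2 * c / 2) := by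
  rw [cE, Complex.norm_exp, Complex.add_re, Complex.re_ofReal_mul, Complex.I_re, Complex.ofReal_re]
  simp

lemma measurable_cE (θ c : ℝ) : Measurable (fun x => cE θ x c) := by
  unfold cE; fun_prop

lemma IsBM.integral_cE {μ : Measure Ω} {F : ℝ → MeasurableSpace Ω} {B : ℝ → Ω → ℝ}
    (h : IsBM μ F B) {s t : ℝ} (hs : 0 ≤ s) (hst : s ≤ t) (θ : ℝ) :
    ∫ ω, cE θ (B t ω - B s ω) (t - s) ∂μ = 1 := by
  have h1 := h.integral_cexp hs hst θ
  simp only [cE, Complex.exp_add]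
  rw [integral_mul_const, h1, ← Complex.exp_add]
  have : (((-(θ ^ 2 * (t - s) / 2) : ℝ)) : ℂ) + ((θ ^ 2 * (t - s) / 2 : ℝ) : ℂ) = 0 := by
    push_cast; ring
  rw [this, Complex.exp_zero]

lemma integrable_of_bdd {μ : Measure Ω} [IsFiniteMeasure μ] {E : Type*} [NormedAddCommGroup E]
    [MeasurableSpace E] [BorelSpace E] [SecondCountableTopology E]
    {f : Ω → E} (hf : Measurable f) {C : ℝ}
    (hC : ∀ ω, ‖f ω‖ ≤ C) : Integrable f μ :=
  Integrable.of_bound hf.aestronglyMeasurable C (Eventually.of_forall hC)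

/-- martingale difference -/
lemma IsBM.cE_diff {μ : Measure Ω} [IsProbabilityMeasure μ] {F : ℝ → MeasurableSpace Ω}
    {B : ℝ → Ω → ℝ}
    (h : IsBM μ F B) {s t : ℝ} (hs : 0 ≤ s) (hst : s ≤ t) (θ : ℝ) {ξ : Ω → ℂ}
    (hξ : Measurable[F s] ξ) :
    ∫ ω, ξ ω * (cE θ (B t ω - B s ω) (t - s) - 1) ∂μ = 0 := by
  rw [h.integral_mul hs hst hξ (g := fun x => cE θ x (t - s) - 1)
    ((measurable_cE _ _).sub measurable_const)]
  rw [integral_sub, h.integral_cE hs hst]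
  · simp
  · exact integrable_of_bdd ((measurable_cE _ _).comp (h.inc_meas' hs (hs.trans hst)))
      (fun ω => (norm_cE _ _ _).le)
  · simp

/-- grid increments of the complex exponential martingale, as functionals of the path -/
def cX (θ s δ : ℝ) (i : ℕ) (b : ℝ → ℝ) : ℂ :=
  cE θ (b (s + δ * i) - b s) (δ * i) * (cE θ (b (s + δ * (i + 1)) - b (s + δ * i)) δ - 1)

lemma measurable_cX (θ s δ : ℝ) (i : ℕ) : Measurable (cX θ s δ i) := by
  unfold cX cE; fun_prop

lemma norm_cX_le (θ s δ : ℝ) (hδ : 0 ≤ δ) (i : ℕ) (b : ℝ → ℝ) :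
    ‖cX θ s δ i b‖ ≤ Real.exp (θ ^ 2 * (δ * i) / 2) * (Real.exp (θ ^ 2 * δ / 2) + 1) := by
  rw [cX, norm_mul, norm_cE]
  gcongr
  refine (norm_sub_le _ _).trans ?_
  rw [norm_cE]; simp

open ComplexConjugate in
lemma IsBM.cX_orth {μ : Measure Ω} [IsProbabilityMeasure μ] {F : ℝ → MeasurableSpace Ω}
    {B : ℝ → Ω → ℝ} (h : IsBM μ F B) {s δ : ℝ} (hs : 0 ≤ s) (hδ : 0 ≤ δ) (θ : ℝ) {i j : ℕ}
    (hij : i < j) :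
    ∫ ω, conj (cX θ s δ i (fun t => B t ω)) * cX θ s δ j (fun t => B t ω) ∂μ = 0 := by
  have hij' : (i : ℝ) + 1 ≤ j := by exact_mod_cast hij
  have e0 : s ≤ s + δ * i := by nlinarith [mul_nonneg hδ (Nat.cast_nonneg (α := ℝ) i)]
  have e1 : s + δ * i ≤ s + δ * (i + 1) := by nlinarith
  have e2 : s + δ * (i + 1) ≤ s + δ * j := by nlinarith
  have e3 : s + δ * j ≤ s + δ * (j + 1) := by nlinarith
  have m1 := h.meas (t := s) (u := s + δ * j) hs (by linarith)
  have m2 := h.meas (t := s + δ * i) (u := s + δ * j) (by linarith) (by linarith)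
  have m3 := h.meas (t := s + δ * (i+1)) (u := s + δ * j) (by linarith) (by linarith)
  have m4 := h.meas (t := s + δ * j) (u := s + δ * j) (by linarith) (by linarith)
  have hm : Measurable[F (s + δ * j)] (fun ω => conj (cX θ s δ i (fun t => B t ω)) *
      cE θ (B (s + δ * j) ω - B s ω) (δ * j)) := by
    refine Measurable.mul ?_ ((measurable_cE _ _).comp (m4.sub m1))
    refine Complex.continuous_conj.measurable.comp ?_
    unfold cX
    exact Measurable.mul ((measurable_cE _ _).comp (m2.sub m1))
      (((measurable_cE _ _).comp (m3.sub m2)).sub measurable_const)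
  have := h.cE_diff (by linarith) e3 θ hm
  rw [← this]
  congr 1; ext ω
  rw [cX, cX]
  have : s + δ * (j + 1) - (s + δ * j) = δ := by ring
  rw [this]; ring

open ComplexConjugate in
lemma IsBM.cX_diag {μ : Measure Ω} [IsProbabilityMeasure μ] {F : ℝ → MeasurableSpace Ω}
    {B : ℝ → Ω → ℝ} (h : IsBM μ F B) {s δ : ℝ} (hs : 0 ≤ s) (hδ : 0 ≤ δ) (θ : ℝ) (i : ℕ) :
    ∫ ω, conj (cX θ s δ i (fun t => B t ω)) * cX θ s δ i (fun t => B t ω) ∂μ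
      = ((Real.exp (θ ^ 2 * (δ * i)) * (Real.exp (θ ^ 2 * δ) - 1) : ℝ) : ℂ) := by
  have e0 : s ≤ s + δ * i := by nlinarith [mul_nonneg hδ (Nat.cast_nonneg (α := ℝ) i)]
  have e1 : s + δ * i ≤ s + δ * (i + 1) := by nlinarith
  have ee : s + δ * (i + 1) - (s + δ * i) = δ := by ring
  have h1 := h.integral_cE (by linarith) e1 θ
  rw [ee] at h1
  have key : ∀ ω, conj (cX θ s δ i (fun t => B t ω)) * cX θ s δ i (fun t => B t ω)
      = ((Real.exp (θ ^ 2 * (δ * i)) : ℝ) : ℂ) * (((Real.exp (θ ^ 2 * δ) + 1 : ℝ) : ℂ)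
        - (cE θ (B (s + δ * (i + 1)) ω - B (s + δ * i) ω) δ
          + conj (cE θ (B (s + δ * (i + 1)) ω - B (s + δ * i) ω) δ))) := by
    intro ω
    have hn : ∀ x c, conj (cE θ x c) * cE θ x c = ((Real.exp (θ ^ 2 * c) : ℝ) : ℂ) := by
      intro x c
      rw [RCLike.conj_mul, norm_cE]
      rw [show θ ^ 2 * c = θ ^ 2 * c / 2 + θ ^ 2 * c / 2 by ring, Real.exp_add]
      push_cast; simp only [Complex.coe_algebraMap]; push_cast; ring
    have a1 := hn (B (s + δ * i) ω - B s ω) (δ * i)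
    have a2 := hn (B (s + δ * (i + 1)) ω - B (s + δ * i) ω) δ
    rw [cX, map_mul, map_sub, map_one, Complex.ofReal_add, ← a1, ← a2]
    push_cast; ring
  simp_rw [key]
  have hi : Integrable (fun ω => cE θ (B (s + δ * (i + 1)) ω - B (s + δ * i) ω) δ) μ :=
    integrable_of_bdd ((measurable_cE _ _).comp (h.inc_meas' (by linarith) (by linarith)))
      (fun ω => (norm_cE _ _ _).le)
  have hi2 : Integrable (fun ω => conj (cE θ (B (s + δ * (i + 1)) ω - B (s + δ * i) ω) δ)) μ :=
    integrable_of_bdd (Complex.continuous_conj.measurable.comp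
      ((measurable_cE _ _).comp (h.inc_meas' (by linarith) (by linarith))))
      (fun ω => by rw [RCLike.norm_conj]; exact (norm_cE _ _ _).le)
  rw [integral_const_mul, integral_sub (integrable_const _) (by exact hi.add hi2), integral_add hi hi2,
    integral_conj, h1]
  simp

open ComplexConjugate in
lemma cX_sum_sq {μ : Measure Ω} [IsProbabilityMeasure μ] {F : ℝ → MeasurableSpace Ω}
    {B₁ B₂ : ℝ → Ω → ℝ} (h : IsPlanarBM μ F B₁ B₂) {s δ : ℝ} (hs : 0 ≤ s) (hδ : 0 ≤ δ)
    (θ η : ℝ) (N : ℕ) :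
    ∫ ω, ‖∑ i ∈ Finset.range N, cX θ s δ i (fun t => B₁ t ω) * cX η s δ i (fun t => B₂ t ω)‖ ^ 2 ∂μ
      = ∑ i ∈ Finset.range N, (Real.exp (θ ^ 2 * (δ * i)) * (Real.exp (θ ^ 2 * δ) - 1)) *
          (Real.exp (η ^ 2 * (δ * i)) * (Real.exp (η ^ 2 * δ) - 1)) := by
  obtain ⟨h1, h2, hI⟩ := h
  have hp : ∀ i, ∀ {B : ℝ → Ω → ℝ} (_ : IsBM μ F B) (θ : ℝ),
      Measurable (fun ω => cX θ s δ i (fun t => B t ω)) := by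
    intro i B hB θ
    have e0 : s ≤ s + δ * i := by nlinarith [mul_nonneg hδ (Nat.cast_nonneg (α := ℝ) i)]
    have e1 : s + δ * i ≤ s + δ * (i + 1) := by nlinarith
    unfold cX
    exact Measurable.mul ((measurable_cE _ _).comp (hB.inc_meas' (by linarith) (by linarith)))
      (((measurable_cE _ _).comp (hB.inc_meas' (by linarith) (by linarith))).sub measurable_const)
  have key : ∀ i j, ∫ ω, conj (cX θ s δ i (fun t => B₁ t ω) * cX η s δ i (fun t => B₂ t ω)) *
      (cX θ s δ j (fun t => B₁ t ω) * cX η s δ j (fun t => B₂ t ω)) ∂μ =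
      (∫ ω, conj (cX θ s δ i (fun t => B₁ t ω)) * cX θ s δ j (fun t => B₁ t ω) ∂μ) *
      (∫ ω, conj (cX η s δ i (fun t => B₂ t ω)) * cX η s δ j (fun t => B₂ t ω) ∂μ) := by
    intro i j
    have hmm : ∀ θ, Measurable (fun b : ℝ → ℝ => conj (cX θ s δ i b) * cX θ s δ j b) := fun θ =>
      (Complex.continuous_conj.measurable.comp (measurable_cX θ s δ i)).mul (measurable_cX θ s δ j)
    have hc := hI.comp (hmm θ) (hmm η)
    have := hc.integral_fun_mul_eq_mul_integral
      (((Complex.continuous_conj.measurable.comp (hp i h1 θ)).mul (hp j h1 θ)).aestronglyMeasurable)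
      (((Complex.continuous_conj.measurable.comp (hp i h2 η)).mul (hp j h2 η)).aestronglyMeasurable)
    simp only [Function.comp_def] at this
    rw [← this]
    congr 1; ext ω; rw [map_mul]; ring
  have hsym : ∀ i j, ∀ {B : ℝ → Ω → ℝ} (_ : IsBM μ F B) (θ : ℝ), i ≠ j →
      ∫ ω, conj (cX θ s δ i (fun t => B t ω)) * cX θ s δ j (fun t => B t ω) ∂μ = 0 := by
    intro i j B hB θ hij
    rcases lt_or_gt_of_ne hij with h' | h'
    · exact hB.cX_orth hs hδ θ h'
    · have := hB.cX_orth hs hδ θ h'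
      have h3 := congrArg conj this
      rw [← integral_conj, map_zero] at h3
      rw [← h3]; congr 1; ext ω; simp [mul_comm]
  have hbd : ∀ i, ∃ C, ∀ ω, ‖cX θ s δ i (fun t => B₁ t ω) * cX η s δ i (fun t => B₂ t ω)‖ ≤ C := by
    intro i
    exact ⟨_, fun ω => by
      rw [norm_mul]
      exact mul_le_mul (norm_cX_le θ s δ hδ i _) (norm_cX_le η s δ hδ i _) (norm_nonneg _)
        (by positivity)⟩
  have hintb : ∀ i j, Integrable (fun ω => conj (cX θ s δ i (fun t => B₁ t ω) *
      cX η s δ i (fun t => B₂ t ω)) *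
      (cX θ s δ j (fun t => B₁ t ω) * cX η s δ j (fun t => B₂ t ω))) μ := by
    intro i j
    obtain ⟨C, hC⟩ := hbd i
    obtain ⟨D, hD⟩ := hbd j
    refine integrable_of_bdd (C := C * D) ?_ ?_
    · exact (Complex.continuous_conj.measurable.comp ((hp i h1 θ).mul (hp i h2 η))).mul
        ((hp j h1 θ).mul (hp j h2 η))
    · intro ω
      rw [norm_mul, RCLike.norm_conj]
      exact mul_le_mul (hC ω) (hD ω) (norm_nonneg _) ((norm_nonneg _).trans (hC ω))
  have : ((∫ ω, ‖∑ i ∈ Finset.range N, cX θ s δ i (fun t => B₁ t ω) *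
      cX η s δ i (fun t => B₂ t ω)‖ ^ 2 ∂μ : ℝ) : ℂ)
      = ((∑ i ∈ Finset.range N, (Real.exp (θ ^ 2 * (δ * i)) * (Real.exp (θ ^ 2 * δ) - 1)) *
          (Real.exp (η ^ 2 * (δ * i)) * (Real.exp (η ^ 2 * δ) - 1)) : ℝ) : ℂ) := by
    rw [← integral_complex_ofReal]
    have e : ∀ ω, ((‖∑ i ∈ Finset.range N, cX θ s δ i (fun t => B₁ t ω) *
      cX η s δ i (fun t => B₂ t ω)‖ ^ 2 : ℝ) : ℂ) = ∑ i ∈ Finset.range N, ∑ j ∈ Finset.range N,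
        conj (cX θ s δ i (fun t => B₁ t ω) * cX η s δ i (fun t => B₂ t ω)) *
      (cX θ s δ j (fun t => B₁ t ω) * cX η s δ j (fun t => B₂ t ω)) := by
      intro ω
      rw [← Finset.sum_mul_sum, ← map_sum, RCLike.conj_mul]; norm_cast
    simp_rw [e]
    rw [integral_finsetSum _ (fun i _ => integrable_finsetSum _ (fun j _ => hintb i j))]
    rw [Complex.ofReal_sum]
    refine Finset.sum_congr rfl fun i hi => ?_
    rw [integral_finsetSum _ (fun j _ => hintb i j), Finset.sum_eq_single i]
    · rw [key, h1.cX_diag hs hδ, h2.cX_diag hs hδ]; push_cast; ring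
    · intro j _ hj
      rw [key, hsym i j h1 θ hj.symm, zero_mul]
    · intro h; exact absurd hi h
  exact_mod_cast this

lemma sq_integral_le {μ : Measure Ω} [IsProbabilityMeasure μ] {f : Ω → ℝ} (hf : MemLp f 2 μ) :
    (∫ ω, f ω ∂μ) ^ 2 ≤ ∫ ω, f ω ^ 2 ∂μ := by
  have h1 := variance_eq_sub hf
  have h2 := variance_nonneg f μ
  have : μ[f ^ 2] = ∫ ω, f ω ^ 2 ∂μ := by simp
  rw [this] at h1
  linarith

lemma exp_sub_one_le {x : ℝ} : Real.exp x - 1 ≤ x * Real.exp x := by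
  have h := Real.add_one_le_exp (-x)
  have h2 : Real.exp (-x) * Real.exp x = 1 := by rw [← Real.exp_add]; simp
  nlinarith [Real.exp_pos x]

lemma planar_telescope {μ : Measure Ω} [IsProbabilityMeasure μ] {F : ℝ → MeasurableSpace Ω}
    {B₁ B₂ : ℝ → Ω → ℝ} (h : IsPlanarBM μ F B₁ B₂) {s δ : ℝ} (hs : 0 ≤ s) (hδ : 0 ≤ δ)
    (θ η : ℝ) (N : ℕ) (ξ : Ω → ℂ) (C : ℝ) (hξ : Measurable[F s] ξ) (hC : ∀ ω, ‖ξ ω‖ ≤ C) :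
    ∫ ω, ξ ω * (cE θ (B₁ (s + δ * N) ω - B₁ s ω) (δ * N) * cE η (B₂ (s + δ * N) ω - B₂ s ω) (δ * N)) ∂μ
      = (∫ ω, ξ ω ∂μ) + ∫ ω, ξ ω * (∑ i ∈ Finset.range N, cX θ s δ i (fun t => B₁ t ω) *
          cX η s δ i (fun t => B₂ t ω)) ∂μ := by
  obtain ⟨h1, h2, hI⟩ := h
  have e0 : ∀ i : ℕ, s ≤ s + δ * i := fun i => by
    nlinarith [mul_nonneg hδ (Nat.cast_nonneg (α := ℝ) i)]
  have e1 : ∀ i : ℕ, s + δ * i ≤ s + δ * (i + 1) := fun i => by nlinarith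
  have hξ' : Measurable ξ := hξ.mono (h1.le s) le_rfl
  have C0 : ∀ ω, 0 ≤ C := fun ω => (norm_nonneg _).trans (hC ω)
  have hp : ∀ i, ∀ {B : ℝ → Ω → ℝ} (_ : IsBM μ F B) (θ : ℝ),
      Measurable (fun ω => cX θ s δ i (fun t => B t ω)) := by
    intro i B hB θ
    unfold cX
    exact Measurable.mul ((measurable_cE _ _).comp (hB.inc_meas' (by linarith [e0 i]) (by linarith [e0 i])))
      (((measurable_cE _ _).comp (hB.inc_meas' (by linarith [e0 i]) (by linarith [e0 i, e1 i]))).sub measurable_const)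
  have hU : ∀ i : ℕ, ∀ {B : ℝ → Ω → ℝ} (_ : IsBM μ F B) (θ : ℝ),
      Measurable[F (s + δ * i)] (fun ω => cE θ (B (s + δ * i) ω - B s ω) (δ * i)) := by
    intro i B hB θ
    exact (measurable_cE _ _).comp (hB.inc_meas hs (by linarith [e0 i]) (e0 i) le_rfl)
  have hU' : ∀ i : ℕ, ∀ {B : ℝ → Ω → ℝ} (_ : IsBM μ F B) (θ : ℝ),
      Measurable (fun ω => cE θ (B (s + δ * i) ω - B s ω) (δ * i)) := fun i B hB θ =>
    (hU i hB θ).mono (h1.le _) le_rfl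
  induction N with
  | zero => simp [cE]
  | succ i ih =>
    have eqn : ∀ ω, ξ ω * (cE θ (B₁ (s + δ * (i + 1 : ℕ)) ω - B₁ s ω) (δ * (i + 1 : ℕ)) *
        cE η (B₂ (s + δ * (i + 1 : ℕ)) ω - B₂ s ω) (δ * (i + 1 : ℕ)))
        = ξ ω * (cE θ (B₁ (s + δ * i) ω - B₁ s ω) (δ * i) * cE η (B₂ (s + δ * i) ω - B₂ s ω) (δ * i))
        + (ξ ω * (cE η (B₂ (s + δ * i) ω - B₂ s ω) (δ * i) * cX θ s δ i (fun t => B₁ t ω))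
        + (ξ ω * (cE θ (B₁ (s + δ * i) ω - B₁ s ω) (δ * i) * cX η s δ i (fun t => B₂ t ω))
        + ξ ω * (cX θ s δ i (fun t => B₁ t ω) * cX η s δ i (fun t => B₂ t ω)))) := by
      intro ω
      have a : ∀ θ (B : ℝ → Ω → ℝ), cE θ (B (s + δ * (i + 1 : ℕ)) ω - B s ω) (δ * (i + 1 : ℕ))
          = cE θ (B (s + δ * i) ω - B s ω) (δ * i) + cX θ s δ i (fun t => B t ω) := by
        intro θ B
        rw [cX]
        rw [show B (s + δ * (i + 1 : ℕ)) ω - B s ω = (B (s + δ * i) ω - B s ω) +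
          (B (s + δ * (i + 1)) ω - B (s + δ * i) ω) by push_cast; ring,
          show δ * (i + 1 : ℕ) = δ * i + δ by push_cast; ring, cE_add]
        ring
      rw [a, a]; ring
    simp_rw [eqn]
    have z : ∀ {B : ℝ → Ω → ℝ} (_ : IsBM μ F B) (θ : ℝ) {B' : ℝ → Ω → ℝ} (_ : IsBM μ F B') (η : ℝ),
        ∫ ω, ξ ω * (cE η (B' (s + δ * i) ω - B' s ω) (δ * i) * cX θ s δ i (fun t => B t ω)) ∂μ = 0 := by
      intro B hB θ B' hB' η
      have := hB.cE_diff (by linarith [e0 i]) (e1 i) θ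
        (ξ := fun ω => ξ ω * (cE η (B' (s + δ * i) ω - B' s ω) (δ * i) *
          cE θ (B (s + δ * i) ω - B s ω) (δ * i)))
        ((hξ.mono (h1.mono (e0 i)) le_rfl).mul ((hU i hB' η).mul (hU i hB θ)))
      rw [← this]; congr 1; ext ω
      rw [cX, show s + δ * (i + 1) - (s + δ * i) = δ by ring]; ring
    have bX : ∀ θ (B : ℝ → Ω → ℝ) ω, ‖cX θ s δ i (fun t => B t ω)‖ ≤
      Real.exp (θ ^ 2 * (δ * i) / 2) * (Real.exp (θ ^ 2 * δ / 2) + 1) := fun θ B ω => norm_cX_le θ s δ hδ i _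
    have i0 : Integrable (fun ω => ξ ω * (cE θ (B₁ (s + δ * i) ω - B₁ s ω) (δ * i) *
        cE η (B₂ (s + δ * i) ω - B₂ s ω) (δ * i))) μ := by
      refine integrable_of_bdd (C := C * (Real.exp (θ ^ 2 * (δ * i) / 2) * Real.exp (η ^ 2 * (δ * i) / 2)))
        (hξ'.mul ((hU' i h1 θ).mul (hU' i h2 η))) fun ω => ?_
      rw [norm_mul, norm_mul, norm_cE, norm_cE]
      exact mul_le_mul_of_nonneg_right (hC ω) (by positivity)
    have i1 : ∀ {B : ℝ → Ω → ℝ} (_ : IsBM μ F B) (θ : ℝ) {B' : ℝ → Ω → ℝ} (_ : IsBM μ F B') (η : ℝ),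
        Integrable (fun ω => ξ ω * (cE η (B' (s + δ * i) ω - B' s ω) (δ * i) *
          cX θ s δ i (fun t => B t ω))) μ := by
      intro B hB θ B' hB' η
      refine integrable_of_bdd (C := C * (Real.exp (η ^ 2 * (δ * i) / 2) *
        (Real.exp (θ ^ 2 * (δ * i) / 2) * (Real.exp (θ ^ 2 * δ / 2) + 1))))
        (hξ'.mul ((hU' i hB' η).mul (hp i hB θ))) fun ω => ?_
      rw [norm_mul, norm_mul, norm_cE]
      have := C0 ω
      exact mul_le_mul (hC ω) (mul_le_mul_of_nonneg_left (bX _ _ _) (by positivity)) (by positivity) this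
    have i2 : ∀ i, Integrable (fun ω => ξ ω * (cX θ s δ i (fun t => B₁ t ω) * cX η s δ i (fun t => B₂ t ω))) μ := by
      intro i
      refine integrable_of_bdd (C := C * ((Real.exp (θ ^ 2 * (δ * i) / 2) * (Real.exp (θ ^ 2 * δ / 2) + 1))
        * (Real.exp (η ^ 2 * (δ * i) / 2) * (Real.exp (η ^ 2 * δ / 2) + 1))))
        (hξ'.mul ((hp i h1 θ).mul (hp i h2 η))) fun ω => ?_
      rw [norm_mul, norm_mul]
      have := C0 ω
      exact mul_le_mul (hC ω) (mul_le_mul (norm_cX_le _ _ _ hδ _ _) (norm_cX_le _ _ _ hδ _ _) (norm_nonneg _)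
        (by positivity)) (by positivity) this
    rw [integral_add i0 (by exact (i1 h1 θ h2 η).add ((i1 h2 η h1 θ).add (i2 i))),
      integral_add (i1 h1 θ h2 η) (by exact (i1 h2 η h1 θ).add (i2 i)), integral_add (i1 h2 η h1 θ) (i2 i),
      z h1 θ h2 η, z h2 η h1 θ, ih]
    simp_rw [Finset.sum_range_succ, mul_add]
    rw [integral_add _ (i2 i)]
    · ring
    · simp_rw [Finset.mul_sum]
      exact integrable_finsetSum _ fun j _ => i2 j

lemma jointCF_planar {μ : Measure Ω} [IsProbabilityMeasure μ] {F : ℝ → MeasurableSpace Ω}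
    {B₁ B₂ : ℝ → Ω → ℝ} (h : IsPlanarBM μ F B₁ B₂) : JointCF μ F B₁ B₂ := by
  intro θ η s t hs hst ξ C hξ hC
  have hT : 0 ≤ t - s := sub_nonneg.2 hst
  set T := t - s with hTdef
  have C0 : 0 ≤ C := by
    obtain ⟨ω⟩ : Nonempty Ω := nonempty_of_isProbabilityMeasure μ
    exact (norm_nonneg _).trans (hC ω)
  set LHS := ∫ ω, ξ ω * (cE θ (B₁ t ω - B₁ s ω) T * cE η (B₂ t ω - B₂ s ω) T) ∂μ with hL
  have hξ' : Measurable ξ := hξ.mono (h.1.le s) le_rfl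
  -- bound for each N
  set D : ℝ := Real.exp ((θ ^ 2 + η ^ 2) * T) * (θ ^ 2 * T * Real.exp (θ ^ 2 * T)) *
    (η ^ 2 * T * Real.exp (η ^ 2 * T)) with hD
  have hb : ∀ N : ℕ, 0 < N → ‖LHS - ∫ ω, ξ ω ∂μ‖ ^ 2 ≤ C ^ 2 * (D / N) := by
    intro N hN
    have hN' : (0 : ℝ) < N := by exact_mod_cast hN
    have hN1 : (1 : ℝ) ≤ N := by exact_mod_cast hN
    set δ := T / N with hδ'
    have hδ : 0 ≤ δ := by positivity
    have hδN : δ * N = T := by rw [hδ']; field_simp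
    have htel := planar_telescope h hs hδ θ η N ξ C hξ hC
    rw [hδN, show s + T = t by rw [hTdef]; ring, ← hL] at htel
    rw [htel, add_sub_cancel_left]
    set R : Ω → ℂ := fun ω => ∑ i ∈ Finset.range N, cX θ s δ i (fun t => B₁ t ω) *
          cX η s δ i (fun t => B₂ t ω) with hR
    have e0 : ∀ i : ℕ, s ≤ s + δ * i := fun i => by
      nlinarith [mul_nonneg hδ (Nat.cast_nonneg (α := ℝ) i)]
    have e1 : ∀ i : ℕ, s + δ * i ≤ s + δ * (i + 1) := fun i => by nlinarith
    have hp : ∀ i, ∀ {B : ℝ → Ω → ℝ} (_ : IsBM μ F B) (θ : ℝ),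
        Measurable (fun ω => cX θ s δ i (fun t => B t ω)) := by
      intro i B hB θ
      unfold cX
      exact Measurable.mul ((measurable_cE _ _).comp (hB.inc_meas' (by linarith [e0 i]) (by linarith [e0 i])))
        (((measurable_cE _ _).comp (hB.inc_meas' (by linarith [e0 i]) (by linarith [e0 i, e1 i]))).sub measurable_const)
    have hRm : Measurable R := Finset.measurable_fun_sum _ fun i _ => (hp i h.1 θ).mul (hp i h.2.1 η)
    have hRb : ∃ K, ∀ ω, ‖R ω‖ ≤ K := by
      refine ⟨∑ i ∈ Finset.range N, (Real.exp (θ ^ 2 * (δ * i) / 2) * (Real.exp (θ ^ 2 * δ / 2) + 1))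
          * (Real.exp (η ^ 2 * (δ * i) / 2) * (Real.exp (η ^ 2 * δ / 2) + 1)),
          fun ω => (norm_sum_le _ _).trans (Finset.sum_le_sum fun i _ => ?_)⟩
      rw [norm_mul]
      exact mul_le_mul (norm_cX_le _ _ _ hδ _ _) (norm_cX_le _ _ _ hδ _ _) (norm_nonneg _)
        (by positivity)
    obtain ⟨K, hK⟩ := hRb
    have hRL : MemLp (fun ω => ‖R ω‖) 2 μ :=
      MemLp.of_bound hRm.norm.aestronglyMeasurable K (Eventually.of_forall fun ω => by simpa using hK ω)
    have s1 : ‖∫ ω, ξ ω * R ω ∂μ‖ ≤ C * ∫ ω, ‖R ω‖ ∂μ := by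
      rw [← integral_const_mul]
      refine (norm_integral_le_integral_norm _).trans (integral_mono_of_nonneg
        (Eventually.of_forall fun ω => norm_nonneg _) ((hRL.integrable (by norm_num)).const_mul _)
        (Eventually.of_forall fun ω => ?_))
      simp only [norm_mul]
      exact mul_le_mul_of_nonneg_right (hC ω) (norm_nonneg _)
    have s2 : ∫ ω, ‖R ω‖ ^ 2 ∂μ ≤ D / N := by
      rw [cX_sum_sq h hs hδ]
      have hle : ∀ i ∈ Finset.range N, (Real.exp (θ ^ 2 * (δ * i)) * (Real.exp (θ ^ 2 * δ) - 1)) *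
          (Real.exp (η ^ 2 * (δ * i)) * (Real.exp (η ^ 2 * δ) - 1)) ≤ D / N / N := by
        intro i hi
        have hiN : (i : ℝ) ≤ N := by exact_mod_cast (Finset.mem_range.1 hi).le
        have hiT : δ * i ≤ T := by rw [← hδN]; gcongr
        have hδT : δ ≤ T := by rw [← hδN]; nlinarith
        have q : ∀ x : ℝ, Real.exp (x ^ 2 * δ) - 1 ≤ x ^ 2 * δ * Real.exp (x ^ 2 * T) := fun x => by
          refine exp_sub_one_le.trans ?_
          gcongr
        have q0 : ∀ x : ℝ, 0 ≤ Real.exp (x ^ 2 * δ) - 1 := fun x => by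
          have := Real.add_one_le_exp (x ^ 2 * δ)
          have : 0 ≤ x ^ 2 * δ := by positivity
          linarith
        calc _ ≤ (Real.exp (θ ^ 2 * T) * (θ ^ 2 * δ * Real.exp (θ ^ 2 * T))) *
                (Real.exp (η ^ 2 * T) * (η ^ 2 * δ * Real.exp (η ^ 2 * T))) := by
              have := q θ; have := q η; have := q0 θ; have := q0 η
              gcongr
          _ = D / N / N := by
              rw [hD, add_mul, Real.exp_add, hδ']; field_simp
      calc _ ≤ ∑ i ∈ Finset.range N, D / N / N := Finset.sum_le_sum hle
        _ = D / N := by rw [Finset.sum_const, Finset.card_range, nsmul_eq_mul]; field_simp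
    calc _ ≤ (C * ∫ ω, ‖R ω‖ ∂μ) ^ 2 := by gcongr
      _ = C ^ 2 * (∫ ω, ‖R ω‖ ∂μ) ^ 2 := by ring
      _ ≤ C ^ 2 * (D / N) := by
        gcongr
        exact (sq_integral_le hRL).trans s2
  have hz : ‖LHS - ∫ ω, ξ ω ∂μ‖ ^ 2 ≤ 0 := by
    have ht : Tendsto (fun N : ℕ => C ^ 2 * (D / N)) atTop (nhds (C ^ 2 * 0)) :=
      (tendsto_const_div_atTop_nhds_zero_nat D).const_mul _
    rw [mul_zero] at ht
    exact ge_of_tendsto ht (eventually_atTop.2 ⟨1, fun N hN => hb N hN⟩)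
  have hz2 : LHS = ∫ ω, ξ ω ∂μ := by
    have : ‖LHS - ∫ ω, ξ ω ∂μ‖ = 0 := by
      have := sq_nonneg ‖LHS - ∫ ω, ξ ω ∂μ‖
      exact pow_eq_zero_iff (two_ne_zero) |>.1 (le_antisymm hz this)
    exact sub_eq_zero.1 (norm_eq_zero.1 this)
  rw [← hz2, hL, ← integral_mul_const]
  congr 1; ext ω
  rw [mul_assoc, cE, cE, ← Complex.exp_add, ← Complex.exp_add]
  congr 2; push_cast; ring

-- Elementary stochastic integrals: characteristic functions and isometry

open Classical in
lemma elem_cf {μ : Measure Ω} [IsProbabilityMeasure μ] {F : ℝ → MeasurableSpace Ω}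
    {B₁ B₂ : ℝ → Ω → ℝ} (h1 : IsBM μ F B₁) (h2 : IsBM μ F B₂) (hJ : JointCF μ F B₁ B₂)
    (p : ℕ → ℝ) (hp : Monotone p) (hp0 : 0 ≤ p 0)
    (E : ℕ → Set Ω) (hE : ∀ j, MeasurableSet[F (p j)] (E j))
    (a b a' b' c : ℝ) (hab : a ^ 2 + b ^ 2 = c) (hab' : a' ^ 2 + b' ^ 2 = c)
    (ξ : Ω → ℂ) (C : ℝ) (hξ : Measurable[F (p 0)] ξ) (hC : ∀ ω, ‖ξ ω‖ ≤ C) (n : ℕ) :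
    ∫ ω, ξ ω * Complex.exp (((∑ j ∈ Finset.range n,
        ((if ω ∈ E j then a else a') * (B₁ (p (j + 1)) ω - B₁ (p j) ω) +
         (if ω ∈ E j then b else b') * (B₂ (p (j + 1)) ω - B₂ (p j) ω)) : ℝ) : ℂ) * Complex.I) ∂μ
      = (∫ ω, ξ ω ∂μ) * Complex.exp (((-(c * (p n - p 0) / 2) : ℝ)) : ℂ) := by
  have p0 : ∀ j, 0 ≤ p j := fun j => hp0.trans (hp (Nat.zero_le j))
  induction n with
  | zero => simp
  | succ n ih =>
    set Z : Ω → ℝ := fun ω => ∑ j ∈ Finset.range n,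
        ((if ω ∈ E j then a else a') * (B₁ (p (j + 1)) ω - B₁ (p j) ω) +
         (if ω ∈ E j then b else b') * (B₂ (p (j + 1)) ω - B₂ (p j) ω)) with hZ
    have hEn : ∀ j ≤ n, MeasurableSet[F (p n)] (E j) := fun j hj => h1.mono (hp hj) _ (hE j)
    have hZm : Measurable[F (p n)] Z := by
      refine @Finset.measurable_fun_sum _ _ _ _ _ _ (F (p n)) _ _ fun j hj => ?_
      have hj' := Finset.mem_range.1 hj
      have hm : ∀ x x' : ℝ, Measurable[F (p n)] (fun ω => if ω ∈ E j then x else x') := fun x x' =>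
        Measurable.ite (hEn j hj'.le) measurable_const measurable_const
      exact ((hm _ _).mul (h1.inc_meas (p0 _) (p0 _) (hp hj'.le) (hp hj'))).add
        ((hm _ _).mul (h2.inc_meas (p0 _) (p0 _) (hp hj'.le) (hp hj')))
    have hξn : Measurable[F (p n)] ξ := hξ.mono (h1.mono (hp (Nat.zero_le n))) le_rfl
    have hexp : Measurable (fun x : ℝ => Complex.exp ((x : ℂ) * Complex.I)) := by fun_prop
    set ζ : Ω → ℂ := fun ω => ξ ω * Complex.exp ((Z ω : ℂ) * Complex.I) with hζ
    have hζm : Measurable[F (p n)] ζ := hξn.mul (hexp.comp hZm)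
    have hζb : ∀ ω, ‖ζ ω‖ ≤ C := fun ω => by
      rw [hζ, norm_mul, Complex.norm_exp_ofReal_mul_I, mul_one]; exact hC ω
    have C0 : 0 ≤ C := by
      obtain ⟨ω⟩ : Nonempty Ω := nonempty_of_isProbabilityMeasure μ
      exact (norm_nonneg _).trans (hC ω)
    have i1 : Measurable[F (p n)] ((E n).indicator ζ) := hζm.indicator (hE n)
    have i2 : Measurable[F (p n)] ((E n)ᶜ.indicator ζ) := hζm.indicator (hE n).compl
    have b1 : ∀ S : Set Ω, ∀ ω, ‖S.indicator ζ ω‖ ≤ C := fun S ω =>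
      (norm_indicator_le_norm_self _ _).trans (hζb ω)
    have e1 := hJ a b (p n) (p (n+1)) (p0 n) (hp (Nat.le_succ n)) _ C i1 (b1 _)
    have e2 := hJ a' b' (p n) (p (n+1)) (p0 n) (hp (Nat.le_succ n)) _ C i2 (b1 _)
    rw [hab] at e1; rw [hab'] at e2
    have hsum : ∀ ω, ξ ω * Complex.exp (((∑ j ∈ Finset.range (n+1),
        ((if ω ∈ E j then a else a') * (B₁ (p (j + 1)) ω - B₁ (p j) ω) +
         (if ω ∈ E j then b else b') * (B₂ (p (j + 1)) ω - B₂ (p j) ω)) : ℝ) : ℂ) * Complex.I)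
        = (E n).indicator ζ ω * Complex.exp (((a * (B₁ (p (n + 1)) ω - B₁ (p n) ω) +
            b * (B₂ (p (n + 1)) ω - B₂ (p n) ω) : ℝ) : ℂ) * Complex.I)
        + (E n)ᶜ.indicator ζ ω * Complex.exp (((a' * (B₁ (p (n + 1)) ω - B₁ (p n) ω) +
            b' * (B₂ (p (n + 1)) ω - B₂ (p n) ω) : ℝ) : ℂ) * Complex.I) := by
      intro ω
      rw [Finset.sum_range_succ, Complex.ofReal_add, add_mul, Complex.exp_add, ← mul_assoc]
      by_cases hω : ω ∈ E n
      · simp only [hω, if_true, indicator_of_mem, mem_compl_iff, not_true_eq_false,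
          not_false_eq_true, indicator_of_notMem, zero_mul, add_zero]
        rfl
      · simp only [hω, if_false, indicator_of_mem, mem_compl_iff,
          not_false_eq_true, indicator_of_notMem, zero_mul, zero_add]
        rfl
    simp_rw [hsum]
    have im : ∀ (S : Set Ω), MeasurableSet S → ∀ x y : ℝ, Integrable (fun ω => S.indicator ζ ω *
        Complex.exp (((x * (B₁ (p (n + 1)) ω - B₁ (p n) ω) +
            y * (B₂ (p (n + 1)) ω - B₂ (p n) ω) : ℝ) : ℂ) * Complex.I)) μ := by
      intro S hS x y
      refine integrable_of_bdd (C := C) (((hζm.mono (h1.le _) le_rfl).indicator hS).mul (hexp.comp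
        (((h1.inc_meas' (p0 _) (p0 _)).const_mul _).add ((h2.inc_meas' (p0 _) (p0 _)).const_mul _))))
        fun ω => ?_
      rw [norm_mul, Complex.norm_exp_ofReal_mul_I, mul_one]; exact b1 _ _
    rw [integral_add (im _ (h1.le _ _ (hE n)) _ _) (im _ (h1.le _ _ (hE n)).compl _ _), e1, e2,
      ← add_mul]
    have hζi : Integrable ζ μ := integrable_of_bdd (hζm.mono (h1.le _) le_rfl) hζb
    rw [integral_indicator (h1.le _ _ (hE n)), integral_indicator (h1.le _ _ (hE n)).compl,
      integral_add_compl (h1.le _ _ (hE n)) hζi, ih, mul_assoc, ← Complex.exp_add]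
    congr 2; push_cast; ring

/-- covariance of two elementary integrals -/
lemma IsBM.cov_aux {μ : Measure Ω} [IsProbabilityMeasure μ] {F : ℝ → MeasurableSpace Ω}
    {B : ℝ → Ω → ℝ} (h : IsBM μ F B) {a b c d : ℝ} (ha : 0 ≤ a) (hab : a ≤ b) (hac : a ≤ c) (hcd : c ≤ d)
    {ξ η : Ω → ℝ} (hξ : Measurable[F a] ξ) (hη : Measurable[F c] η) {C D : ℝ}
    (hC : ∀ ω, |ξ ω| ≤ C) (hD : ∀ ω, |η ω| ≤ D) :
    ∫ ω, (ξ ω * (B b ω - B a ω)) * (η ω * (B d ω - B c ω)) ∂μ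
      = (∫ ω, ξ ω * η ω ∂μ) * max (min b d - c) 0 := by
  have hξ' : Measurable[F c] ξ := hξ.mono (h.mono hac) le_rfl
  have hc : 0 ≤ c := ha.trans hac
  -- orthogonality
  have orth : ∀ {u v : ℝ} {ζ : Ω → ℝ}, 0 ≤ u → u ≤ v → Measurable[F u] ζ →
      ∫ ω, ζ ω * (B v ω - B u ω) ∂μ = 0 := by
    intro u v ζ hu huv hζ
    rw [h.integral_mul hu huv hζ (g := fun x => x) measurable_id, h.integral_inc_one hu huv, mul_zero]
  have sq : ∀ {u v : ℝ} {ζ : Ω → ℝ}, 0 ≤ u → u ≤ v → Measurable[F u] ζ →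
      ∫ ω, ζ ω * (B v ω - B u ω) ^ 2 ∂μ = (∫ ω, ζ ω ∂μ) * (v - u) := by
    intro u v ζ hu huv hζ
    rw [h.integral_mul hu huv hζ (g := fun x => x ^ 2) (by fun_prop), h.integral_inc_sq hu huv]
  have hintb : ∀ {u v u' v' : ℝ}, 0 ≤ u → u ≤ v → 0 ≤ u' → u' ≤ v' →
      Integrable (fun ω => ξ ω * η ω * ((B v ω - B u ω) * (B v' ω - B u' ω))) μ := by
    intro u v u' v' hu huv hu' huv'
    have i0 : Integrable (fun ω => (B v ω - B u ω) * (B v' ω - B u' ω)) μ :=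
      MemLp.integrable_mul (p := 2) (q := 2) (h.memLp_inc hu huv (by norm_num))
        (h.memLp_inc hu' huv' (by norm_num))
    refine i0.bdd_mul (c := C * D) ((hξ.mono (h.le _) le_rfl).mul (hη.mono (h.le _) le_rfl)).aestronglyMeasurable
      (Eventually.of_forall fun ω => ?_)
    rw [norm_mul]
    exact mul_le_mul (hC ω) (hD ω) (norm_nonneg _) ((abs_nonneg _).trans (hC ω))
  rcases le_total b c with hbc | hcb
  · have : max (min b d - c) 0 = 0 := max_eq_right (by linarith [min_le_left b d])
    rw [this, mul_zero]
    rw [← orth hc hcd (ζ := fun ω => (ξ ω * (B b ω - B a ω)) * η ω)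
      ((hξ'.mul (h.inc_meas ha (ha.trans hab) hac hbc)).mul hη)]
    congr 1; ext ω; ring
  · have e1 : ∀ ω, (ξ ω * (B b ω - B a ω)) * (η ω * (B d ω - B c ω)) =
        ξ ω * η ω * ((B c ω - B a ω) * (B d ω - B c ω)) + ξ ω * η ω * ((B b ω - B c ω) * (B d ω - B c ω)) := by
      intro ω; ring
    simp_rw [e1]
    rw [integral_add (hintb ha hac hc hcd) (hintb hc hcb hc hcd)]
    have z1 : ∫ ω, ξ ω * η ω * ((B c ω - B a ω) * (B d ω - B c ω)) ∂μ = 0 := by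
      rw [← orth hc hcd (ζ := fun ω => (ξ ω * (B c ω - B a ω)) * η ω)
        ((hξ'.mul (h.inc_meas ha hc hac le_rfl)).mul hη)]
      congr 1; ext ω; ring
    have key : ∀ {b d : ℝ}, c ≤ b → b ≤ d →
        ∫ ω, ξ ω * η ω * ((B b ω - B c ω) * (B d ω - B c ω)) ∂μ = (∫ ω, ξ ω * η ω ∂μ) * (b - c) := by
      intro b d hcb hbd
      have e2 : ∀ ω, ξ ω * η ω * ((B b ω - B c ω) * (B d ω - B c ω)) =
        ξ ω * η ω * ((B b ω - B c ω) * (B d ω - B b ω)) + ξ ω * η ω * ((B b ω - B c ω) * (B b ω - B c ω)) := by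
        intro ω; ring
      simp_rw [e2]
      rw [integral_add (hintb hc hcb (hc.trans hcb) hbd) (hintb hc hcb hc hcb)]
      have z2 : ∫ ω, ξ ω * η ω * ((B b ω - B c ω) * (B d ω - B b ω)) ∂μ = 0 := by
        rw [← orth (hc.trans hcb) hbd (ζ := fun ω => (ξ ω * η ω) * (B b ω - B c ω))
          (((hξ'.mul hη).mono (h.mono hcb) le_rfl).mul (h.inc_meas hc (hc.trans hcb) hcb le_rfl))]
        congr 1; ext ω; ring
      rw [z2, zero_add, ← sq hc hcb (ζ := fun ω => ξ ω * η ω) (hξ'.mul hη)]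
      congr 1; ext ω; ring
    rw [z1, zero_add]
    rcases le_total b d with hbd | hdb
    · rw [key hcb hbd, min_eq_left hbd, max_eq_left (by linarith)]
    · rw [min_eq_right hdb, max_eq_left (by linarith), ← key hcd hdb]
      congr 1; ext ω; ring

lemma IsBM.cov {μ : Measure Ω} [IsProbabilityMeasure μ] {F : ℝ → MeasurableSpace Ω}
    {B : ℝ → Ω → ℝ} (h : IsBM μ F B) {a b c d : ℝ} (ha : 0 ≤ a) (hab : a ≤ b) (hc : 0 ≤ c) (hcd : c ≤ d)
    {ξ η : Ω → ℝ} (hξ : Measurable[F a] ξ) (hη : Measurable[F c] η) {C D : ℝ}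
    (hC : ∀ ω, |ξ ω| ≤ C) (hD : ∀ ω, |η ω| ≤ D) :
    ∫ ω, (ξ ω * (B b ω - B a ω)) * (η ω * (B d ω - B c ω)) ∂μ
      = (∫ ω, ξ ω * η ω ∂μ) * volume.real (Ioc a b ∩ Ioc c d) := by
  have hv : volume.real (Ioc a b ∩ Ioc c d) = max (min b d - max a c) 0 := by
    rw [Ioc_inter_Ioc, Real.volume_real_Ioc]
  rcases le_total a c with hac | hca
  · rw [h.cov_aux ha hab hac hcd hξ hη hC hD, hv, max_eq_right hac]
  · have := h.cov_aux hc hcd hca hab hη hξ hD hC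
    rw [hv, max_eq_left hca, min_comm b d]
    simp_rw [mul_comm (η _) (ξ _)] at this
    rw [← this]
    congr 1; ext ω; ring

/-- Itô isometry for elementary families -/
lemma IsBM.isometry {μ : Measure Ω} [IsProbabilityMeasure μ] {F : ℝ → MeasurableSpace Ω}
    {B : ℝ → Ω → ℝ} (h : IsBM μ F B) {ι : Type*} (s : Finset ι) (a b : ι → ℝ) (ξ : ι → Ω → ℝ)
    (ha : ∀ k ∈ s, 0 ≤ a k) (hab : ∀ k ∈ s, a k ≤ b k) (hξ : ∀ k ∈ s, Measurable[F (a k)] (ξ k))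
    (C : ℝ) (hC : ∀ k ∈ s, ∀ ω, |ξ k ω| ≤ C) :
    ∫ ω, (∑ k ∈ s, ξ k ω * (B (b k) ω - B (a k) ω)) ^ 2 ∂μ
      = ∫ u : ℝ, ∫ ω, (∑ k ∈ s, (Ioc (a k) (b k)).indicator (fun _ => ξ k ω) u) ^ 2 ∂μ := by
  have hI : ∀ k ∈ s, ∀ l ∈ s, Integrable (fun ω => (ξ k ω * (B (b k) ω - B (a k) ω)) *
      (ξ l ω * (B (b l) ω - B (a l) ω))) μ := by
    intro k hk l hl
    have hm : ∀ k ∈ s, MemLp (fun ω => ξ k ω * (B (b k) ω - B (a k) ω)) 2 μ := fun k hk => by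
      have := MemLp.mul (p := ⊤) (q := 2) (r := 2) (h.memLp_inc (ha k hk) (hab k hk) (p := 2) (by norm_num))
        (memLp_top_of_bound (((hξ k hk).mono (h.le _) le_rfl).aestronglyMeasurable) C
          (Eventually.of_forall (hC k hk)))
      exact this
    exact MemLp.integrable_mul (p := 2) (q := 2) (hm k hk) (hm l hl)
  have hJ : ∀ k ∈ s, ∀ l ∈ s, Integrable (fun ω => ξ k ω * ξ l ω) μ := by
    intro k hk l hl
    refine integrable_of_bdd (C := C * C) (((hξ k hk).mono (h.le _) le_rfl).mul
      ((hξ l hl).mono (h.le _) le_rfl)) fun ω => ?_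
    rw [norm_mul]
    exact mul_le_mul (hC k hk ω) (hC l hl ω) (norm_nonneg _) ((abs_nonneg _).trans (hC k hk ω))
  have e1 : ∫ ω, (∑ k ∈ s, ξ k ω * (B (b k) ω - B (a k) ω)) ^ 2 ∂μ
      = ∑ k ∈ s, ∑ l ∈ s, (∫ ω, ξ k ω * ξ l ω ∂μ) * volume.real (Ioc (a k) (b k) ∩ Ioc (a l) (b l)) := by
    simp_rw [_root_.sq, Finset.sum_mul_sum]
    rw [integral_finsetSum _ (fun k hk => integrable_finsetSum _ (fun l hl => hI k hk l hl))]
    refine Finset.sum_congr rfl fun k hk => ?_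
    rw [integral_finsetSum _ (fun l hl => hI k hk l hl)]
    exact Finset.sum_congr rfl fun l hl => h.cov (ha k hk) (hab k hk) (ha l hl) (hab l hl) (hξ k hk)
      (hξ l hl) (hC k hk) (hC l hl)
  have e2 : ∀ u : ℝ, ∫ ω, (∑ k ∈ s, (Ioc (a k) (b k)).indicator (fun _ => ξ k ω) u) ^ 2 ∂μ
      = ∑ k ∈ s, ∑ l ∈ s, (Ioc (a k) (b k) ∩ Ioc (a l) (b l)).indicator
          (fun _ => ∫ ω, ξ k ω * ξ l ω ∂μ) u := by
    intro u
    have e3 : ∀ ω, (∑ k ∈ s, (Ioc (a k) (b k)).indicator (fun _ => ξ k ω) u) ^ 2 =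
        ∑ k ∈ s, ∑ l ∈ s, (Ioc (a k) (b k) ∩ Ioc (a l) (b l)).indicator (fun _ => ξ k ω * ξ l ω) u := by
      intro ω
      rw [_root_.sq, Finset.sum_mul_sum]
      refine Finset.sum_congr rfl fun k hk => Finset.sum_congr rfl fun l hl => ?_
      by_cases h1 : u ∈ Ioc (a k) (b k) <;> by_cases h2 : u ∈ Ioc (a l) (b l) <;>
        simp [indicator, h1, h2]
    simp_rw [e3]
    have hi : ∀ k ∈ s, ∀ l ∈ s, Integrable (fun ω => (Ioc (a k) (b k) ∩ Ioc (a l) (b l)).indicator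
        (fun _ => ξ k ω * ξ l ω) u) μ := by
      intro k hk l hl
      by_cases h1 : u ∈ Ioc (a k) (b k) ∩ Ioc (a l) (b l)
      · simpa only [indicator_of_mem h1] using hJ k hk l hl
      · simp only [indicator_of_notMem h1]; exact integrable_zero _ _ _
    rw [integral_finsetSum _ (fun k hk => integrable_finsetSum _ (fun l hl => hi k hk l hl))]
    refine Finset.sum_congr rfl fun k hk => ?_
    rw [integral_finsetSum _ (fun l hl => hi k hk l hl)]
    refine Finset.sum_congr rfl fun l hl => ?_
    by_cases h1 : u ∈ Ioc (a k) (b k) ∩ Ioc (a l) (b l)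
    · simp only [indicator_of_mem h1]
    · simp only [indicator_of_notMem h1]; simp
  simp_rw [e2]
  have hms : ∀ k l, MeasurableSet (Ioc (a k) (b k) ∩ Ioc (a l) (b l)) := fun k l =>
    measurableSet_Ioc.inter measurableSet_Ioc
  have hi : ∀ k l, Integrable (fun u : ℝ => (Ioc (a k) (b k) ∩ Ioc (a l) (b l)).indicator
          (fun _ => ∫ ω, ξ k ω * ξ l ω ∂μ) u) := by
    intro k l
    rw [integrable_indicator_iff (hms k l)]
    exact integrableOn_const (by
      rw [Ioc_inter_Ioc]; exact measure_Ioc_lt_top.ne) (by simp)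
  rw [e1, integral_finsetSum _ (fun k hk => integrable_finsetSum _ (fun l hl => hi k l))]
  refine Finset.sum_congr rfl fun k hk => ?_
  rw [integral_finsetSum _ (fun l hl => hi k l)]
  refine Finset.sum_congr rfl fun l hl => ?_
  rw [integral_indicator (hms k l), setIntegral_const, smul_eq_mul, mul_comm]

-- Consequences of the joint characteristic function identity

lemma JointCF.swap {μ : Measure Ω} {F : ℝ → MeasurableSpace Ω} {W Q : ℝ → Ω → ℝ}
    (h : JointCF μ F W Q) : JointCF μ F Q W := by
  intro θ η s t hs hst ξ C hξ hC
  have := h η θ s t hs hst ξ C hξ hC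
  rw [add_comm (θ ^ 2)]
  rw [← this]
  congr 1; ext ω; rw [add_comm]

lemma JointCF.map_restrict {μ : Measure Ω} [IsProbabilityMeasure μ] {F : ℝ → MeasurableSpace Ω}
    {W Q : ℝ → Ω → ℝ} (h : JointCF μ F W Q) (hle : ∀ t, F t ≤ m)
    (hW : ∀ t, 0 ≤ t → Measurable (W t)) {s t : ℝ} (hs : 0 ≤ s) (hst : s ≤ t)
    {A : Set Ω} (hA : MeasurableSet[F s] A) :
    (μ.restrict A).map (fun ω => W t ω - W s ω)
      = (μ A) • gaussianReal 0 ((t - s).toNNReal) := by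
  have hA' := hle s A hA
  have hm : Measurable (fun ω => W t ω - W s ω) := (hW t (hs.trans hst)).sub (hW s hs)
  haveI : IsFiniteMeasure ((μ A) • gaussianReal 0 ((t - s).toNNReal)) :=
    Measure.smul_finite _ (measure_ne_top _ _)
  apply Measure.ext_of_charFun
  ext θ
  rw [charFun_apply_real, charFun_apply_real, integral_map hm.aemeasurable
    (by apply Measurable.aestronglyMeasurable; fun_prop), integral_smul_measure,
    ← charFun_apply_real, charFun_gaussianReal]
  have h1 := h θ 0 s t hs hst (A.indicator fun _ => (1 : ℂ)) 1
    (Measurable.indicator measurable_const hA)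
    (fun ω => by by_cases hω : ω ∈ A <;> simp [hω])
  rw [integral_indicator hA'] at h1
  have h2 : ∀ ω, (A.indicator (fun _ => (1 : ℂ)) ω) *
      Complex.exp (((θ * (W t ω - W s ω) + 0 * (Q t ω - Q s ω) : ℝ) : ℂ) * Complex.I)
      = A.indicator (fun ω => Complex.exp (θ * ((W t ω - W s ω : ℝ) : ℂ) * Complex.I)) ω := by
    intro ω
    by_cases hω : ω ∈ A <;> simp [hω]
  simp only [h2] at h1
  rw [integral_indicator hA'] at h1
  rw [h1]
  have h0 : 0 ≤ t - s := sub_nonneg.2 hst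
  have h3 : (((t - s).toNNReal : ℝ) : ℂ) = ((t - s : ℝ) : ℂ) := by
    rw [Real.coe_toNNReal _ h0]
  have h4 : (((t - s).toNNReal : ℂ)) = ((t - s : ℝ) : ℂ) := h3
  rw [h4]
  simp [Measure.real]
  left; congr 1; ring

lemma JointCF.isBM {μ : Measure Ω} [IsProbabilityMeasure μ] {F : ℝ → MeasurableSpace Ω}
    {W Q : ℝ → Ω → ℝ} (h : JointCF μ F W Q) (hle : ∀ t, F t ≤ m) (hmono : Monotone F)
    (had : ∀ t, 0 ≤ t → Measurable[F t] (W t)) (h0 : ∀ᵐ ω ∂μ, W 0 ω = 0)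
    (hc : ∀ᵐ ω ∂μ, Continuous fun t => W t ω) : IsBM μ F W := by
  have hm : ∀ t, 0 ≤ t → Measurable (W t) := fun t ht => (had t ht).mono (hle t) le_rfl
  have hlaw : ∀ s t : ℝ, 0 ≤ s → s ≤ t →
      μ.map (fun ω => W t ω - W s ω) = gaussianReal 0 ((t - s).toNNReal) := by
    intro s t hs hst
    have := h.map_restrict hle hm hs hst (A := univ) MeasurableSet.univ
    simpa using this
  refine ⟨hle, hmono, fun t ht => measurable_iff_comap_le.1 (had t ht), h0, hc, hlaw, ?_⟩
  intro s t hs hst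
  have hd : Measurable (fun ω => W t ω - W s ω) := (hm t (hs.trans hst)).sub (hm s hs)
  rw [Indep_iff]
  rintro _ A ⟨D, hD, rfl⟩ hA
  have h1 := h.map_restrict hle hm hs hst hA
  have h2 := congrArg (fun ν => ν D) h1
  simp only [Measure.smul_apply, smul_eq_mul] at h2
  rw [Measure.map_apply hd hD, Measure.restrict_apply (hd hD)] at h2
  rw [h2, ← hlaw s t hs hst, Measure.map_apply hd hD, mul_comm]

lemma JointCF.finCF {μ : Measure Ω} [IsProbabilityMeasure μ] {F : ℝ → MeasurableSpace Ω}
    {W Q : ℝ → Ω → ℝ} (h : JointCF μ F W Q) (hW : IsBM μ F W) (hQ : IsBM μ F Q)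
    (K : Finset ℝ) : (∀ u ∈ K, 0 ≤ u) → ∀ v, 0 ≤ v → (∀ u ∈ K, u ≤ v) →
    ∀ (α β : ℝ → ℝ) (a b : ℝ),
    ∫ ω, Complex.exp ((((∑ u ∈ K, (α u * W u ω + β u * Q u ω)) + (a * W v ω + b * Q v ω) : ℝ) : ℂ)
        * Complex.I) ∂μ
      = (∫ ω, Complex.exp ((((∑ u ∈ K, α u * W u ω) + a * W v ω : ℝ) : ℂ) * Complex.I) ∂μ) *
        ∫ ω, Complex.exp ((((∑ u ∈ K, β u * Q u ω) + b * Q v ω : ℝ) : ℂ) * Complex.I) ∂μ := by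
  induction K using Finset.induction_on_max with
  | empty =>
    intro _ v hv _ α β a b
    have key : ∀ a b : ℝ, ∫ ω, Complex.exp (((a * W v ω + b * Q v ω : ℝ) : ℂ) * Complex.I) ∂μ
        = Complex.exp (((-((a ^ 2 + b ^ 2) * (v - 0) / 2) : ℝ)) : ℂ) := by
      intro a b
      have := h a b 0 v le_rfl hv (fun _ => 1) 1 measurable_const (fun _ => by simp)
      simp only [one_mul, integral_const, probReal_univ, one_smul] at this
      rw [← this]
      apply integral_congr_ae
      filter_upwards [hW.init, hQ.init] with ω h1 h2
      rw [h1, h2, sub_zero, sub_zero]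
    have k1 := key a b
    have k2 := key a 0
    have k3 := key 0 b
    simp only [Finset.sum_empty, zero_add, zero_mul, add_zero] at k1 k2 k3 ⊢
    rw [k1, k2, k3, ← Complex.exp_add]
    congr 1
    push_cast; ring
  | insert w K hw ih =>
    intro hK v hv hKv α β a b
    have hwK : w ∉ K := fun hh => lt_irrefl _ (hw w hh)
    have hw0 : 0 ≤ w := hK w (Finset.mem_insert_self _ _)
    have hwv : w ≤ v := hKv w (Finset.mem_insert_self _ _)
    have hK' : ∀ u ∈ K, 0 ≤ u := fun u hu => hK u (Finset.mem_insert_of_mem hu)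
    have hKw : ∀ u ∈ K, u ≤ w := fun u hu => (hw u hu).le
    have key : ∀ (α β : ℝ → ℝ) (a b : ℝ),
      ∫ ω, Complex.exp ((((∑ u ∈ insert w K, (α u * W u ω + β u * Q u ω)) +
        (a * W v ω + b * Q v ω) : ℝ) : ℂ) * Complex.I) ∂μ =
      (∫ ω, Complex.exp ((((∑ u ∈ K, (α u * W u ω + β u * Q u ω)) +
        ((α w + a) * W w ω + (β w + b) * Q w ω) : ℝ) : ℂ) * Complex.I) ∂μ) *
        Complex.exp (((-((a ^ 2 + b ^ 2) * (v - w) / 2) : ℝ)) : ℂ) := by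
      intro α β a b
      have hm : Measurable[F w] (fun ω => Complex.exp ((((∑ u ∈ K, (α u * W u ω + β u * Q u ω)) +
        ((α w + a) * W w ω + (β w + b) * Q w ω) : ℝ) : ℂ) * Complex.I)) := by
        have m1 := hW.meas hw0 le_rfl
        have m2 := hQ.meas hw0 le_rfl
        have m3 : Measurable[F w] (fun ω => ∑ u ∈ K, (α u * W u ω + β u * Q u ω)) := by
          apply Finset.measurable_fun_sum
          intro u hu
          exact ((hW.meas (hK' u hu) (hKw u hu)).const_mul _).add
            ((hQ.meas (hK' u hu) (hKw u hu)).const_mul _)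
        have m4 : Measurable[F w] (fun ω => (∑ u ∈ K, (α u * W u ω + β u * Q u ω)) +
          ((α w + a) * W w ω + (β w + b) * Q w ω)) :=
          m3.add ((m1.const_mul _).add (m2.const_mul _))
        exact (Complex.measurable_exp.comp ((Complex.measurable_ofReal.mul_const _))).comp m4
      rw [← h a b w v hw0 hwv _ 1 hm (fun ω => (Complex.norm_exp_ofReal_mul_I _).le)]
      congr 1; ext ω
      rw [← Complex.exp_add, Finset.sum_insert hwK]
      congr 1; push_cast; ring
    have k1 := key α β a b
    have k2 := key α 0 a 0
    have k3 := key 0 β 0 b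
    have i1 := ih hK' w hw0 hKw α β (α w + a) (β w + b)
    simp only [Pi.zero_apply, zero_mul, add_zero, zero_add] at k2 k3
    rw [k1, k2, k3, i1, mul_mul_mul_comm, ← Complex.exp_add]
    congr 2
    push_cast; ring

lemma JointCF.indepFun_fin {μ : Measure Ω} [IsProbabilityMeasure μ] {F : ℝ → MeasurableSpace Ω}
    {W Q : ℝ → Ω → ℝ} (h : JointCF μ F W Q) (hW : IsBM μ F W) (hQ : IsBM μ F Q)
    (I J : Finset {t : ℝ // 0 ≤ t}) :
    IndepFun (fun ω (i : I) => W i.1.1 ω) (fun ω (j : J) => Q j.1.1 ω) μ := by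
  classical
  have hX : Measurable (fun ω (i : I) => W i.1.1 ω) :=
    measurable_pi_lambda _ fun i => hW.meas' i.1.2
  have hY : Measurable (fun ω (i : J) => Q i.1.1 ω) :=
    measurable_pi_lambda _ fun i => hQ.meas' i.1.2
  rw [indepFun_iff_charFunDual_prod hX.aemeasurable hY.aemeasurable]
  intro L
  rw [charFunDual_apply, charFunDual_apply, charFunDual_apply,
    integral_map (hX.prodMk hY).aemeasurable (by
      apply Measurable.aestronglyMeasurable; fun_prop),
    integral_map hX.aemeasurable (by apply Measurable.aestronglyMeasurable; fun_prop),
    integral_map hY.aemeasurable (by apply Measurable.aestronglyMeasurable; fun_prop)]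
  set L1 : (I → ℝ) →L[ℝ] ℝ := L.comp (.inl ℝ _ _) with hL1
  set L2 : (J → ℝ) →L[ℝ] ℝ := L.comp (.inr ℝ _ _) with hL2
  have hL : ∀ x y, L (x, y) = L1 x + L2 y := by
    intro x y
    simp only [hL1, hL2, ContinuousLinearMap.comp_apply, ContinuousLinearMap.inl_apply,
      ContinuousLinearMap.inr_apply, ← map_add]
    simp
  set α : ℝ → ℝ := fun u => if hu : ∃ i : I, i.1.1 = u then L1 (Pi.single hu.choose 1) else 0 with hα
  set β : ℝ → ℝ := fun u => if hu : ∃ i : J, i.1.1 = u then L2 (Pi.single hu.choose 1) else 0 with hβ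
  have hαi : ∀ i : I, α i.1.1 = L1 (Pi.single i 1) := by
    intro i
    have hu : ∃ j : I, j.1.1 = i.1.1 := ⟨i, rfl⟩
    simp only [hα]; rw [dif_pos hu]
    have : hu.choose = i := Subtype.ext (Subtype.ext hu.choose_spec)
    rw [this]
  have hβi : ∀ i : J, β i.1.1 = L2 (Pi.single i 1) := by
    intro i
    have hu : ∃ j : J, j.1.1 = i.1.1 := ⟨i, rfl⟩
    simp only [hβ]; rw [dif_pos hu]
    have : hu.choose = i := Subtype.ext (Subtype.ext hu.choose_spec)
    rw [this]
  have dec : ∀ (K : Finset {t : ℝ // 0 ≤ t}) (M : (K → ℝ) →L[ℝ] ℝ) (x : K → ℝ),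
      M x = ∑ i, M (Pi.single i 1) * x i := by
    intro K M x
    conv_lhs => rw [pi_eq_sum_univ' x]
    rw [map_sum]
    refine Finset.sum_congr rfl fun i _ => ?_
    rw [map_smul, smul_eq_mul, mul_comm]
  set K : Finset ℝ := I.image Subtype.val ∪ J.image Subtype.val with hK
  have hKpos : ∀ u ∈ K, 0 ≤ u := by
    intro u hu
    simp only [hK, Finset.mem_union, Finset.mem_image] at hu
    rcases hu with ⟨x, _, rfl⟩ | ⟨x, _, rfl⟩ <;> exact x.2
  have hs1 : ∀ f : ℝ → ℝ, L1 (fun i => f i.1.1) = ∑ u ∈ K, α u * f u := by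
    intro f
    rw [dec I L1]
    have e1 : ∑ i : I, L1 (Pi.single i 1) * f i.1.1 = ∑ u ∈ I.image Subtype.val, α u * f u := by
      rw [Finset.sum_image (fun x _ y _ hxy => Subtype.ext hxy), ← Finset.sum_coe_sort I]
      exact Finset.sum_congr rfl fun i _ => by rw [hαi]
    rw [e1]
    apply Finset.sum_subset Finset.subset_union_left
    intro u _ hu
    have : α u = 0 := by
      simp only [hα]; rw [dif_neg]
      rintro ⟨i, rfl⟩
      exact hu (Finset.mem_image_of_mem _ i.2)
    rw [this, zero_mul]
  have hs2 : ∀ f : ℝ → ℝ, L2 (fun i => f i.1.1) = ∑ u ∈ K, β u * f u := by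
    intro f
    rw [dec J L2]
    have e1 : ∑ i : J, L2 (Pi.single i 1) * f i.1.1 = ∑ u ∈ J.image Subtype.val, β u * f u := by
      rw [Finset.sum_image (fun x _ y _ hxy => Subtype.ext hxy), ← Finset.sum_coe_sort J]
      exact Finset.sum_congr rfl fun i _ => by rw [hβi]
    rw [e1]
    apply Finset.sum_subset Finset.subset_union_right
    intro u _ hu
    have : β u = 0 := by
      simp only [hβ]; rw [dif_neg]
      rintro ⟨i, rfl⟩
      exact hu (Finset.mem_image_of_mem _ i.2)
    rw [this, zero_mul]
  have main := h.finCF hW hQ K hKpos (∑ u ∈ K, u) (Finset.sum_nonneg hKpos)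
    (fun u hu => Finset.single_le_sum (f := fun u => u) hKpos hu) α β 0 0
  simp only [zero_mul, add_zero] at main
  have g1 : ∀ ω, L1 (fun i => W i.1.1 ω) = ∑ u ∈ K, α u * W u ω := fun ω => hs1 fun u => W u ω
  have g2 : ∀ ω, L2 (fun i => Q i.1.1 ω) = ∑ u ∈ K, β u * Q u ω := fun ω => hs2 fun u => Q u ω
  simp only [hL, g1, g2]
  rw [← main]
  simp only [Finset.sum_add_distrib]

lemma JointCF.indepFun {μ : Measure Ω} [IsProbabilityMeasure μ] {F : ℝ → MeasurableSpace Ω}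
    {W Q : ℝ → Ω → ℝ} (h : JointCF μ F W Q) (hW : IsBM μ F W) (hQ : IsBM μ F Q) :
    IndepFun (fun ω (t : {t : ℝ // 0 ≤ t}) => W t.1 ω) (fun ω (t : {t : ℝ // 0 ≤ t}) => Q t.1 ω) μ :=
  IndepFun.process_indepFun_process (X := fun (t : {t : ℝ // 0 ≤ t}) ω => W t.1 ω)
    (Y := fun (t : {t : ℝ // 0 ≤ t}) ω => Q t.1 ω)
    (fun t => hW.meas' t.2) (fun t => hQ.meas' t.2)
    (fun I J => h.indepFun_fin hW hQ I J)

-- Grids and stopped Riemann sums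

/-- left end point of the dyadic cell `(t i / 2^n, t (i+1) / 2^n]` that contains `u` -/
def lpt (t : ℝ) (n : ℕ) (u : ℝ) : ℝ := t * ((⌈2 ^ n * u / t⌉₊ - 1 : ℕ) : ℝ) / 2 ^ n

/-- Riemann sum over the `n`-th grid of `[0,t]` stopped at time `s` -/
def csum (H X : ℝ → Ω → ℝ) (t : ℝ) (n : ℕ) (s : ℝ) (ω : Ω) : ℝ :=
  ∑ i ∈ Finset.range (2 ^ n),
    H (min (t * i / 2 ^ n) s) ω * (X (min (t * (i + 1) / 2 ^ n) s) ω - X (min (t * i / 2 ^ n) s) ω)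

lemma grid_le {t : ℝ} (ht : 0 ≤ t) {n i : ℕ} (hi : i ≤ 2 ^ n) : t * i / 2 ^ n ≤ t := by
  have h2 : (0:ℝ) < 2 ^ n := by positivity
  rw [div_le_iff₀ h2]
  have : (i : ℝ) ≤ 2 ^ n := by exact_mod_cast hi
  exact mul_le_mul_of_nonneg_left this ht

lemma csum_self {H X : ℝ → Ω → ℝ} {t : ℝ} (ht : 0 ≤ t) (n : ℕ) (ω : Ω) :
    csum H X t n t ω = rsum H X t n ω := by
  unfold csum rsum
  refine Finset.sum_congr rfl fun i hi => ?_
  have h1 : t * i / 2 ^ n ≤ t := grid_le ht (Finset.mem_range.1 hi).le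
  have h2 : t * (i + 1) / 2 ^ n ≤ t := by
    have := grid_le ht (n := n) (i := i + 1) (Finset.mem_range.1 hi)
    push_cast at this; exact this
  rw [min_eq_left h1, min_eq_left h2]

lemma lpt_spec {t : ℝ} (ht : 0 < t) (n : ℕ) {u : ℝ} (hu : 0 < u) (hut : u ≤ t) :
    ∃ k : ℕ, k < 2 ^ n ∧ lpt t n u = t * k / 2 ^ n ∧ t * k / 2 ^ n < u ∧ u ≤ t * (k + 1) / 2 ^ n := by
  have h2 : (0:ℝ) < 2 ^ n := by positivity
  have h3 : 0 < 2 ^ n * u / t := by positivity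
  have hc : 0 < ⌈2 ^ n * u / t⌉₊ := Nat.ceil_pos.2 h3
  obtain ⟨k, hk⟩ : ∃ k, ⌈2 ^ n * u / t⌉₊ = k + 1 := ⟨_, (Nat.succ_pred_eq_of_pos hc).symm⟩
  refine ⟨k, ?_, ?_, ?_, ?_⟩
  · have : ⌈2 ^ n * u / t⌉₊ ≤ 2 ^ n := by
      apply Nat.ceil_le.2
      rw [div_le_iff₀ ht]; push_cast
      exact mul_le_mul_of_nonneg_left hut h2.le
    omega
  · unfold lpt; rw [hk]; simp
  · have h4 : ((k : ℕ) : ℝ) < 2 ^ n * u / t := by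
      apply Nat.lt_ceil.1; omega
    rw [lt_div_iff₀ ht] at h4
    rw [div_lt_iff₀ h2]; linarith
  · have h4 := Nat.le_ceil (2 ^ n * u / t)
    rw [hk, div_le_iff₀ ht] at h4
    push_cast at h4
    rw [le_div_iff₀ h2]; linarith

lemma lpt_nonneg {t : ℝ} (ht : 0 ≤ t) (n : ℕ) (u : ℝ) : 0 ≤ lpt t n u := by
  unfold lpt; positivity

lemma lpt_lt {t : ℝ} (ht : 0 < t) (n : ℕ) {u : ℝ} (hu : 0 < u) (hut : u ≤ t) : lpt t n u < u := by
  obtain ⟨k, _, h1, h2, _⟩ := lpt_spec ht n hu hut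
  rw [h1]; exact h2

lemma lpt_ge {t : ℝ} (ht : 0 < t) (n : ℕ) {u : ℝ} (hu : 0 < u) (hut : u ≤ t) :
    u - t / 2 ^ n ≤ lpt t n u := by
  obtain ⟨k, _, h1, _, h2⟩ := lpt_spec ht n hu hut
  rw [h1]
  have : t * (k + 1) / 2 ^ n = t * k / 2 ^ n + t / 2 ^ n := by ring
  linarith

lemma measurable_lpt (t : ℝ) (n : ℕ) : Measurable (lpt t n) := by
  unfold lpt
  have h1 : Measurable (fun u : ℝ => ⌈2 ^ n * u / t⌉₊) :=
    Nat.measurable_ceil.comp (by fun_prop)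
  have h2 : Measurable (fun k : ℕ => t * ((k - 1 : ℕ) : ℝ) / 2 ^ n) := measurable_from_nat
  exact h2.comp h1

lemma tendsto_lpt {t : ℝ} (ht : 0 < t) {u : ℝ} (hu : 0 < u) (hut : u ≤ t) :
    Tendsto (fun n => lpt t n u) atTop (nhds u) := by
  have h0 : Tendsto (fun n : ℕ => u - t / 2 ^ n) atTop (nhds (u - 0)) := by
    apply Tendsto.sub tendsto_const_nhds
    have := (tendsto_pow_atTop_nhds_zero_of_lt_one (r := (1/2 : ℝ)) (by norm_num) (by norm_num)).const_mul t
    simpa [div_eq_mul_inv] using this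
  rw [sub_zero] at h0
  exact tendsto_of_tendsto_of_tendsto_of_le_of_le h0 tendsto_const_nhds
    (fun n => lpt_ge ht n hu hut) (fun n => (lpt_lt ht n hu hut).le)

lemma cell_sum {t : ℝ} (ht : 0 < t) (n : ℕ) {s : ℝ} (hst : s ≤ t) (f : ℝ → ℝ) (u : ℝ) :
    ∑ i ∈ Finset.range (2 ^ n), (Ioc (min (t * i / 2 ^ n) s) (min (t * (i + 1) / 2 ^ n) s)).indicator
      (fun _ => f (min (t * i / 2 ^ n) s)) u = (Ioc 0 s).indicator (fun u => f (lpt t n u)) u := by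
  have h2 : (0:ℝ) < 2 ^ n := by positivity
  by_cases hu : u ∈ Ioc 0 s
  · rw [indicator_of_mem hu]
    obtain ⟨k, hk, h1, h3, h4⟩ := lpt_spec ht n hu.1 (hu.2.trans hst)
    rw [Finset.sum_eq_single k]
    · have hks : t * k / 2 ^ n ≤ s := (h3.trans_le hu.2).le
      rw [min_eq_left hks, indicator_of_mem, h1]
      exact ⟨h3, le_min h4 hu.2⟩
    · intro i _ hik
      apply indicator_of_notMem
      rintro ⟨g1, g2⟩
      apply hik
      have g3 : t * i / 2 ^ n < u := by
        rcases min_lt_iff.1 g1 with h | h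
        · exact h
        · exact absurd hu.2 (not_le.2 h)
      have g4 : u ≤ t * (i + 1) / 2 ^ n := g2.trans (min_le_left _ _)
      have e1 : t * (k : ℝ) / 2 ^ n < t * (i + 1) / 2 ^ n := h3.trans_le g4
      have e2 : t * (i : ℝ) / 2 ^ n < t * (k + 1) / 2 ^ n := g3.trans_le h4
      rw [div_lt_div_iff_of_pos_right h2, mul_lt_mul_iff_right₀ ht] at e1 e2
      have e3 : k < i + 1 := by exact_mod_cast e1
      have e4 : i < k + 1 := by exact_mod_cast e2
      omega
    · intro h; exact absurd (Finset.mem_range.2 hk) h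
  · rw [indicator_of_notMem hu]
    apply Finset.sum_eq_zero
    intro i _
    apply indicator_of_notMem
    rintro ⟨g1, g2⟩
    apply hu
    have hus : u ≤ s := g2.trans (min_le_right _ _)
    have g3 : t * i / 2 ^ n < u := by
        rcases min_lt_iff.1 g1 with h | h
        · exact h
        · exact absurd hus (not_le.2 h)
    exact ⟨lt_of_le_of_lt (by positivity) g3, hus⟩

lemma csum_diff_sq {μ : Measure Ω} [IsProbabilityMeasure μ] {F : ℝ → MeasurableSpace Ω}
    {B : ℝ → Ω → ℝ} (h : IsBM μ F B) {H H' : ℝ → Ω → ℝ}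
    (hH : ∀ u, 0 ≤ u → Measurable[F u] (H u)) (hH' : ∀ u, 0 ≤ u → Measurable[F u] (H' u))
    {C : ℝ} (hC : ∀ u ω, |H u ω| ≤ C) (hC' : ∀ u ω, |H' u ω| ≤ C)
    {t t' s : ℝ} (ht : 0 < t) (ht' : 0 < t') (hs : 0 ≤ s) (hst : s ≤ t) (hst' : s ≤ t') (n n' : ℕ) :
    ∫ ω, (csum H B t n s ω - csum H' B t' n' s ω) ^ 2 ∂μ
      = ∫ u in Ioc 0 s, ∫ ω, (H (lpt t n u) ω - H' (lpt t' n' u) ω) ^ 2 ∂μ := by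
  have h2 : ∀ n : ℕ, (0:ℝ) < 2 ^ n := fun n => by positivity
  set a : ℕ ⊕ ℕ → ℝ := Sum.elim (fun i => min (t * i / 2 ^ n) s) (fun i => min (t' * i / 2 ^ n') s) with ha
  set b : ℕ ⊕ ℕ → ℝ := Sum.elim (fun i => min (t * (i + 1) / 2 ^ n) s)
    (fun i => min (t' * (i + 1) / 2 ^ n') s) with hb
  set ξ : ℕ ⊕ ℕ → Ω → ℝ := Sum.elim (fun i => H (min (t * i / 2 ^ n) s))
    (fun i ω => - H' (min (t' * i / 2 ^ n') s) ω) with hξ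
  have key := h.isometry ((Finset.range (2 ^ n)).disjSum (Finset.range (2 ^ n'))) a b ξ
    (by
      rintro (i | i) _
      · simp only [ha, Sum.elim_inl]; positivity
      · simp only [ha, Sum.elim_inr]; positivity)
    (by
      rintro (i | i) _
      · simp only [ha, hb, Sum.elim_inl]
        gcongr; linarith
      · simp only [ha, hb, Sum.elim_inr]
        gcongr; linarith)
    (by
      rintro (i | i) _
      · simp only [ha, hξ, Sum.elim_inl]
        exact hH _ (by positivity)
      · simp only [ha, hξ, Sum.elim_inr]
        exact Measurable.neg (hH' _ (by positivity))) C
    (by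
      rintro (i | i) _ ω
      · simp only [hξ, Sum.elim_inl]; exact hC _ _
      · simp only [hξ, Sum.elim_inr, abs_neg]; exact hC' _ _)
  have e1 : ∀ ω, csum H B t n s ω - csum H' B t' n' s ω =
      ∑ k ∈ (Finset.range (2 ^ n)).disjSum (Finset.range (2 ^ n')), ξ k ω * (B (b k) ω - B (a k) ω) := by
    intro ω
    rw [Finset.sum_disjSum]
    simp only [ha, hb, hξ, Sum.elim_inl, Sum.elim_inr, neg_mul, Finset.sum_neg_distrib]
    rfl
  simp only [e1]
  rw [key, ← integral_indicator measurableSet_Ioc]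
  congr 1; ext u
  have e2 : ∀ ω, (∑ k ∈ (Finset.range (2 ^ n)).disjSum (Finset.range (2 ^ n')),
      (Ioc (a k) (b k)).indicator (fun _ => ξ k ω) u) =
      (Ioc 0 s).indicator (fun u => H (lpt t n u) ω - H' (lpt t' n' u) ω) u := by
    intro ω
    rw [Finset.sum_disjSum]
    simp only [ha, hb, hξ, Sum.elim_inl, Sum.elim_inr]
    have c1 := cell_sum ht n hst (fun v => H v ω) u
    have c2 := cell_sum ht' n' hst' (fun v => - H' v ω) u
    rw [c1, c2]
    by_cases hu : u ∈ Ioc 0 s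
    · simp only [indicator_of_mem hu]; ring
    · simp only [indicator_of_notMem hu]; ring
  simp only [e2]
  by_cases hu : u ∈ Ioc 0 s
  · simp only [indicator_of_mem hu]
  · simp only [indicator_of_notMem hu]; simp

/-- decomposition of the full sum at an intermediate time -/
lemma rsum_sub_csum {H X : ℝ → Ω → ℝ} {t s : ℝ} (ht : 0 ≤ t) (n : ℕ) (ω : Ω) :
    rsum H X t n ω - csum H X t n s ω = ∑ i ∈ Finset.range (2 ^ n),
      H (t * i / 2 ^ n) ω * (X (max s (t * (i + 1) / 2 ^ n)) ω - X (max s (t * i / 2 ^ n)) ω) := by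
  unfold rsum csum
  rw [← Finset.sum_sub_distrib]
  refine Finset.sum_congr rfl fun i _ => ?_
  have h12 : t * i / 2 ^ n ≤ t * (i + 1) / 2 ^ n := by gcongr; linarith
  rcases le_total s (t * i / 2 ^ n) with h1 | h1
  · have h2 := h1.trans h12
    rw [min_eq_right h1, min_eq_right h2, max_eq_right h1, max_eq_right h2]; ring
  · rw [min_eq_left h1, max_eq_left h1]
    rcases le_total s (t * (i + 1) / 2 ^ n) with h2 | h2
    · rw [min_eq_right h2, max_eq_right h2]; ring
    · rw [min_eq_left h2, max_eq_left h2]; ring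

lemma csum_memLp {μ : Measure Ω} [IsProbabilityMeasure μ] {F : ℝ → MeasurableSpace Ω}
    {B : ℝ → Ω → ℝ} (h : IsBM μ F B) {H : ℝ → Ω → ℝ}
    (hH : ∀ u, 0 ≤ u → Measurable[F u] (H u)) {C : ℝ} (hC : ∀ u ω, |H u ω| ≤ C)
    {t s : ℝ} (ht : 0 ≤ t) (hs : 0 ≤ s) (n : ℕ) : MemLp (csum H B t n s) 2 μ := by
  unfold csum
  have : MemLp (fun ω => ∑ i ∈ Finset.range (2 ^ n), H (min (t * i / 2 ^ n) s) ω *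
    (B (min (t * (i + 1) / 2 ^ n) s) ω - B (min (t * i / 2 ^ n) s) ω)) 2 μ := by
    apply memLp_finsetSum
    intro i _
    have h0 : 0 ≤ min (t * i / 2 ^ n) s := by positivity
    have h12 : min (t * i / 2 ^ n) s ≤ min (t * (i + 1) / 2 ^ n) s := by gcongr; linarith
    exact MemLp.mul (p := ⊤) (q := 2) (r := 2) (h.memLp_inc h0 h12 (p := 2) (by norm_num))
        (memLp_top_of_bound (((hH _ h0).mono (h.le _) le_rfl).aestronglyMeasurable) C
          (Eventually.of_forall (hC _)))
  exact this

-- Averaging over grids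

lemma exists_contMod {μ : Measure Ω} {Y : ℝ → Ω → ℝ} (hY : ∀ t, Measurable (Y t))
    (hc : ∀ᵐ ω ∂μ, Continuous fun t => Y t ω) :
    ∃ Z : ℝ → Ω → ℝ, (∀ ω, Continuous fun t => Z t ω) ∧ (∀ t, Measurable (Z t)) ∧
      ∀ᵐ ω ∂μ, ∀ t, Z t ω = Y t ω := by
  classical
  obtain ⟨N, hN1, hN2, hN3⟩ := exists_measurable_superset_of_null (ae_iff.1 hc)
  refine ⟨fun t ω => if ω ∈ N then 0 else Y t ω, ?_, ?_, ?_⟩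
  · intro ω
    by_cases hω : ω ∈ N
    · simp only [hω, if_true]; exact continuous_const
    · simp only [hω, if_false]
      by_contra h
      exact hω (hN1 h)
  · intro t
    exact Measurable.ite hN2 measurable_const (hY t)
  · have : ∀ᵐ ω ∂μ, ω ∉ N := measure_eq_zero_iff_ae_notMem.1 hN3
    filter_upwards [this] with ω hω t
    simp [hω]

/-- indicator of the nonpositive half line -/
def ai (y : ℝ) : ℝ := if y ≤ 0 then 1 else 0

lemma measurable_ai : Measurable ai :=
  Measurable.ite measurableSet_Iic measurable_const measurable_const

lemma ai_nonneg (y : ℝ) : 0 ≤ ai y := by unfold ai; split_ifs <;> norm_num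
lemma ai_le_one (y : ℝ) : ai y ≤ 1 := by unfold ai; split_ifs <;> norm_num

lemma abs_ai_sub_le (x y : ℝ) : |ai x - ai y| ≤ 1 := by
  unfold ai; split_ifs <;> norm_num

lemma ai_sub_sq (x y : ℝ) : (ai x - ai y) ^ 2 = |ai x - ai y| := by
  unfold ai; split_ifs <;> norm_num

lemma enorm_ai_sub_le (x y : ℝ) : ‖ai x - ai y‖ₑ ≤ 1 := by
  rw [← ofReal_norm_eq_enorm, Real.norm_eq_abs]
  exact ENNReal.ofReal_le_one.2 (abs_ai_sub_le _ _)

/-- continuity of dilations for the indicator of a closed set -/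
lemma dilation_tendsto {y : ℝ → ℝ} (hy : Continuous y) {T x : ℝ} (hT : 0 ≤ T) (hx : 0 < x)
    {r : ℕ → ℝ} (hr : Tendsto r atTop (nhds x)) :
    Tendsto (fun n => ∫⁻ t in Ioc 0 T, ‖ai (y (t * r n)) - ai (y (t * x))‖ₑ) atTop (nhds 0) := by
  have hm : ∀ r : ℝ, Measurable (fun t => ai (y (t * r))) := fun r =>
    measurable_ai.comp (hy.measurable.comp (by fun_prop))
  have hintb : ∀ r : ℝ, Integrable (fun t => ai (y (t * r))) (volume.restrict (Ioc 0 T)) := by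
    intro r
    apply Integrable.of_bound (C := 1) (hm r).aestronglyMeasurable
    refine Eventually.of_forall fun t => ?_
    rw [Real.norm_eq_abs, abs_of_nonneg (ai_nonneg _)]; exact ai_le_one _
  have hii : ∀ a b : ℝ, IntervalIntegrable (fun t => ai (y t)) volume a b := by
    intro a b
    rw [intervalIntegrable_iff]
    apply Measure.integrableOn_of_bounded (M := 1) (by simp)
      (measurable_ai.comp hy.measurable).aestronglyMeasurable
    refine Eventually.of_forall fun t => ?_
    rw [Real.norm_eq_abs, Function.comp_apply, abs_of_nonneg (ai_nonneg _)]; exact ai_le_one _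
  -- signed difference
  have h1 : Tendsto (fun n => ∫ t in Ioc 0 T, (ai (y (t * r n)) - ai (y (t * x)))) atTop (nhds 0) := by
    have e : ∀ r : ℝ, r ≠ 0 → ∫ t in Ioc 0 T, ai (y (t * r)) = r⁻¹ * ∫ t in (0:ℝ)..(T * r), ai (y t) := by
      intro r hr
      rw [← intervalIntegral.integral_of_le hT]
      rw [intervalIntegral.integral_comp_mul_right (fun t => ai (y t)) hr]
      simp
    have hc : Continuous fun b => ∫ t in (0:ℝ)..b, ai (y t) :=
      intervalIntegral.continuous_primitive hii 0
    have h2 : Tendsto (fun n => (r n)⁻¹ * (∫ t in (0:ℝ)..(T * r n), ai (y t)) -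
        x⁻¹ * ∫ t in (0:ℝ)..(T * x), ai (y t)) atTop (nhds (x⁻¹ * (∫ t in (0:ℝ)..(T * x), ai (y t)) -
        x⁻¹ * ∫ t in (0:ℝ)..(T * x), ai (y t))) := by
      apply Tendsto.sub _ tendsto_const_nhds
      exact (hr.inv₀ hx.ne').mul ((hc.tendsto _).comp (hr.const_mul T))
    rw [sub_self] at h2
    refine h2.congr' ?_
    filter_upwards [hr.eventually (lt_mem_nhds hx)] with n hn
    rw [integral_sub (hintb _) (hintb _), e _ hn.ne', e _ hx.ne']
  have h2 : Tendsto (fun n => ∫ t in Ioc 0 T, max (ai (y (t * r n)) - ai (y (t * x))) 0) atTop (nhds 0) := by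
    have := tendsto_integral_of_dominated_convergence (μ := volume.restrict (Ioc 0 T))
      (F := fun n t => max (ai (y (t * r n)) - ai (y (t * x))) 0) (f := fun _ => 0) (fun _ => (1:ℝ))
      (fun n => (((hm _).sub (hm _)).max measurable_const).aestronglyMeasurable)
      (integrable_const _) (fun n => Eventually.of_forall fun t => ?_)
      (Eventually.of_forall fun t => ?_)
    · simpa using this
    · rw [Real.norm_eq_abs, abs_of_nonneg (le_max_right _ _)]
      exact max_le ((le_abs_self _).trans (abs_ai_sub_le _ _)) zero_le_one
    · by_cases hyt : y (t * x) ≤ 0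
      · have : ∀ n, max (ai (y (t * r n)) - ai (y (t * x))) 0 = 0 := by
          intro n
          apply max_eq_right
          have : ai (y (t * x)) = 1 := by unfold ai; rw [if_pos hyt]
          rw [this]; linarith [ai_le_one (y (t * r n))]
        simp only [this]; exact tendsto_const_nhds
      · push Not at hyt
        have : Tendsto (fun n => y (t * r n)) atTop (nhds (y (t * x))) :=
          (hy.tendsto _).comp (hr.const_mul t)
        apply tendsto_const_nhds.congr'
        filter_upwards [this.eventually (lt_mem_nhds hyt)] with n hn
        unfold ai
        rw [if_neg (not_le.2 hn), if_neg (not_le.2 hyt)]; simp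
  have h3 : Tendsto (fun n => ∫ t in Ioc 0 T, ‖ai (y (t * r n)) - ai (y (t * x))‖) atTop (nhds 0) := by
    have h4 := (h2.const_mul 2).sub h1
    simp only [mul_zero, sub_zero] at h4
    refine h4.congr fun n => ?_
    have hd : Integrable (fun t => ai (y (t * r n)) - ai (y (t * x))) (volume.restrict (Ioc 0 T)) :=
      (hintb _).sub (hintb _)
    rw [← integral_const_mul, ← integral_sub (by exact hd.pos_part.const_mul 2) hd]
    congr 1; ext t
    rw [Real.norm_eq_abs]
    rcases le_total (ai (y (t * r n)) - ai (y (t * x))) 0 with h | h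
    · rw [max_eq_right h, abs_of_nonpos h]; ring
    · rw [max_eq_left h, abs_of_nonneg h]; ring
  have h5 := ENNReal.tendsto_ofReal h3
  rw [ENNReal.ofReal_zero] at h5
  refine h5.congr fun n => ?_
  exact ofReal_integral_norm_eq_lintegral_enorm ((hintb _).sub (hintb _))

/-- grid discrepancy -/
def kap (μ : Measure Ω) (Z : ℝ → Ω → ℝ) (t : ℝ) (n : ℕ) : ENNReal :=
  ∫⁻ u in Ioc 0 t, ∫⁻ ω, ‖ai (Z (lpt t n u) ω) - ai (Z u ω)‖ₑ ∂μ

lemma lpt_scale {t : ℝ} (ht : 0 < t) (n : ℕ) (x : ℝ) : lpt t n (t * x) = t * lpt 1 n x := by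
  unfold lpt
  have : 2 ^ n * (t * x) / t = 2 ^ n * x / 1 := by field_simp
  rw [this]; ring

lemma measurable_ai_comp {Z : ℝ → Ω → ℝ} (hZ : Measurable (Function.uncurry Z)) {α : Type*}
    [MeasurableSpace α] {f : α → ℝ} {g : α → Ω} (hf : Measurable f) (hg : Measurable g) :
    Measurable (fun a => ai (Z (f a) (g a))) :=
  measurable_ai.comp (hZ.comp (hf.prodMk hg))

lemma kap_eq {μ : Measure Ω} [IsProbabilityMeasure μ] {Z : ℝ → Ω → ℝ}
    (hZ : Measurable (Function.uncurry Z)) {t : ℝ} (ht : 0 < t) (n : ℕ) :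
    kap μ Z t n = ENNReal.ofReal t * ∫⁻ x in Ioc 0 1, ∫⁻ ω,
      ‖ai (Z (t * lpt 1 n x) ω) - ai (Z (t * x) ω)‖ₑ ∂μ := by
  have hg : Measurable (fun u => ∫⁻ ω, ‖ai (Z (lpt t n u) ω) - ai (Z u ω)‖ₑ ∂μ) := by
    apply Measurable.lintegral_prod_right' (f := fun p : ℝ × Ω =>
      ‖ai (Z (lpt t n p.1) p.2) - ai (Z p.1 p.2)‖ₑ)
    exact ((measurable_ai_comp hZ ((measurable_lpt t n).comp measurable_fst) measurable_snd).sub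
      (measurable_ai_comp hZ measurable_fst measurable_snd)).enorm
  unfold kap
  rw [← lintegral_indicator measurableSet_Ioc, ← lintegral_indicator measurableSet_Ioc]
  conv_lhs => rw [← Real.smul_map_volume_mul_left ht.ne']
  rw [lintegral_smul_measure, lintegral_map (hg.indicator measurableSet_Ioc) (measurable_const_mul t),
    abs_of_pos ht, smul_eq_mul]
  congr 1
  apply lintegral_congr
  intro x
  by_cases hx : x ∈ Ioc (0:ℝ) 1
  · have : t * x ∈ Ioc 0 t := ⟨by have := hx.1; positivity, by nlinarith [hx.2]⟩
    rw [indicator_of_mem hx, indicator_of_mem this, lpt_scale ht]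
  · have : t * x ∉ Ioc 0 t := by
      rintro ⟨h1, h2⟩
      exact hx ⟨by by_contra h; push Not at h; nlinarith, by
        by_contra h; push Not at h; nlinarith⟩
    rw [indicator_of_notMem hx, indicator_of_notMem this]

lemma kap_avg {μ : Measure Ω} [IsProbabilityMeasure μ] {Z : ℝ → Ω → ℝ}
    (hZ : Measurable (Function.uncurry Z)) (hc : ∀ ω, Continuous fun t => Z t ω) {T : ℝ} (hT : 0 ≤ T) :
    Tendsto (fun n => ∫⁻ t in Ioc 0 T, kap μ Z t n) atTop (nhds 0) := by
  set ν := ((volume : Measure ℝ).restrict (Ioc 0 1)).prod μ with hν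
  set φ : ℕ → ℝ → (ℝ × Ω) → ENNReal := fun n t z =>
    ‖ai (Z (t * lpt 1 n z.1) z.2) - ai (Z (t * z.1) z.2)‖ₑ with hφ
  have hφm : ∀ n, Measurable (Function.uncurry (φ n)) := by
    intro n
    have m1 : Measurable (fun p : ℝ × (ℝ × Ω) => p.1 * lpt 1 n p.2.1) :=
      measurable_fst.mul ((measurable_lpt 1 n).comp (measurable_fst.comp measurable_snd))
    have m2 : Measurable (fun p : ℝ × (ℝ × Ω) => p.1 * p.2.1) := by fun_prop
    have m3 : Measurable (fun p : ℝ × (ℝ × Ω) => p.2.2) := by fun_prop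
    exact ((measurable_ai_comp hZ m1 m3).sub (measurable_ai_comp hZ m2 m3)).enorm
  have hD : Tendsto (fun n => ∫⁻ z, ∫⁻ t in Ioc 0 T, φ n t z ∂volume ∂ν) atTop (nhds 0) := by
    have := tendsto_lintegral_of_dominated_convergence (μ := ν)
      (F := fun n z => ∫⁻ t in Ioc 0 T, φ n t z) (f := fun _ => 0) (fun _ => ENNReal.ofReal T)
      (fun n => Measurable.lintegral_prod_left (hφm n)) (fun n => Eventually.of_forall fun z => ?_)
      (by simp [ENNReal.mul_eq_top, hν]) ?_
    · simpa using this
    · calc ∫⁻ t in Ioc 0 T, φ n t z ≤ ∫⁻ t in Ioc 0 T, 1 := lintegral_mono fun t => enorm_ai_sub_le _ _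
        _ = _ := by simp
    · have hpos : ∀ᵐ z ∂ν, z.1 ∈ Ioc (0:ℝ) 1 := by
        have h1 : ∀ᵐ x ∂((volume : Measure ℝ).restrict (Ioc 0 1)), x ∈ Ioc (0:ℝ) 1 :=
          ae_restrict_mem measurableSet_Ioc
        exact (Measure.quasiMeasurePreserving_fst (μ := (volume : Measure ℝ).restrict (Ioc 0 1))
          (ν := μ)).ae h1
      filter_upwards [hpos] with z hz
      exact dilation_tendsto (hc z.2) hT hz.1 (tendsto_lpt one_pos hz.1 hz.2)
  have hb : ∀ n, ∫⁻ t in Ioc 0 T, kap μ Z t n ≤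
      ENNReal.ofReal T * ∫⁻ z, ∫⁻ t in Ioc 0 T, φ n t z ∂volume ∂ν := by
    intro n
    rw [lintegral_lintegral_swap (by
      exact ((hφm n).comp measurable_swap).aemeasurable)]
    rw [← lintegral_const_mul _ (Measurable.lintegral_prod_right (hφm n))]
    apply setLIntegral_mono' measurableSet_Ioc
    intro t ht
    rw [kap_eq hZ ht.1]
    have hm1 : Measurable (φ n t) := (hφm n).comp (measurable_const.prodMk measurable_id)
    rw [hν, lintegral_prod _ hm1.aemeasurable]
    gcongr
    exact ht.2
  refine tendsto_of_tendsto_of_tendsto_of_le_of_le tendsto_const_nhds ?_ (fun _ => zero_le) hb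
  have := ENNReal.Tendsto.const_mul (a := ENNReal.ofReal T) hD (Or.inr ENNReal.ofReal_ne_top)
  simpa using this

lemma measurable_kap {μ : Measure Ω} [IsProbabilityMeasure μ] {Z : ℝ → Ω → ℝ}
    (hZ : Measurable (Function.uncurry Z)) (T : ℝ) (n : ℕ) :
    AEMeasurable (fun t => kap μ Z t n) (volume.restrict (Ioc 0 T)) := by
  have h1 : Measurable (fun t => ENNReal.ofReal t * ∫⁻ x in Ioc 0 1, ∫⁻ ω,
      ‖ai (Z (t * lpt 1 n x) ω) - ai (Z (t * x) ω)‖ₑ ∂μ) := by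
    apply ENNReal.measurable_ofReal.mul
    apply Measurable.lintegral_prod_right' (f := fun q : ℝ × ℝ => ∫⁻ ω,
      ‖ai (Z (q.1 * lpt 1 n q.2) ω) - ai (Z (q.1 * q.2) ω)‖ₑ ∂μ)
    apply Measurable.lintegral_prod_right' (f := fun p : (ℝ × ℝ) × Ω =>
      ‖ai (Z (p.1.1 * lpt 1 n p.1.2) p.2) - ai (Z (p.1.1 * p.1.2) p.2)‖ₑ)
    have m1 : Measurable (fun p : (ℝ × ℝ) × Ω => p.1.1 * lpt 1 n p.1.2) :=
      (measurable_fst.comp measurable_fst).mul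
        ((measurable_lpt 1 n).comp (measurable_snd.comp measurable_fst))
    have m2 : Measurable (fun p : (ℝ × ℝ) × Ω => p.1.1 * p.1.2) := by fun_prop
    exact ((measurable_ai_comp hZ m1 measurable_snd).sub
      (measurable_ai_comp hZ m2 measurable_snd)).enorm
  refine h1.aemeasurable.congr ?_
  filter_upwards [ae_restrict_mem measurableSet_Ioc] with t ht
  rw [kap_eq hZ ht.1]

lemma kap_subseq {μ : Measure Ω} [IsProbabilityMeasure μ] {Z : ℝ → Ω → ℝ}
    (hZ : Measurable (Function.uncurry Z)) (hc : ∀ ω, Continuous fun t => Z t ω) {T : ℝ} (hT : 0 ≤ T) :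
    ∃ ns : ℕ → ℕ, StrictMono ns ∧ ∀ᵐ t ∂(volume.restrict (Ioc 0 T)),
      Tendsto (fun k => kap μ Z t (ns k)) atTop (nhds 0) := by
  have h1 := kap_avg (μ := μ) hZ hc hT
  have hle : ∀ t n, 0 < t → kap μ Z t n ≤ ENNReal.ofReal t := by
    intro t n ht
    unfold kap
    calc ∫⁻ u in Ioc 0 t, ∫⁻ ω, ‖ai (Z (lpt t n u) ω) - ai (Z u ω)‖ₑ ∂μ
        ≤ ∫⁻ u in Ioc 0 t, ∫⁻ ω, 1 ∂μ := by
          gcongr; exact enorm_ai_sub_le _ _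
      _ = _ := by simp
  have h2 : TendstoInMeasure (volume.restrict (Ioc 0 T)) (fun n t => (kap μ Z t n).toReal) atTop
      (fun _ => 0) := by
    apply tendstoInMeasure_of_tendsto_eLpNorm (p := 1) one_ne_zero
    · intro n; exact (measurable_kap hZ T n).ennreal_toReal.aestronglyMeasurable
    · exact aestronglyMeasurable_const
    · refine tendsto_of_tendsto_of_tendsto_of_le_of_le tendsto_const_nhds h1 (fun _ => zero_le) ?_
      intro n
      simp only [eLpNorm_one_eq_lintegral_enorm, Pi.sub_apply, sub_zero]
      apply lintegral_mono
      intro t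
      simp only [Pi.sub_apply, sub_zero]
      rw [Real.enorm_eq_ofReal ENNReal.toReal_nonneg]
      exact ENNReal.ofReal_toReal_le
  obtain ⟨ns, hns, h3⟩ := h2.exists_seq_tendsto_ae
  refine ⟨ns, hns, ?_⟩
  filter_upwards [h3, ae_restrict_mem measurableSet_Ioc] with t ht hmem
  have h4 := ENNReal.tendsto_ofReal ht
  rw [ENNReal.ofReal_zero] at h4
  refine h4.congr fun k => ?_
  exact ENNReal.ofReal_toReal (ne_top_of_le_ne_top ENNReal.ofReal_ne_top (hle t _ hmem.1))

-- Calculus of convergence in measure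

lemma TIM.add {μ : Measure Ω} {ι : Type*} {l : Filter ι} {f f' : ι → Ω → ℝ} {g g' : Ω → ℝ}
    (h : TendstoInMeasure μ f l g) (h' : TendstoInMeasure μ f' l g') :
    TendstoInMeasure μ (fun i ω => f i ω + f' i ω) l (fun ω => g ω + g' ω) := by
  rw [tendstoInMeasure_iff_norm] at *
  intro ε hε
  have h1 := (h (ε / 2) (by positivity)).add (h' (ε / 2) (by positivity))
  rw [add_zero] at h1
  refine tendsto_of_tendsto_of_tendsto_of_le_of_le tendsto_const_nhds h1 (fun _ => zero_le) ?_
  intro i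
  refine le_trans (measure_mono ?_) (measure_union_le _ _)
  intro ω hω
  simp only [mem_setOf_eq, mem_union] at hω ⊢
  by_contra hcon
  push Not at hcon
  have : f i ω + f' i ω - (g ω + g' ω) = (f i ω - g ω) + (f' i ω - g' ω) := by ring
  rw [this] at hω
  have := norm_add_le (f i ω - g ω) (f' i ω - g' ω)
  linarith [hcon.1, hcon.2]

lemma TIM.const_mul {μ : Measure Ω} {ι : Type*} {l : Filter ι} {f : ι → Ω → ℝ} {g : Ω → ℝ}
    (h : TendstoInMeasure μ f l g) (c : ℝ) :
    TendstoInMeasure μ (fun i ω => c * f i ω) l (fun ω => c * g ω) := by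
  rw [tendstoInMeasure_iff_norm] at *
  intro ε hε
  have hc : 0 < |c| + 1 := by positivity
  refine tendsto_of_tendsto_of_tendsto_of_le_of_le tendsto_const_nhds (h (ε / (|c| + 1)) (by positivity))
    (fun _ => zero_le) ?_
  intro i
  refine measure_mono ?_
  intro ω hω
  simp only [mem_setOf_eq] at hω ⊢
  rw [← mul_sub, norm_mul, Real.norm_eq_abs c] at hω
  rw [div_le_iff₀ hc]
  nlinarith [norm_nonneg (f i ω - g ω)]

lemma TIM.const {μ : Measure Ω} {ι : Type*} {l : Filter ι} (g : Ω → ℝ) :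
    TendstoInMeasure μ (fun _ : ι => g) l g := by
  intro ε hε
  simp only [edist_self, nonpos_iff_eq_zero]
  simp only [hε.ne', setOf_false, measure_empty]
  exact tendsto_const_nhds

lemma TIM.sub {μ : Measure Ω} {ι : Type*} {l : Filter ι} {f f' : ι → Ω → ℝ} {g g' : Ω → ℝ}
    (h : TendstoInMeasure μ f l g) (h' : TendstoInMeasure μ f' l g') :
    TendstoInMeasure μ (fun i ω => f i ω - f' i ω) l (fun ω => g ω - g' ω) := by
  have := TIM.add h (TIM.const_mul h' (-1))
  simpa [sub_eq_add_neg] using this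

lemma TIM.of_eq {μ : Measure Ω} {ι : Type*} {l : Filter ι} {f f' : ι → Ω → ℝ} {g g' : Ω → ℝ}
    (h : TendstoInMeasure μ f l g) (h1 : ∀ i ω, f i ω = f' i ω) (h2 : ∀ᵐ ω ∂μ, g ω = g' ω) :
    TendstoInMeasure μ f' l g' :=
  h.congr (fun i => Eventually.of_forall (h1 i)) h2

lemma TIM.of_sq {μ : Measure Ω} [IsFiniteMeasure μ] {ι : Type*} {l : Filter ι} {f : ι → Ω → ℝ}
    (hf : ∀ i, MemLp (f i) 2 μ) (h : Tendsto (fun i => ∫ ω, (f i ω) ^ 2 ∂μ) l (nhds 0)) :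
    TendstoInMeasure μ f l (fun _ => 0) := by
  rw [tendstoInMeasure_iff_measureReal_norm]
  intro ε hε
  have h1 := h.const_mul (ε ^ 2)⁻¹
  rw [mul_zero] at h1
  refine tendsto_of_tendsto_of_tendsto_of_le_of_le tendsto_const_nhds h1
    (fun _ => measureReal_nonneg) ?_
  intro i
  have h2 := mul_meas_ge_le_integral_of_nonneg (μ := μ) (f := fun ω => (f i ω) ^ 2)
    (Eventually.of_forall fun ω => sq_nonneg _) (hf i).integrable_sq (ε ^ 2)
  have h3 : {x | ε ≤ ‖f i x - 0‖} = {x | ε ^ 2 ≤ (f i x) ^ 2} := by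
    ext x
    simp only [sub_zero, mem_setOf_eq, Real.norm_eq_abs]
    rw [← sq_abs (f i x)]
    exact (pow_le_pow_iff_left₀ hε.le (abs_nonneg _) two_ne_zero).symm
  simp only [h3]
  rw [inv_mul_eq_div, le_div_iff₀ (by positivity), mul_comm]
  exact h2

lemma TIM.cf {μ : Measure Ω} [IsProbabilityMeasure μ] {E : ℕ → Ω → ℝ} {Z : Ω → ℝ}
    (hE : ∀ k, AEMeasurable (E k) μ) (h : TendstoInMeasure μ E atTop Z) {ξ : Ω → ℂ} {C : ℝ}
    (hξ : Measurable ξ) (hC : ∀ ω, ‖ξ ω‖ ≤ C) {c : ℂ}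
    (hc : Tendsto (fun k => ∫ ω, ξ ω * Complex.exp ((E k ω : ℂ) * Complex.I) ∂μ) atTop (nhds c)) :
    ∫ ω, ξ ω * Complex.exp ((Z ω : ℂ) * Complex.I) ∂μ = c := by
  obtain ⟨ns, hns, hae⟩ := h.exists_seq_tendsto_ae
  have hc' := hc.comp hns.tendsto_atTop
  refine tendsto_nhds_unique ?_ hc'
  apply tendsto_integral_of_dominated_convergence (fun _ => C)
  · intro k
    apply AEMeasurable.aestronglyMeasurable
    apply hξ.aemeasurable.mul
    exact Complex.measurable_exp.comp_aemeasurable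
      ((Complex.measurable_ofReal.comp_aemeasurable (hE _)).mul_const _)
  · exact integrable_const _
  · intro k
    refine Eventually.of_forall fun ω => ?_
    rw [norm_mul, Complex.norm_exp_ofReal_mul_I, mul_one]; exact hC ω
  · filter_upwards [hae] with ω hω
    apply Tendsto.const_mul
    have hcont : Continuous (fun x : ℝ => Complex.exp ((x : ℂ) * Complex.I)) := by fun_prop
    exact (hcont.tendsto _).comp hω

-- Comparison of Riemann sums on different grids

lemma coef_sub_sq (p q x y : ℝ) :
    ((if x ≤ 0 then p else q) - (if y ≤ 0 then p else q)) ^ 2 = (p - q) ^ 2 * |ai x - ai y| := by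
  unfold ai; split_ifs <;> simp
  ring

lemma kap_sub_le' {μ : Measure Ω} [IsProbabilityMeasure μ] {Y Z G : ℝ → Ω → ℝ}
    (hZm : Measurable (Function.uncurry Z)) (hZY : ∀ᵐ ω ∂μ, ∀ t, Z t ω = Y t ω) (p q : ℝ)
    {t t' s : ℝ} (hst : s ≤ t) (hst' : s ≤ t') (n n' : ℕ)
    (hG : ∀ u ω, |G u ω| ≤ ((if Y (lpt t n u) ω ≤ 0 then p else q) -
      (if Y (lpt t' n' u) ω ≤ 0 then p else q)) ^ 2) :
    ‖∫ u in Ioc 0 s, ∫ ω, G u ω ∂μ‖ₑ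
      ≤ ENNReal.ofReal ((p - q) ^ 2) * (kap μ Z t n + kap μ Z t' n') := by
  have hm1 : ∀ t n, Measurable (fun z : ℝ × Ω => ‖ai (Z (lpt t n z.1) z.2) - ai (Z z.1 z.2)‖ₑ) :=
    fun t n => ((measurable_ai_comp hZm ((measurable_lpt t n).comp measurable_fst) measurable_snd).sub
      (measurable_ai_comp hZm measurable_fst measurable_snd)).enorm
  have hm2 : ∀ t n, Measurable (fun u => ∫⁻ ω, ‖ai (Z (lpt t n u) ω) - ai (Z u ω)‖ₑ ∂μ) :=
    fun t n => Measurable.lintegral_prod_right' (hm1 t n)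
  calc ‖∫ u in Ioc 0 s, ∫ ω, G u ω ∂μ‖ₑ
      ≤ ∫⁻ u in Ioc 0 s, ‖∫ ω, G u ω ∂μ‖ₑ := enorm_integral_le_lintegral_enorm _
    _ ≤ ∫⁻ u in Ioc 0 s, ∫⁻ ω, ‖G u ω‖ₑ ∂μ :=
      lintegral_mono fun u => enorm_integral_le_lintegral_enorm _
    _ ≤ ∫⁻ u in Ioc 0 s, ∫⁻ ω, ENNReal.ofReal ((p - q) ^ 2) *
        (‖ai (Z (lpt t n u) ω) - ai (Z u ω)‖ₑ + ‖ai (Z (lpt t' n' u) ω) - ai (Z u ω)‖ₑ) ∂μ := by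
      apply lintegral_mono fun u => ?_
      apply lintegral_mono_ae
      filter_upwards [hZY] with ω hω
      have hg := hG u ω
      rw [← Real.norm_eq_abs] at hg
      have hg2 : ‖G u ω‖ₑ ≤ ‖(((if Y (lpt t n u) ω ≤ 0 then p else q) -
        (if Y (lpt t' n' u) ω ≤ 0 then p else q)) ^ 2 : ℝ)‖ₑ := by
        rw [← enorm_norm, Real.enorm_eq_ofReal (norm_nonneg _), Real.enorm_eq_ofReal (sq_nonneg _)]
        exact ENNReal.ofReal_le_ofReal hg
      refine hg2.trans ?_
      rw [coef_sub_sq, enorm_mul, Real.enorm_eq_ofReal (sq_nonneg _), hω, hω, hω]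
      gcongr
      rw [← Real.norm_eq_abs, enorm_norm]
      have : ai (Y (lpt t n u) ω) - ai (Y (lpt t' n' u) ω) =
        (ai (Y (lpt t n u) ω) - ai (Y u ω)) - (ai (Y (lpt t' n' u) ω) - ai (Y u ω)) := by ring
      rw [this]; exact enorm_sub_le
    _ = ENNReal.ofReal ((p - q) ^ 2) * (∫⁻ u in Ioc 0 s, ((∫⁻ ω, ‖ai (Z (lpt t n u) ω) - ai (Z u ω)‖ₑ ∂μ) +
        ∫⁻ ω, ‖ai (Z (lpt t' n' u) ω) - ai (Z u ω)‖ₑ ∂μ)) := by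
      rw [← lintegral_const_mul _ (by exact (hm2 t n).add (hm2 t' n'))]
      congr 1; ext u
      have h1 := (hm1 t n).comp (measurable_prodMk_left (x := u))
      have h2 := (hm1 t' n').comp (measurable_prodMk_left (x := u))
      rw [lintegral_const_mul _ (by exact h1.add h2), lintegral_add_left (by exact h1)]
    _ = ENNReal.ofReal ((p - q) ^ 2) * ((∫⁻ u in Ioc 0 s, (∫⁻ ω, ‖ai (Z (lpt t n u) ω) - ai (Z u ω)‖ₑ ∂μ)) +
        ∫⁻ u in Ioc 0 s, ∫⁻ ω, ‖ai (Z (lpt t' n' u) ω) - ai (Z u ω)‖ₑ ∂μ) := by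
      rw [lintegral_add_left (hm2 t n)]
    _ ≤ _ := by
      unfold kap
      gcongr <;> assumption

lemma kap_sub_le {μ : Measure Ω} [IsProbabilityMeasure μ] {Y Z : ℝ → Ω → ℝ}
    (hZm : Measurable (Function.uncurry Z)) (hZY : ∀ᵐ ω ∂μ, ∀ t, Z t ω = Y t ω) (p q : ℝ)
    {t t' s : ℝ} (hst : s ≤ t) (hst' : s ≤ t') (n n' : ℕ) :
    ‖∫ u in Ioc 0 s, ∫ ω, ((if Y (lpt t n u) ω ≤ 0 then p else q) -
      (if Y (lpt t' n' u) ω ≤ 0 then p else q)) ^ 2 ∂μ‖ₑ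
      ≤ ENNReal.ofReal ((p - q) ^ 2) * (kap μ Z t n + kap μ Z t' n') := by
  apply kap_sub_le' hZm hZY p q hst hst' n n'
  intro u ω
  rw [abs_of_nonneg (sq_nonneg _)]

/-- `E = (B, Y)`: two-valued coefficient along `Y` -/
lemma coef_meas {F : ℝ → MeasurableSpace Ω} {Y : ℝ → Ω → ℝ}
    (hY : ∀ u, 0 ≤ u → Measurable[F u] (Y u)) (p q : ℝ) (u : ℝ) (hu : 0 ≤ u) :
    Measurable[F u] (fun ω => if Y u ω ≤ 0 then p else q) :=
  Measurable.ite (measurableSet_le (hY u hu) measurable_const) measurable_const measurable_const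

lemma coef_bdd (p q x : ℝ) : |if x ≤ 0 then p else q| ≤ |p| + |q| := by
  split_ifs
  · linarith [abs_nonneg q]
  · linarith [abs_nonneg p]

lemma csum_compare {μ : Measure Ω} [IsProbabilityMeasure μ] {F : ℝ → MeasurableSpace Ω}
    {B Y Z : ℝ → Ω → ℝ} (h : IsBM μ F B) (hY : ∀ u, 0 ≤ u → Measurable[F u] (Y u))
    (hZm : Measurable (Function.uncurry Z)) (hZY : ∀ᵐ ω ∂μ, ∀ t, Z t ω = Y t ω) (p q : ℝ)
    {ι : Type*} {l : Filter ι} {N N' : ι → ℕ}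
    {t t' s : ℝ} (ht : 0 < t) (ht' : 0 < t') (hs : 0 ≤ s) (hst : s ≤ t) (hst' : s ≤ t')
    (hk : Tendsto (fun i => kap μ Z t (N i)) l (nhds 0))
    (hk' : Tendsto (fun i => kap μ Z t' (N' i)) l (nhds 0)) :
    TendstoInMeasure μ (fun i ω => csum (fun u ω => if Y u ω ≤ 0 then p else q) B t (N i) s ω -
      csum (fun u ω => if Y u ω ≤ 0 then p else q) B t' (N' i) s ω) l (fun _ => 0) := by
  set H : ℝ → Ω → ℝ := fun u ω => if Y u ω ≤ 0 then p else q with hH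
  have hHm : ∀ u, 0 ≤ u → Measurable[F u] (H u) := fun u hu => coef_meas hY p q u hu
  have hHb : ∀ u ω, |H u ω| ≤ |p| + |q| := fun u ω => coef_bdd p q _
  apply TIM.of_sq
  · intro i
    exact (csum_memLp h hHm hHb ht.le hs _).sub (csum_memLp h hHm hHb ht'.le hs _)
  · have h1 : ∀ i, ‖∫ ω, (csum H B t (N i) s ω - csum H B t' (N' i) s ω) ^ 2 ∂μ‖ₑ ≤
        ENNReal.ofReal ((p - q) ^ 2) * (kap μ Z t (N i) + kap μ Z t' (N' i)) := by
      intro i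
      rw [csum_diff_sq h hHm hHm hHb hHb ht ht' hs hst hst']
      exact kap_sub_le hZm hZY p q hst hst' _ _
    have h2 := ENNReal.Tendsto.const_mul (a := ENNReal.ofReal ((p - q) ^ 2)) (hk.add hk')
      (Or.inr ENNReal.ofReal_ne_top)
    rw [add_zero, mul_zero] at h2
    have h3 := tendsto_of_tendsto_of_tendsto_of_le_of_le tendsto_const_nhds h2 (fun _ => zero_le) h1
    rw [tendsto_zero_iff_enorm_tendsto_zero]
    exact h3

-- The pair (W, Q) has the characteristic function of a planar Brownian motion

/-- bundled standing hypotheses -/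
structure Sys (μ : Measure Ω) (F : ℝ → MeasurableSpace Ω) (ρ σ : ℝ)
    (B₁ B₂ Y I₁ I₂ W Q : ℝ → Ω → ℝ) : Prop where
  hnorm : ρ ^ 2 + σ ^ 2 = 1
  hB : IsPlanarBM μ F B₁ B₂
  adY : ∀ u, 0 ≤ u → Measurable[F u] (Y u)
  mY : ∀ u, Measurable (Y u)
  cY : ∀ᵐ ω ∂μ, Continuous fun t => Y t ω
  hI1 : ∀ t : ℝ, 0 ≤ t → TendstoInMeasure μ
    (fun n => rsum (fun s ω => if Y s ω ≤ 0 then σ else ρ) B₁ t n) atTop (I₁ t)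
  hI2 : ∀ t : ℝ, 0 ≤ t → TendstoInMeasure μ
    (fun n => rsum (fun s ω => if Y s ω ≤ 0 then ρ else σ) B₂ t n) atTop (I₂ t)
  adW : ∀ u, 0 ≤ u → Measurable[F u] (W u)
  adQ : ∀ u, 0 ≤ u → Measurable[F u] (Q u)
  cW : ∀ᵐ ω ∂μ, Continuous fun t => W t ω
  cQ : ∀ᵐ ω ∂μ, Continuous fun t => Q t ω
  hW : ∀ t, 0 ≤ t → ∀ᵐ ω ∂μ, W t ω = I₁ t ω - I₂ t ω
  hQ : ∀ t, 0 ≤ t → ∀ᵐ ω ∂μ, Q t ω = (ρ + σ) * (B₁ t ω + B₂ t ω) - I₁ t ω - I₂ t ω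

open Classical in
lemma Sys.cf_good {μ : Measure Ω} [IsProbabilityMeasure μ] {F : ℝ → MeasurableSpace Ω} {ρ σ : ℝ}
    {B₁ B₂ Y I₁ I₂ W Q : ℝ → Ω → ℝ} (S : Sys μ F ρ σ B₁ B₂ Y I₁ I₂ W Q) {Z : ℝ → Ω → ℝ}
    (hZm : Measurable (Function.uncurry Z)) (hZY : ∀ᵐ ω ∂μ, ∀ t, Z t ω = Y t ω)
    {ns : ℕ → ℕ} (hns : StrictMono ns) {s t : ℝ} (hs : 0 < s) (hst : s ≤ t)
    (hk : Tendsto (fun i => kap μ Z t (ns i)) atTop (nhds 0))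
    (hk' : Tendsto (fun i => kap μ Z s (ns i)) atTop (nhds 0)) (θ η : ℝ)
    (ξ : Ω → ℂ) (C : ℝ) (hξ : Measurable[F s] ξ) (hC : ∀ ω, ‖ξ ω‖ ≤ C) :
    ∫ ω, ξ ω * Complex.exp (((θ * (W t ω - W s ω) + η * (Q t ω - Q s ω) : ℝ) : ℂ) * Complex.I) ∂μ
      = (∫ ω, ξ ω ∂μ) * Complex.exp (((-((θ ^ 2 + η ^ 2) * (t - s) / 2) : ℝ)) : ℂ) := by
  have ht : 0 < t := hs.trans_le hst
  obtain ⟨hB1, hB2, _⟩ := S.hB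
  have hJ := jointCF_planar S.hB
  set H₁ : ℝ → Ω → ℝ := fun s ω => if Y s ω ≤ 0 then σ else ρ with hH₁
  set H₂ : ℝ → Ω → ℝ := fun s ω => if Y s ω ≤ 0 then ρ else σ with hH₂
  have conv : ∀ (B I : ℝ → Ω → ℝ) (p q : ℝ), IsBM μ F B →
      (∀ t : ℝ, 0 ≤ t → TendstoInMeasure μ
        (fun n => rsum (fun s ω => if Y s ω ≤ 0 then p else q) B t n) atTop (I t)) →
      TendstoInMeasure μ (fun k ω => rsum (fun s ω => if Y s ω ≤ 0 then p else q) B t (ns k) ω -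
        csum (fun s ω => if Y s ω ≤ 0 then p else q) B t (ns k) s ω) atTop
        (fun ω => I t ω - I s ω) := by
    intro B I p q hB hI
    have c1 := csum_compare hB S.adY hZm hZY p q ht hs hs.le hst le_rfl hk hk'
    have c2 := (hI t ht.le).comp hns.tendsto_atTop
    have c3 := (hI s hs.le).comp hns.tendsto_atTop
    have c4 := TIM.sub c2 (TIM.add c3 c1)
    refine TIM.of_eq c4 ?_ (Eventually.of_forall fun ω => ?_)
    · intro k ω
      simp only [Function.comp]
      rw [csum_self hs.le]; ring
    · simp
  have c1 := conv B₁ I₁ σ ρ hB1 S.hI1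
  have c2 := conv B₂ I₂ ρ σ hB2 S.hI2
  have cB : TendstoInMeasure μ (fun _ : ℕ => fun ω => (B₁ t ω - B₁ s ω) + (B₂ t ω - B₂ s ω)) atTop
    (fun ω => (B₁ t ω - B₁ s ω) + (B₂ t ω - B₂ s ω)) := TIM.const _
  have c3 := TIM.add (TIM.const_mul (TIM.sub c1 c2) θ)
    (TIM.const_mul (TIM.sub (TIM.const_mul cB (ρ + σ)) (TIM.add c1 c2)) η)
  -- the elementary sums
  set p : ℕ → ℕ → ℝ := fun n j => max s (t * j / 2 ^ n) with hp
  set E : ℕ → ℕ → Set Ω := fun n j => {ω | Y (t * j / 2 ^ n) ω ≤ 0} with hE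
  set El : ℕ → Ω → ℝ := fun k ω => ∑ j ∈ Finset.range (2 ^ (ns k)),
        ((if ω ∈ E (ns k) j then θ * σ + η * ρ else θ * ρ + η * σ) *
            (B₁ (p (ns k) (j + 1)) ω - B₁ (p (ns k) j) ω) +
         (if ω ∈ E (ns k) j then -θ * ρ + η * σ else -θ * σ + η * ρ) *
            (B₂ (p (ns k) (j + 1)) ω - B₂ (p (ns k) j) ω)) with hEl
  have hp0 : ∀ n, p n 0 = s := fun n => by simp [hp, hs.le]
  have hpN : ∀ n, p n (2 ^ n) = t := fun n => by simp [hp, hst]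
  have hpm : ∀ n, Monotone (p n) := by
    intro n i j hij
    simp only [hp]
    gcongr
  have hp' : ∀ n j, 0 ≤ p n j := fun n j => hs.le.trans (le_max_left _ _)
  have hEm : ∀ n j, MeasurableSet[F (p n j)] (E n j) := by
    intro n j
    have h0 : 0 ≤ t * j / 2 ^ n := by positivity
    exact hB1.mono (le_max_right _ _) _ (measurableSet_le (S.adY _ h0) measurable_const)
  have tele : ∀ (n : ℕ) (B : ℝ → Ω → ℝ) (ω : Ω), B t ω - B s ω =
      ∑ j ∈ Finset.range (2 ^ n), (B (p n (j + 1)) ω - B (p n j) ω) := by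
    intro n B ω
    rw [Finset.sum_range_sub (fun j => B (p n j) ω), hp0, hpN]
  have c4 : TendstoInMeasure μ El atTop
      (fun ω => θ * (W t ω - W s ω) + η * (Q t ω - Q s ω)) := by
    refine TIM.of_eq c3 ?_ ?_
    · intro k ω
      rw [rsum_sub_csum ht.le, rsum_sub_csum ht.le, tele (ns k) B₁, tele (ns k) B₂]
      simp only [hEl, ← Finset.sum_add_distrib, Finset.mul_sum, ← Finset.sum_sub_distrib]
      refine Finset.sum_congr rfl fun j _ => ?_
      simp only [hp, hE, mem_setOf_eq]
      push_cast
      split_ifs <;> ring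
    · filter_upwards [S.hW t ht.le, S.hW s hs.le, S.hQ t ht.le, S.hQ s hs.le] with ω h1 h2 h3 h4
      rw [h1, h2, h3, h4]; ring
  refine TIM.cf (E := El) ?_ c4 (hξ.mono (hB1.le s) le_rfl) hC ?_
  · intro k
    apply Measurable.aemeasurable
    apply Finset.measurable_fun_sum
    intro j _
    have hE' : MeasurableSet (E (ns k) j) := hB1.le _ _ (hEm _ _)
    exact ((Measurable.ite hE' measurable_const measurable_const).mul
      (hB1.inc_meas' (hp' _ _) (hp' _ _))).add
      ((Measurable.ite hE' measurable_const measurable_const).mul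
      (hB2.inc_meas' (hp' _ _) (hp' _ _)))
  · refine tendsto_const_nhds.congr fun k => ?_
    have hn := S.hnorm
    have := elem_cf hB1 hB2 hJ (p (ns k)) (hpm _) (hp' _ _) (E (ns k)) (hEm _)
      (θ * σ + η * ρ) (-θ * ρ + η * σ) (θ * ρ + η * σ) (-θ * σ + η * ρ) (θ ^ 2 + η ^ 2)
      (by linear_combination (θ ^ 2 + η ^ 2) * hn) (by linear_combination (θ ^ 2 + η ^ 2) * hn)
      ξ C (by rw [hp0]; exact hξ) hC (2 ^ (ns k))
    rw [hp0, hpN] at this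
    exact this.symm

lemma exists_seq_good {P : ℝ → Prop} {s T : ℝ} (hs : 0 ≤ s) (hT : s < T)
    (h : ∀ᵐ t ∂(volume.restrict (Ioc 0 T)), P t) :
    ∃ r : ℕ → ℝ, (∀ k, s < r k ∧ r k < T ∧ P (r k)) ∧ Tendsto r atTop (nhds s) := by
  have key : ∀ ε > 0, ∃ r, s < r ∧ r < T ∧ r < s + ε ∧ P r := by
    intro ε hε
    by_contra hcon
    push Not at hcon
    have hlt : s < min T (s + ε) := lt_min hT (by linarith)
    have h1 : ∀ᵐ t ∂(volume.restrict (Ioc 0 T)), t ∉ Ioo s (min T (s + ε)) := by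
      filter_upwards [h] with t ht hmem
      exact hcon t hmem.1 (hmem.2.trans_le (min_le_left _ _)) (hmem.2.trans_le (min_le_right _ _)) ht
    have h2 := measure_eq_zero_iff_ae_notMem.2 h1
    have hsub : Ioo s (min T (s + ε)) ⊆ Ioc 0 T := fun t ht =>
      ⟨hs.trans_lt ht.1, (ht.2.trans_le (min_le_left _ _)).le⟩
    rw [Measure.restrict_apply measurableSet_Ioo, inter_eq_left.2 hsub, Real.volume_Ioo] at h2
    rw [ENNReal.ofReal_eq_zero] at h2
    linarith
  choose r hr using fun k : ℕ => key (1 / ((k : ℝ) + 1)) (by positivity)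
  refine ⟨r, fun k => ⟨(hr k).1, (hr k).2.1, (hr k).2.2.2⟩, ?_⟩
  have h0 : Tendsto (fun k : ℕ => s + 1 / ((k : ℝ) + 1)) atTop (nhds (s + 0)) :=
    tendsto_const_nhds.add tendsto_one_div_add_atTop_nhds_zero_nat
  rw [add_zero] at h0
  exact tendsto_of_tendsto_of_tendsto_of_le_of_le tendsto_const_nhds h0 (fun k => (hr k).1.le)
    (fun k => (hr k).2.2.1.le)

lemma Sys.jointCF {μ : Measure Ω} [IsProbabilityMeasure μ] {F : ℝ → MeasurableSpace Ω} {ρ σ : ℝ}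
    {B₁ B₂ Y I₁ I₂ W Q : ℝ → Ω → ℝ} (S : Sys μ F ρ σ B₁ B₂ Y I₁ I₂ W Q) : JointCF μ F W Q := by
  intro θ η s t hs hst ξ C hξ hC
  rcases hst.eq_or_lt with rfl | hlt
  · simp
  obtain ⟨hB1, hB2, _⟩ := S.hB
  obtain ⟨Z, hZc, hZm0, hZY⟩ := exists_contMod S.mY S.cY
  have hZm : Measurable (Function.uncurry Z) :=
    measurable_uncurry_of_continuous_of_measurable hZc hZm0
  have ht : 0 < t := hs.trans_lt hlt
  obtain ⟨ns, hns, hae⟩ := kap_subseq (μ := μ) hZm hZc (T := t + 1) (by linarith)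
  obtain ⟨r, hr, hrt⟩ := exists_seq_good ht.le (by linarith) hae
  have hae' : ∀ᵐ u ∂(volume.restrict (Ioc 0 t)),
      Tendsto (fun k => kap μ Z u (ns k)) atTop (nhds 0) :=
    ae_mono (Measure.restrict_mono (Ioc_subset_Ioc_right (by linarith)) le_rfl) hae
  obtain ⟨q, hq, hqs⟩ := exists_seq_good hs hlt hae'
  have mW : ∀ u, 0 ≤ u → Measurable (W u) := fun u hu => (S.adW u hu).mono (hB1.le u) le_rfl
  have mQ : ∀ u, 0 ≤ u → Measurable (Q u) := fun u hu => (S.adQ u hu).mono (hB1.le u) le_rfl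
  have q0 : ∀ k, 0 ≤ q k := fun k => hs.trans (hq k).1.le
  have r0 : ∀ k, 0 ≤ r k := fun k => ht.le.trans (hr k).1.le
  have hm : ∀ k, Measurable (fun ω => θ * (W (r k) ω - W (q k) ω) + η * (Q (r k) ω - Q (q k) ω)) :=
    fun k => (((mW _ (r0 k)).sub (mW _ (q0 k))).const_mul θ).add
      (((mQ _ (r0 k)).sub (mQ _ (q0 k))).const_mul η)
  have hconv : TendstoInMeasure μ
      (fun k ω => θ * (W (r k) ω - W (q k) ω) + η * (Q (r k) ω - Q (q k) ω)) atTop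
      (fun ω => θ * (W t ω - W s ω) + η * (Q t ω - Q s ω)) := by
    apply tendstoInMeasure_of_tendsto_ae (fun k => (hm k).aestronglyMeasurable)
    filter_upwards [S.cW, S.cQ] with ω h1 h2
    exact ((((h1.tendsto t).comp hrt).sub ((h1.tendsto s).comp hqs)).const_mul θ).add
      ((((h2.tendsto t).comp hrt).sub ((h2.tendsto s).comp hqs)).const_mul η)
  refine TIM.cf (fun k => (hm k).aemeasurable) hconv (hξ.mono (hB1.le s) le_rfl) hC ?_
  have hval : ∀ k, ∫ ω, ξ ω * Complex.exp (((θ * (W (r k) ω - W (q k) ω) +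
      η * (Q (r k) ω - Q (q k) ω) : ℝ) : ℂ) * Complex.I) ∂μ
      = (∫ ω, ξ ω ∂μ) * Complex.exp (((-((θ ^ 2 + η ^ 2) * (r k - q k) / 2) : ℝ)) : ℂ) := fun k =>
    S.cf_good hZm hZY hns (hs.trans_lt (hq k).1) ((hq k).2.1.trans (hr k).1).le (hr k).2.2 (hq k).2.2
      θ η ξ C (hξ.mono (hB1.mono (hq k).1.le) le_rfl) hC
  simp only [hval]
  apply Tendsto.const_mul
  have hcont : Continuous (fun x : ℝ => Complex.exp (((-((θ ^ 2 + η ^ 2) * x / 2) : ℝ)) : ℂ)) := by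
    fun_prop
  exact (hcont.tendsto _).comp (hrt.sub hqs)

lemma Sys.isBM_W {μ : Measure Ω} [IsProbabilityMeasure μ] {F : ℝ → MeasurableSpace Ω} {ρ σ : ℝ}
    {B₁ B₂ Y I₁ I₂ W Q : ℝ → Ω → ℝ} (S : Sys μ F ρ σ B₁ B₂ Y I₁ I₂ W Q)
    (h0 : ∀ᵐ ω ∂μ, W 0 ω = 0) : IsBM μ F W :=
  S.jointCF.isBM S.hB.1.le S.hB.1.mono S.adW h0 S.cW

lemma Sys.isBM_Q {μ : Measure Ω} [IsProbabilityMeasure μ] {F : ℝ → MeasurableSpace Ω} {ρ σ : ℝ}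
    {B₁ B₂ Y I₁ I₂ W Q : ℝ → Ω → ℝ} (S : Sys μ F ρ σ B₁ B₂ Y I₁ I₂ W Q)
    (h0 : ∀ᵐ ω ∂μ, Q 0 ω = 0) : IsBM μ F Q :=
  S.jointCF.swap.isBM S.hB.1.le S.hB.1.mono S.adQ h0 S.cQ

-- The bang-bang process: small ball estimates

lemma gauss_Icc {v : NNReal} (hv : v ≠ 0) (α β : ℝ) :
    gaussianReal 0 v (Icc α β) ≤ ENNReal.ofReal ((β - α) / (2 * Real.sqrt v)) := by
  rw [gaussianReal_apply _ hv]
  have hv0 : (0:ℝ) < v := by positivity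
  have h1 : ∀ x, gaussianPDF 0 v x ≤ ENNReal.ofReal (1 / (2 * Real.sqrt v)) := by
    intro x
    unfold gaussianPDF
    apply ENNReal.ofReal_le_ofReal
    rw [gaussianPDFReal_def]
    have h2 : Real.exp (-(x - 0) ^ 2 / (2 * v)) ≤ 1 := by
      rw [Real.exp_le_one_iff]
      apply div_nonpos_of_nonpos_of_nonneg
      · nlinarith [sq_nonneg (x - 0)]
      · positivity
    have h3 : 2 * Real.sqrt v ≤ Real.sqrt (2 * Real.pi * v) := by
      have : (2:ℝ) * Real.sqrt v = Real.sqrt (4 * v) := by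
        rw [Real.sqrt_mul (by norm_num)]
        congr 1
        rw [show (4:ℝ) = 2 ^ 2 by norm_num, Real.sqrt_sq (by norm_num)]
      rw [this]
      apply Real.sqrt_le_sqrt
      nlinarith [Real.pi_gt_three]
    have h4 : (0:ℝ) < 2 * Real.sqrt v := by positivity
    calc (Real.sqrt (2 * Real.pi * v))⁻¹ * Real.exp (-(x - 0) ^ 2 / (2 * v))
        ≤ (Real.sqrt (2 * Real.pi * v))⁻¹ * 1 := by gcongr
      _ ≤ 1 / (2 * Real.sqrt v) := by
          rw [mul_one, one_div]
          exact inv_anti₀ h4 h3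
  calc ∫⁻ x in Icc α β, gaussianPDF 0 v x
      ≤ ∫⁻ x in Icc α β, ENNReal.ofReal (1 / (2 * Real.sqrt v)) :=
        lintegral_mono fun x => h1 x
    _ = ENNReal.ofReal ((β - α) / (2 * Real.sqrt v)) := by
        rw [setLIntegral_const, Real.volume_Icc, ← ENNReal.ofReal_mul (by positivity)]
        congr 1; ring

lemma IsBM.small_ball {μ : Measure Ω} [IsProbabilityMeasure μ] {F : ℝ → MeasurableSpace Ω}
    {B : ℝ → Ω → ℝ} (h : IsBM μ F B) {s t : ℝ} (hs : 0 ≤ s) (hst : s < t) {ξ : Ω → ℝ}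
    (hξ : Measurable[F s] ξ) (c : ℝ) :
    μ {ω | |ξ ω + (B t ω - B s ω)| ≤ c} ≤ ENNReal.ofReal (c / Real.sqrt (t - s)) := by
  have hi := h.indepFun hs hst.le hξ
  have hξm : Measurable ξ := hξ.mono (h.le s) le_rfl
  have hG := h.inc_meas' hs (hs.trans hst.le)
  have hmap := (indepFun_iff_map_prod_eq_prod_map_map hξm.aemeasurable hG.aemeasurable).1 hi
  have hS : MeasurableSet {p : ℝ × ℝ | |p.1 + p.2| ≤ c} :=
    measurableSet_le (by fun_prop) measurable_const
  have h1 : μ {ω | |ξ ω + (B t ω - B s ω)| ≤ c}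
      = μ.map (fun ω => (ξ ω, B t ω - B s ω)) {p : ℝ × ℝ | |p.1 + p.2| ≤ c} := by
    rw [Measure.map_apply (hξm.prodMk hG) hS]; rfl
  have : IsProbabilityMeasure (μ.map ξ) := Measure.isProbabilityMeasure_map hξm.aemeasurable
  rw [h1, hmap, h.law s t hs hst.le, Measure.prod_apply hS]
  have hv : (t - s).toNNReal ≠ 0 := by
    simpa using hst
  calc ∫⁻ x, gaussianReal 0 (t - s).toNNReal (Prod.mk x ⁻¹' {p : ℝ × ℝ | |p.1 + p.2| ≤ c}) ∂(μ.map ξ)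
      ≤ ∫⁻ x, ENNReal.ofReal (c / Real.sqrt (t - s)) ∂(μ.map ξ) := by
        refine lintegral_mono fun x => ?_
        have : Prod.mk x ⁻¹' {p : ℝ × ℝ | |p.1 + p.2| ≤ c} = Icc (-c - x) (c - x) := by
          ext y
          simp only [mem_preimage, mem_setOf_eq, mem_Icc, abs_le]
          constructor <;> rintro ⟨h1, h2⟩ <;> constructor <;> linarith
        beta_reduce
        rw [this]
        refine (gauss_Icc hv _ _).trans (le_of_eq ?_)
        rw [Real.coe_toNNReal _ (by linarith)]
        congr 1
        have : 0 < Real.sqrt (t - s) := Real.sqrt_pos.2 (by linarith)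
        field_simp
        ring
    _ = _ := by simp

/-- The bang-bang equation driven by `W`. -/
structure BB (μ : Measure Ω) (F : ℝ → MeasurableSpace Ω) (lam y : ℝ) (W Y : ℝ → Ω → ℝ) : Prop where
  hl : 0 ≤ lam
  hW : IsBM μ F W
  adY : ∀ u, 0 ≤ u → Measurable[F u] (Y u)
  mY : ∀ u, Measurable (Y u)
  cY : ∀ᵐ ω ∂μ, Continuous fun t => Y t ω
  eq : ∀ᵐ ω ∂μ, ∀ t : ℝ, 0 ≤ t → Y t ω = y - lam * (∫ s in (0:ℝ)..t, psgn (Y s ω)) + W t ω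

lemma measurable_psgn : Measurable psgn :=
  Measurable.ite (measurableSet_lt measurable_const measurable_id) measurable_const measurable_const

lemma abs_psgn (y : ℝ) : |psgn y| = 1 := by unfold psgn; split_ifs <;> simp

lemma psgn_intble {f : ℝ → ℝ} (hf : Continuous f) (a b : ℝ) :
    IntervalIntegrable (fun u => psgn (f u)) volume a b := by
  refine IntervalIntegrable.mono_fun (g := fun u => psgn (f u)) (f := fun _ : ℝ => (1:ℝ))
    intervalIntegrable_const (measurable_psgn.comp hf.measurable).aestronglyMeasurable ?_
  refine Eventually.of_forall fun u => ?_
  simp [abs_psgn]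

/-- increments -/
lemma BB.inc {μ : Measure Ω} {F : ℝ → MeasurableSpace Ω} {lam y : ℝ} {W Y : ℝ → Ω → ℝ}
    (S : BB μ F lam y W Y) : ∀ᵐ ω ∂μ, ∀ s t : ℝ, 0 ≤ s → s ≤ t →
      Y t ω = Y s ω - lam * (∫ u in s..t, psgn (Y u ω)) + (W t ω - W s ω) := by
  filter_upwards [S.cY, S.eq] with ω hc he s t hs hst
  rw [he t (hs.trans hst), he s hs, ← intervalIntegral.integral_add_adjacent_intervals
    (psgn_intble hc 0 s) (psgn_intble hc s t)]
  ring

lemma abs_psgn_int (f : ℝ → ℝ) {s t : ℝ} (hst : s ≤ t) : |∫ u in s..t, psgn (f u)| ≤ t - s := by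
  have := intervalIntegral.norm_integral_le_of_norm_le_const (a := s) (b := t) (C := 1)
    (f := fun u => psgn (f u)) (fun u _ => by simp [abs_psgn])
  rwa [one_mul, abs_of_nonneg (sub_nonneg.2 hst), Real.norm_eq_abs] at this

lemma BB.small_ball {μ : Measure Ω} [IsProbabilityMeasure μ] {F : ℝ → MeasurableSpace Ω}
    {lam y : ℝ} {W Y : ℝ → Ω → ℝ} (S : BB μ F lam y W Y) {s b : ℝ} (hb : 0 < b) (hs : b ≤ s) :
    μ {ω | |Y s ω| ≤ b} ≤ ENNReal.ofReal ((1 + lam) * Real.sqrt b) := by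
  have h0 : 0 ≤ s - b := by linarith
  have h1 := S.hW.small_ball h0 (sub_lt_self s hb) (S.adY _ h0) ((1 + lam) * b)
  have h2 : μ {ω | |Y s ω| ≤ b} ≤ μ {ω | |Y (s - b) ω + (W s ω - W (s - b) ω)| ≤ (1 + lam) * b} := by
    apply measure_mono_ae
    filter_upwards [S.inc] with ω hω h
    change |Y s ω| ≤ b at h
    change |_| ≤ _
    have h3 := hω (s - b) s h0 (by linarith)
    have h4 := abs_psgn_int (fun u => Y u ω) (show s - b ≤ s by linarith)
    have h5 : Y (s - b) ω + (W s ω - W (s - b) ω) = Y s ω + lam * ∫ u in (s - b)..s, psgn (Y u ω) := by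
      rw [h3]; ring
    rw [h5]
    refine (abs_add_le _ _).trans ?_
    rw [abs_mul, abs_of_nonneg S.hl]
    have := mul_le_mul_of_nonneg_left h4 S.hl
    linarith
  refine h2.trans (h1.trans (le_of_eq ?_))
  congr 1
  rw [sub_sub_cancel, mul_div_assoc, Real.div_sqrt]

lemma BB.null {μ : Measure Ω} [IsProbabilityMeasure μ] {F : ℝ → MeasurableSpace Ω}
    {lam y : ℝ} {W Y : ℝ → Ω → ℝ} (S : BB μ F lam y W Y) {s : ℝ} (hs : 0 < s) :
    μ {ω | Y s ω = 0} = 0 := by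
  have h1 : Tendsto (fun b : ℝ => ENNReal.ofReal ((1 + lam) * Real.sqrt b)) (nhdsWithin 0 (Ioi 0))
      (nhds 0) := by
    have : Continuous (fun b : ℝ => ENNReal.ofReal ((1 + lam) * Real.sqrt b)) :=
      ENNReal.continuous_ofReal.comp (by fun_prop)
    have h2 := this.tendsto 0
    simp only [Real.sqrt_zero, mul_zero, ENNReal.ofReal_zero] at h2
    exact h2.mono_left nhdsWithin_le_nhds
  refine le_antisymm (ge_of_tendsto h1 ?_) zero_le
  have h3 : ∀ᶠ b in nhdsWithin (0:ℝ) (Ioi 0), b ≤ s :=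
    nhdsWithin_le_nhds (Iic_mem_nhds hs)
  filter_upwards [h3, self_mem_nhdsWithin] with b hb hb0
  refine le_trans (measure_mono ?_) (S.small_ball hb0 hb)
  intro ω hω
  have hω' : Y s ω = 0 := hω
  have hb0' : (0:ℝ) < b := hb0
  simp [hω', hb0'.le]

/-- a.s. the zero set is Lebesgue null -/
lemma BB.ae_null {μ : Measure Ω} [IsProbabilityMeasure μ] {F : ℝ → MeasurableSpace Ω}
    {lam y : ℝ} {W Y : ℝ → Ω → ℝ} (S : BB μ F lam y W Y) :
    ∀ᵐ ω ∂μ, ∀ᵐ u ∂(volume.restrict (Ioi (0:ℝ))), Y u ω ≠ 0 := by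
  obtain ⟨Z, hZc, hZm0, hZY⟩ := exists_contMod S.mY S.cY
  have hZm : Measurable (Function.uncurry Z) :=
    measurable_uncurry_of_continuous_of_measurable hZc hZm0
  have hZm' : Measurable (fun p : Ω × ℝ => Z p.2 p.1) := hZm.comp measurable_swap
  have h2 : ∀ᵐ ω ∂μ, ∀ᵐ u ∂(volume.restrict (Ioi (0:ℝ))), Z u ω ≠ 0 := by
    rw [Measure.ae_ae_comm (p := fun ω u => Z u ω ≠ 0) (hZm' (measurableSet_singleton 0)).compl]
    filter_upwards [ae_restrict_mem measurableSet_Ioi] with u hu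
    have h2 := measure_eq_zero_iff_ae_notMem.1 (S.null hu)
    filter_upwards [h2, hZY] with ω h3 h4
    rw [h4]; exact h3
  filter_upwards [h2, hZY] with ω h3 h4
  filter_upwards [h3] with u hu
  rwa [← h4]

lemma ai_continuousAt {y : ℝ} (hy : y ≠ 0) : ContinuousAt ai y := by
  rcases lt_or_gt_of_ne hy with h | h
  · have : ai =ᶠ[nhds y] fun _ => 1 := by
      filter_upwards [Iio_mem_nhds h] with x hx
      have : x ≤ 0 := le_of_lt hx
      simp [ai, this]
    exact continuousAt_const.congr this.symm
  · have : ai =ᶠ[nhds y] fun _ => 0 := by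
      filter_upwards [Ioi_mem_nhds h] with x hx
      have : ¬ x ≤ 0 := not_le.2 hx
      simp [ai, this]
    exact continuousAt_const.congr this.symm

lemma BB.kap_tendsto {μ : Measure Ω} [IsProbabilityMeasure μ] {F : ℝ → MeasurableSpace Ω}
    {lam y : ℝ} {W Y Z : ℝ → Ω → ℝ} (S : BB μ F lam y W Y) (hZc : ∀ ω, Continuous fun t => Z t ω)
    (hZm0 : ∀ t, Measurable (Z t)) (hZY : ∀ᵐ ω ∂μ, ∀ t, Z t ω = Y t ω) {t : ℝ} (ht : 0 < t) :
    Tendsto (fun n => kap μ Z t n) atTop (nhds 0) := by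
  have hZm : Measurable (Function.uncurry Z) :=
    measurable_uncurry_of_continuous_of_measurable hZc hZm0
  have hprob : ∀ u ∈ Ioc 0 t, Tendsto (fun n => ∫⁻ ω, ‖ai (Z (lpt t n u) ω) - ai (Z u ω)‖ₑ ∂μ)
      atTop (nhds 0) := by
    intro u hu
    have h0 : (0 : ENNReal) = ∫⁻ ω, 0 ∂μ := by simp
    rw [h0]
    refine tendsto_lintegral_of_dominated_convergence (fun _ => 1) ?_ ?_ (by simp) ?_
    · intro n
      exact ((measurable_ai.comp (hZm0 _)).sub (measurable_ai.comp (hZm0 _))).enorm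
    · intro n; exact Eventually.of_forall fun ω => enorm_ai_sub_le _ _
    · have h2 := measure_eq_zero_iff_ae_notMem.1 (S.null hu.1)
      filter_upwards [h2, hZY] with ω h3 h4
      have h5 : Z u ω ≠ 0 := by rw [h4]; exact h3
      have h6 : Tendsto (fun n => Z (lpt t n u) ω) atTop (nhds (Z u ω)) :=
        ((hZc ω).tendsto u).comp (tendsto_lpt ht hu.1 hu.2)
      have h7 := (ai_continuousAt h5).tendsto.comp h6
      have h8 : Tendsto (fun n => ai (Z (lpt t n u) ω) - ai (Z u ω)) atTop (nhds 0) := by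
        have := h7.sub (tendsto_const_nhds (x := ai (Z u ω)))
        simpa using this
      exact tendsto_zero_iff_enorm_tendsto_zero.1 h8
  unfold kap
  have h0 : (0 : ENNReal) = ∫⁻ u in Ioc 0 t, 0 := by simp
  rw [h0]
  refine tendsto_lintegral_of_dominated_convergence' (fun _ => 1) ?_ ?_ ?_ ?_
  · intro n
    apply Measurable.aemeasurable
    apply Measurable.lintegral_prod_right (f := fun u ω => ‖ai (Z (lpt t n u) ω) - ai (Z u ω)‖ₑ)
    exact ((measurable_ai_comp hZm ((measurable_lpt t n).comp measurable_fst) measurable_snd).sub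
      (measurable_ai_comp hZm measurable_fst measurable_snd)).enorm
  · intro n
    refine Eventually.of_forall fun u => ?_
    calc ∫⁻ ω, ‖ai (Z (lpt t n u) ω) - ai (Z u ω)‖ₑ ∂μ ≤ ∫⁻ ω, 1 ∂μ :=
          lintegral_mono fun ω => enorm_ai_sub_le _ _
      _ = 1 := by simp
  · simp
  · filter_upwards [ae_restrict_mem measurableSet_Ioc] with u hu
    exact hprob u hu

-- Fatou in measure, and associativity of the stochastic integral

lemma TIM.fatou {μ : Measure Ω} {f : ℕ → Ω → ℝ} {g : Ω → ℝ}
    (hf : ∀ n, AEMeasurable (f n) μ) (h : TendstoInMeasure μ f atTop g) {φ : ℝ → ENNReal}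
    (hφ : Continuous φ) {C : ℕ → ENNReal} {c : ENNReal} (hC : ∀ n, ∫⁻ ω, φ (f n ω) ∂μ ≤ C n)
    (hc : Tendsto C atTop (nhds c)) : ∫⁻ ω, φ (g ω) ∂μ ≤ c := by
  obtain ⟨ns, hns, hae⟩ := h.exists_seq_tendsto_ae
  have h1 : ∀ᵐ ω ∂μ, φ (g ω) = liminf (fun k => φ (f (ns k) ω)) atTop := by
    filter_upwards [hae] with ω hω
    exact ((hφ.tendsto _).comp hω).liminf_eq.symm
  rw [lintegral_congr_ae h1]
  refine (lintegral_liminf_le' fun k => hφ.measurable.comp_aemeasurable (hf _)).trans ?_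
  have h2 : Tendsto (fun k => C (ns k)) atTop (nhds c) := hc.comp hns.tendsto_atTop
  rw [← h2.liminf_eq]
  exact liminf_le_liminf (Eventually.of_forall fun k => hC _)

lemma TIM.of_lsq {μ : Measure Ω} [IsFiniteMeasure μ] {ι : Type*} {l : Filter ι} {f : ι → Ω → ℝ}
    (hf : ∀ i, AEMeasurable (f i) μ) {C : ι → ENNReal}
    (h : ∀ i, ∫⁻ ω, ENNReal.ofReal ((f i ω) ^ 2) ∂μ ≤ C i) (hC : Tendsto C l (nhds 0)) :
    TendstoInMeasure μ f l (fun _ => 0) := by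
  rw [tendstoInMeasure_iff_norm]
  intro ε hε
  have h1 : Tendsto (fun i => C i / ENNReal.ofReal (ε ^ 2)) l (nhds 0) := by
    have := ENNReal.Tendsto.div_const hC (b := ENNReal.ofReal (ε ^ 2))
      (Or.inr (by simpa using hε.ne'))
    simpa using this
  refine tendsto_of_tendsto_of_tendsto_of_le_of_le tendsto_const_nhds h1 (fun _ => zero_le) ?_
  intro i
  have h2 : {x | ε ≤ ‖f i x - 0‖} ⊆ {x | ENNReal.ofReal (ε ^ 2) ≤ ENNReal.ofReal ((f i x) ^ 2)} := by
    intro x hx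
    simp only [sub_zero, mem_setOf_eq, Real.norm_eq_abs] at hx ⊢
    apply ENNReal.ofReal_le_ofReal
    rw [← sq_abs (f i x)]
    gcongr
  refine (measure_mono h2).trans ((meas_ge_le_lintegral_div ?_ ?_ ?_).trans ?_)
  · exact ((hf i).pow_const 2).ennreal_ofReal
  · simpa using hε.ne'
  · simp
  · exact ENNReal.div_le_div_right (h i) _

lemma TIM.sum {μ : Measure Ω} {ι κ : Type*} {l : Filter ι} (s : Finset κ) {f : κ → ι → Ω → ℝ}
    {g : κ → Ω → ℝ} (h : ∀ k ∈ s, TendstoInMeasure μ (f k) l (g k)) :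
    TendstoInMeasure μ (fun i ω => ∑ k ∈ s, f k i ω) l (fun ω => ∑ k ∈ s, g k ω) := by
  classical
  induction s using Finset.induction_on with
  | empty => simpa using TIM.const (l := l) (μ := μ) (fun _ => (0:ℝ))
  | insert a s ha ih =>
    simp only [Finset.sum_insert ha]
    exact TIM.add (h a (Finset.mem_insert_self _ _))
      (ih fun k hk => h k (Finset.mem_insert_of_mem hk))

lemma TIM.bdd_mul {μ : Measure Ω} {ι : Type*} {l : Filter ι} {f : ι → Ω → ℝ} {g ξ : Ω → ℝ}
    (h : TendstoInMeasure μ f l g) (hξ : ∀ ω, |ξ ω| ≤ 1) :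
    TendstoInMeasure μ (fun i ω => ξ ω * f i ω) l (fun ω => ξ ω * g ω) := by
  rw [tendstoInMeasure_iff_norm] at h ⊢
  intro ε hε
  refine tendsto_of_tendsto_of_tendsto_of_le_of_le tendsto_const_nhds (h ε hε) (fun _ => zero_le) ?_
  intro i
  apply measure_mono
  intro ω hω
  simp only [mem_setOf_eq, ← mul_sub, norm_mul] at hω ⊢
  refine hω.trans ?_
  have := hξ ω
  rw [← Real.norm_eq_abs] at this
  nlinarith [norm_nonneg (f i ω - g ω)]

lemma sum_block (f : ℕ → ℝ) (M k : ℕ) :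
    ∑ j ∈ Finset.range (k * M), f j = ∑ i ∈ Finset.range k, ∑ l ∈ Finset.range M, f (i * M + l) := by
  induction k with
  | zero => simp
  | succ k ih => rw [Nat.succ_mul, Finset.sum_range_add, ih, Finset.sum_range_succ]

lemma grid_mul (t : ℝ) (n k i l : ℕ) :
    t * ((i * 2 ^ k : ℕ) : ℝ) / 2 ^ (n + k) = t * i / 2 ^ n := by
  push_cast
  rw [pow_add]
  field_simp

lemma csum_grid {H X : ℝ → Ω → ℝ} {t : ℝ} (ht : 0 ≤ t) (n k i : ℕ) (hi : i ≤ 2 ^ n) (ω : Ω) :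
    csum H X t (n + k) (t * i / 2 ^ n) ω = ∑ j ∈ Finset.range (i * 2 ^ k),
      H (t * j / 2 ^ (n + k)) ω * (X (t * (j + 1) / 2 ^ (n + k)) ω - X (t * j / 2 ^ (n + k)) ω) := by
  have hg := grid_mul t n k i 0
  have hmono : ∀ a b : ℝ, a ≤ b → t * a / 2 ^ (n + k) ≤ t * b / 2 ^ (n + k) := by
    intro a b hab; gcongr
  unfold csum
  symm
  rw [← hg]
  have hsub : Finset.range (i * 2 ^ k) ⊆ Finset.range (2 ^ (n + k)) := by
    apply Finset.range_subset_range.2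
    rw [pow_add]; exact Nat.mul_le_mul_right _ hi
  rw [← Finset.sum_subset hsub]
  · apply Finset.sum_congr rfl
    intro j hj
    have hj' : j + 1 ≤ i * 2 ^ k := Finset.mem_range.1 hj
    have hj2 : (j : ℝ) + 1 ≤ ((i * 2 ^ k : ℕ) : ℝ) := by exact_mod_cast hj'
    rw [min_eq_left (hmono _ _ (by linarith)), min_eq_left (hmono _ _ hj2)]
  · intro j _ hj
    have hj' : i * 2 ^ k ≤ j := by simpa using hj
    have hj2 : ((i * 2 ^ k : ℕ) : ℝ) ≤ (j : ℝ) := by exact_mod_cast hj'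
    rw [min_eq_right (hmono _ _ hj2), min_eq_right (hmono _ _ (by linarith))]
    simp

/-- left coarse grid point -/
def flo (t : ℝ) (n : ℕ) (u : ℝ) : ℝ := t * (⌊2 ^ n * u / t⌋₊ : ℝ) / 2 ^ n

lemma flo_nonneg {t : ℝ} (ht : 0 ≤ t) (n : ℕ) (u : ℝ) : 0 ≤ flo t n u := by unfold flo; positivity

lemma flo_le {t : ℝ} (ht : 0 < t) (n : ℕ) {u : ℝ} (hu : 0 ≤ u) : flo t n u ≤ u := by
  unfold flo
  have := Nat.floor_le (show 0 ≤ 2 ^ n * u / t by positivity)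
  rw [div_le_iff₀ (by positivity)]
  rw [le_div_iff₀ ht] at this
  linarith

lemma flo_grid {t : ℝ} (ht : 0 < t) (n k j : ℕ) :
    flo t n (t * j / 2 ^ (n + k)) = t * ((j / 2 ^ k : ℕ) : ℝ) / 2 ^ n := by
  unfold flo
  have h1 : 2 ^ n * (t * j / 2 ^ (n + k)) / t = (j : ℝ) / ((2 ^ k : ℕ) : ℝ) := by
    rw [pow_add]; push_cast; field_simp
  rw [h1, Nat.floor_div_eq_div]

lemma flo_lpt {t : ℝ} (ht : 0 < t) (n k : ℕ) {u : ℝ} (hu : 0 < u) (hut : u ≤ t) :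
    flo t n (lpt t (n + k) u) = lpt t n u := by
  obtain ⟨a, _, ha, ha1, ha2⟩ := lpt_spec ht (n + k) hu hut
  obtain ⟨b, _, hb, hb1, hb2⟩ := lpt_spec ht n hu hut
  rw [ha, hb, flo_grid ht]
  have hk : (0:ℝ) < 2 ^ k := by positivity
  have h1 : b * 2 ^ k < a + 1 := by
    have := hb1.trans_le ha2
    rw [div_lt_div_iff₀ (by positivity) (by positivity), pow_add] at this
    have h2 : (b : ℝ) * 2 ^ k < a + 1 := by
      have h3 : (t * 2 ^ n) * ((b : ℝ) * 2 ^ k) < (t * 2 ^ n) * (a + 1) := by linarith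
      exact lt_of_mul_lt_mul_left h3 (by positivity)
    exact_mod_cast h2
  have h2 : a < (b + 1) * 2 ^ k := by
    have := ha1.trans_le hb2
    rw [div_lt_div_iff₀ (by positivity) (by positivity), pow_add] at this
    have h2 : (a : ℝ) < (b + 1) * 2 ^ k := by
      have h3 : (t * 2 ^ n) * (a : ℝ) < (t * 2 ^ n) * ((b + 1) * 2 ^ k) := by linarith
      exact lt_of_mul_lt_mul_left h3 (by positivity)
    exact_mod_cast h2
  have h3 : a / 2 ^ k = b := by
    apply Nat.div_eq_of_lt_le
    · omega
    · exact h2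
  rw [h3]

lemma BB.csum_tendsto {μ : Measure Ω} [IsProbabilityMeasure μ] {F : ℝ → MeasurableSpace Ω}
    {lam y : ℝ} {W Y B I : ℝ → Ω → ℝ} (S : BB μ F lam y W Y) (hB : IsBM μ F B) (p q : ℝ)
    (hI : ∀ t, 0 ≤ t → TendstoInMeasure μ (fun n => rsum (fun s ω => if Y s ω ≤ 0 then p else q) B t n)
      atTop (I t)) {s t : ℝ} (hs : 0 ≤ s) (hst : s ≤ t) (ht : 0 < t) :
    TendstoInMeasure μ (fun n => csum (fun s ω => if Y s ω ≤ 0 then p else q) B t n s) atTop (I s) := by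
  obtain ⟨Z, hZc, hZm0, hZY⟩ := exists_contMod S.mY S.cY
  have hZm : Measurable (Function.uncurry Z) :=
    measurable_uncurry_of_continuous_of_measurable hZc hZm0
  rcases hs.eq_or_lt with rfl | hs0
  · refine TIM.of_eq (hI 0 le_rfl) ?_ (Eventually.of_forall fun _ => rfl)
    intro n ω
    have h1 : rsum (fun s ω => if Y s ω ≤ 0 then p else q) B 0 n ω = 0 := by
      unfold rsum; simp
    rw [h1]
    unfold csum
    symm
    apply Finset.sum_eq_zero
    intro i _
    rw [min_eq_right (by positivity), min_eq_right (by positivity)]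
    simp
  · have h1 := csum_compare (N := fun n => n) (N' := fun n => n) hB S.adY hZm hZY p q ht hs0 hs hst le_rfl
      (S.kap_tendsto hZc hZm0 hZY ht) (S.kap_tendsto hZc hZm0 hZY hs0)
    refine TIM.of_eq (TIM.add h1 (hI s hs)) ?_ (Eventually.of_forall fun ω => by simp)
    intro n ω
    simp only [csum_self hs]
    ring

lemma BB.lemK {μ : Measure Ω} [IsProbabilityMeasure μ] {F : ℝ → MeasurableSpace Ω}
    {lam y : ℝ} {W Y B I : ℝ → Ω → ℝ} (S : BB μ F lam y W Y) (hB : IsBM μ F B) (p q : ℝ)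
    (hI : ∀ t, 0 ≤ t → TendstoInMeasure μ (fun n => rsum (fun s ω => if Y s ω ≤ 0 then p else q) B t n)
      atTop (I t)) {t : ℝ} (ht : 0 < t) :
    TendstoInMeasure μ (fun n ω => rsum (fun s ω => if Y s ω ≤ 0 then 0 else 1) I t n ω -
      rsum (fun s ω => if Y s ω ≤ 0 then 0 else q) B t n ω) atTop (fun _ => 0) := by
  obtain ⟨Z, hZc, hZm0, hZY⟩ := exists_contMod S.mY S.cY
  have hZm : Measurable (Function.uncurry Z) :=
    measurable_uncurry_of_continuous_of_measurable hZc hZm0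
  set c : ℝ → Ω → ℝ := fun s ω => if Y s ω ≤ 0 then p else q with hc
  set H : ℝ → Ω → ℝ := fun s ω => if Y s ω ≤ 0 then 0 else 1 with hH
  have hH1 : ∀ u ω, |H u ω| ≤ 1 := by
    intro u ω; simp only [hH]; split_ifs <;> simp
  set G : ℕ → ℝ → Ω → ℝ := fun n u ω => H (flo t n u) ω * (c u ω - c (flo t n u) ω) with hG
  have hGm : ∀ n u, 0 ≤ u → Measurable[F u] (G n u) := by
    intro n u hu
    have h1 := flo_le ht n hu
    have h2 := flo_nonneg ht.le n u
    have e1 := (coef_meas S.adY 0 1 _ h2).mono (hB.mono h1) le_rfl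
    have e2 := (coef_meas S.adY p q _ h2).mono (hB.mono h1) le_rfl
    exact Measurable.mul e1 (Measurable.sub (coef_meas S.adY p q u hu) e2)
  have hGC : ∀ n u ω, |G n u ω| ≤ 2 * (|p| + |q|) := by
    intro n u ω
    simp only [hG, abs_mul]
    have h1 := hH1 (flo t n u) ω
    have h2 : |c u ω - c (flo t n u) ω| ≤ 2 * (|p| + |q|) := by
      refine (abs_sub _ _).trans ?_
      have := coef_bdd p q (Y u ω)
      have := coef_bdd p q (Y (flo t n u) ω)
      simp only [hc]; linarith
    nlinarith [abs_nonneg (H (flo t n u) ω), abs_nonneg (c u ω - c (flo t n u) ω)]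
  -- the approximation
  have hR : ∀ n k ω, ∑ i ∈ Finset.range (2 ^ n), H (t * i / 2 ^ n) ω *
      ((csum c B t (n + k) (t * (i + 1) / 2 ^ n) ω - csum c B t (n + k) (t * i / 2 ^ n) ω) -
        c (t * i / 2 ^ n) ω * (B (t * (i + 1) / 2 ^ n) ω - B (t * i / 2 ^ n) ω))
      = rsum (G n) B t (n + k) ω := by
    intro n k ω
    unfold rsum
    rw [pow_add 2 n k, sum_block]
    apply Finset.sum_congr rfl
    intro i hi
    have hi' : i + 1 ≤ 2 ^ n := Finset.mem_range.1 hi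
    have e1 := csum_grid (H := c) (X := B) ht.le n k i (by omega) ω
    have e2 := csum_grid (H := c) (X := B) ht.le n k (i + 1) hi' ω
    rw [Nat.succ_mul, Finset.sum_range_add, ← e1] at e2
    push_cast at e2
    rw [e2, add_sub_cancel_left]
    have e3 : B (t * (i + 1) / 2 ^ n) ω - B (t * i / 2 ^ n) ω = ∑ l ∈ Finset.range (2 ^ k),
        (B (t * ((i * 2 ^ k + l : ℝ) + 1) / 2 ^ (n + k)) ω - B (t * (i * 2 ^ k + l : ℝ) / 2 ^ (n + k)) ω) := by
      have := Finset.sum_range_sub (fun l : ℕ => B (t * (i * 2 ^ k + l : ℝ) / 2 ^ (n + k)) ω) (2 ^ k)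
      push_cast at this
      simp only [add_assoc] at this ⊢
      rw [this]
      congr 2
      · rw [pow_add]; field_simp
      · rw [pow_add]; field_simp; simp
    rw [e3, Finset.mul_sum, ← Finset.sum_sub_distrib, Finset.mul_sum]
    apply Finset.sum_congr rfl
    intro l hl
    have hl' : l < 2 ^ k := Finset.mem_range.1 hl
    have e4 : flo t n (t * (i * 2 ^ k + l : ℝ) / 2 ^ (n + k)) = t * i / 2 ^ n := by
      have := flo_grid ht n k (i * 2 ^ k + l)
      rw [Nat.add_comm, Nat.add_mul_div_right _ _ (by positivity), Nat.div_eq_of_lt hl', zero_add] at this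
      rw [← this]; push_cast; ring_nf
    simp only [hG]
    push_cast
    rw [e4]
    ring
  have hlim : ∀ n, TendstoInMeasure μ (fun k => rsum (G n) B t (n + k)) atTop
      (fun ω => rsum H I t n ω - rsum (fun s ω => if Y s ω ≤ 0 then 0 else q) B t n ω) := by
    intro n
    have hD : ∀ i : ℕ, i ≤ 2 ^ n → TendstoInMeasure μ (fun k => csum c B t (n + k) (t * i / 2 ^ n)) atTop
        (I (t * i / 2 ^ n)) := by
      intro i hi
      exact (S.csum_tendsto hB p q hI (by positivity) (grid_le ht.le hi) ht).comp
        (tendsto_add_atTop_nat n |>.congr fun k => add_comm _ _)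
    have h1 := TIM.sum (Finset.range (2 ^ n)) (μ := μ) (l := atTop)
      (f := fun i k ω => H (t * i / 2 ^ n) ω *
      ((csum c B t (n + k) (t * (i + 1) / 2 ^ n) ω - csum c B t (n + k) (t * i / 2 ^ n) ω) -
        c (t * i / 2 ^ n) ω * (B (t * (i + 1) / 2 ^ n) ω - B (t * i / 2 ^ n) ω)))
      (g := fun i ω => H (t * i / 2 ^ n) ω *
      ((I (t * (i + 1) / 2 ^ n) ω - I (t * i / 2 ^ n) ω) -
        c (t * i / 2 ^ n) ω * (B (t * (i + 1) / 2 ^ n) ω - B (t * i / 2 ^ n) ω))) ?_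
    · refine TIM.of_eq h1 (fun k ω => hR n k ω) (Eventually.of_forall fun ω => ?_)
      unfold rsum
      rw [← Finset.sum_sub_distrib]
      apply Finset.sum_congr rfl
      intro i _
      simp only [hH, hc]
      split_ifs <;> ring
    · intro i hi
      have hi' : i + 1 ≤ 2 ^ n := Finset.mem_range.1 hi
      have hd := hD (i + 1) hi'
      push_cast at hd
      exact TIM.bdd_mul (TIM.sub (TIM.sub hd (hD i (by omega))) (TIM.const _)) (hH1 _)
  have hmL : ∀ n k, MemLp (rsum (G n) B t (n + k)) 2 μ := by
    intro n k
    have := csum_memLp hB (hGm n) (hGC n) ht.le ht.le (n + k)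
    have h2 : csum (G n) B t (n + k) t = rsum (G n) B t (n + k) := by
      ext ω; exact csum_self ht.le _ _
    rwa [h2] at this
  have hbd : ∀ n k, ∫⁻ ω, ENNReal.ofReal ((rsum (G n) B t (n + k) ω) ^ 2) ∂μ
      ≤ ENNReal.ofReal ((p - q) ^ 2) * (kap μ Z t (n + k) + kap μ Z t n) := by
    intro n k
    rw [← ofReal_integral_eq_lintegral_ofReal (hmL n k).integrable_sq
      (Eventually.of_forall fun ω => sq_nonneg _)]
    have h1 := csum_diff_sq (H' := fun _ _ => 0) hB (hGm n) (fun _ _ => measurable_const) (hGC n)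
      (fun _ _ => by simp; positivity) ht ht ht.le le_rfl le_rfl (n + k) 0
    have h2 : ∀ ω, csum (fun _ _ => 0) B t 0 t ω = 0 := fun ω => by unfold csum; simp
    simp only [csum_self ht.le, sub_zero] at h1
    have h3 : ∀ ω, rsum (fun _ _ => 0) B t 0 ω = 0 := fun ω => by unfold rsum; simp
    simp only [h3, sub_zero] at h1
    rw [h1]
    rw [← Real.enorm_eq_ofReal (integral_nonneg fun u => integral_nonneg fun ω => sq_nonneg _)]
    have h4 := kap_sub_le' (μ := μ) (G := fun u ω => if 0 < u ∧ u ≤ t then (G n (lpt t (n + k) u) ω) ^ 2 else 0)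
      hZm hZY p q (le_refl t) (le_refl t) (n + k) n ?_
    · refine le_trans (le_of_eq ?_) h4
      congr 1
      apply setIntegral_congr_fun measurableSet_Ioc
      intro u hu
      have hu' : 0 < u ∧ u ≤ t := hu
      simp only [hu', and_self, if_true]
    · intro u ω
      beta_reduce
      by_cases hu : 0 < u ∧ u ≤ t
      · rw [if_pos hu]
        simp only [hG]
        rw [flo_lpt ht n k hu.1 hu.2, mul_pow, abs_mul, abs_of_nonneg (sq_nonneg (c _ ω - c _ ω))]
        have h5 : |H (lpt t n u) ω ^ 2| ≤ 1 := by
          rw [abs_pow]; exact pow_le_one₀ (abs_nonneg _) (hH1 _ _)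
        exact mul_le_of_le_one_left (sq_nonneg _) h5
      · rw [if_neg hu, abs_zero]; exact sq_nonneg _
  have hk := S.kap_tendsto hZc hZm0 hZY ht
  refine TIM.of_lsq (C := fun n => ENNReal.ofReal ((p - q) ^ 2) * (0 + kap μ Z t n)) ?_ ?_ ?_
  · intro n
    exact ((hlim n).aestronglyMeasurable (fun k => (hmL n k).1)).aemeasurable
  · intro n
    refine TIM.fatou (fun k => (hmL n k).1.aemeasurable) (hlim n) (φ := fun x => ENNReal.ofReal (x ^ 2))
      (ENNReal.continuous_ofReal.comp (by fun_prop)) (hbd n) ?_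
    refine ENNReal.Tendsto.const_mul ?_ (Or.inr ENNReal.ofReal_ne_top)
    exact ((hk.comp (tendsto_add_atTop_nat n)).congr fun k => by simp [add_comm]).add tendsto_const_nhds
  · have : Tendsto (fun n => ENNReal.ofReal ((p - q) ^ 2) * (0 + kap μ Z t n)) atTop
      (nhds (ENNReal.ofReal ((p - q) ^ 2) * (0 + 0))) :=
      ENNReal.Tendsto.const_mul (tendsto_const_nhds.add hk) (Or.inr ENNReal.ofReal_ne_top)
    simpa using this

-- The bang-bang process is a functional of the driving Brownian motion

/-- resolvent of the sign function -/
def rsv (d z : ℝ) : ℝ := z - max (-d) (min d z)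

lemma rsv_lip {d : ℝ} (hd : 0 ≤ d) (z z' : ℝ) : |rsv d z - rsv d z'| ≤ |z - z'| := by
  wlog h : z' ≤ z generalizing z z'
  · rw [abs_sub_comm, abs_sub_comm z]
    exact this _ _ (by linarith)
  unfold rsv
  rw [abs_of_nonneg (sub_nonneg.2 h), abs_le]
  have h1 : max (-d) (min d z') ≤ max (-d) (min d z) := by gcongr
  have h2 : max (-d) (min d z) ≤ max (-d) (min d z') + (z - z') := by
    apply max_le
    · have := le_max_left (-d) (min d z'); linarith
    · rcases le_total d z' with h3 | h3
      · have := le_max_right (-d) (min d z')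
        rw [min_eq_left h3] at this ⊢
        have := min_le_left d z
        linarith
      · have := le_max_right (-d) (min d z')
        rw [min_eq_right h3] at this ⊢
        have := min_le_right d z
        linarith
  constructor <;> linarith

lemma rsv_psgn {d : ℝ} (hd : 0 ≤ d) (v : ℝ) : rsv d (v + d * psgn v) = v := by
  unfold rsv psgn
  split_ifs with h
  · rw [min_eq_left (by linarith), max_eq_right (by linarith)]; ring
  · rw [min_eq_right (by linarith), max_eq_left (by linarith)]; ring

/-- implicit Euler scheme -/
def eul (d y : ℝ) (w : ℕ → ℝ) : ℕ → ℝ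
  | 0 => y
  | i + 1 => rsv d (eul d y w i + (w (i + 1) - w i))

def rpt (t : ℝ) (n : ℕ) (u : ℝ) : ℝ := t * (⌈2 ^ n * u / t⌉₊ : ℝ) / 2 ^ n

lemma measurable_rpt (t : ℝ) (n : ℕ) : Measurable (rpt t n) := by
  unfold rpt
  have h1 : Measurable fun u : ℝ => ⌈2 ^ n * u / t⌉₊ := Nat.measurable_ceil.comp (by fun_prop)
  have h2 : Measurable fun u : ℝ => ((⌈2 ^ n * u / t⌉₊ : ℕ) : ℝ) := measurable_from_top.comp h1
  fun_prop

lemma rpt_cell {t : ℝ} (ht : 0 < t) (n i : ℕ) {u : ℝ} (h1 : t * i / 2 ^ n < u)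
    (h2 : u ≤ t * (i + 1) / 2 ^ n) : rpt t n u = t * (i + 1) / 2 ^ n := by
  unfold rpt
  have : ⌈2 ^ n * u / t⌉₊ = i + 1 := by
    rw [Nat.ceil_eq_iff (by omega)]
    rw [div_lt_iff₀ (by positivity)] at h1
    rw [le_div_iff₀ (by positivity)] at h2
    constructor
    · rw [lt_div_iff₀ ht, Nat.add_sub_cancel]; linarith
    · rw [div_le_iff₀ ht]; push_cast; linarith
  rw [this]; push_cast; rfl

lemma tendsto_rpt {t : ℝ} (ht : 0 < t) {u : ℝ} (hu : 0 < u) :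
    Tendsto (fun n => rpt t n u) atTop (nhds u) := by
  have h1 : Tendsto (fun n : ℕ => u + t * (1 / 2) ^ n) atTop (nhds (u + t * 0)) :=
    tendsto_const_nhds.add ((tendsto_pow_atTop_nhds_zero_of_lt_one (by norm_num) (by norm_num)).const_mul t)
  rw [mul_zero, add_zero] at h1
  refine tendsto_of_tendsto_of_tendsto_of_le_of_le tendsto_const_nhds h1 ?_ ?_
  · intro n
    change u ≤ rpt t n u
    unfold rpt
    have := Nat.le_ceil (2 ^ n * u / t)
    rw [div_le_iff₀ ht] at this
    rw [le_div_iff₀ (by positivity)]; linarith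
  · intro n
    change rpt t n u ≤ _
    unfold rpt
    have := (Nat.ceil_lt_add_one (show 0 ≤ 2 ^ n * u / t by positivity)).le
    rw [div_add_one ht.ne', le_div_iff₀ ht] at this
    rw [div_le_iff₀ (by positivity), add_mul, mul_assoc t, ← mul_pow]
    norm_num
    linarith

lemma abs_psgn_sub_le (a b : ℝ) : |psgn a - psgn b| ≤ 2 := by
  unfold psgn; split_ifs <;> norm_num

lemma psgn_sub_intble {f : ℝ → ℝ} (hf : Continuous f) {r : ℝ → ℝ} (hr : Measurable r) (a b : ℝ) :
    IntervalIntegrable (fun u => |psgn (f u) - psgn (f (r u))|) volume a b := by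
  refine IntervalIntegrable.mono_fun (f := fun _ : ℝ => (2:ℝ))
    intervalIntegrable_const ?_ ?_
  · have h1 : Measurable fun u => psgn (f u) := measurable_psgn.comp hf.measurable
    have h2 : Measurable fun u => psgn (f (r u)) := measurable_psgn.comp (hf.measurable.comp hr)
    exact (h1.sub h2).norm.aestronglyMeasurable
  · refine Eventually.of_forall fun u => ?_
    simpa using abs_psgn_sub_le _ _

lemma eul_err {lam t : ℝ} (hl : 0 ≤ lam) (ht : 0 < t) {Y W : ℝ → ℝ} (hY : Continuous Y)
    (hinc : ∀ s t : ℝ, 0 ≤ s → s ≤ t → Y t = Y s - lam * (∫ u in s..t, psgn (Y u)) + (W t - W s))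
    (n i : ℕ) :
    |eul (lam * (t / 2 ^ n)) (Y 0) (fun i => W (t * i / 2 ^ n)) i - Y (t * i / 2 ^ n)|
      ≤ lam * ∫ u in (0:ℝ)..(t * i / 2 ^ n), |psgn (Y u) - psgn (Y (rpt t n u))| := by
  induction i with
  | zero => simp [eul]
  | succ i ih =>
    push_cast
    set a := t * i / 2 ^ n with ha
    set b := t * ((i:ℝ) + 1) / 2 ^ n with hb
    have ha0 : 0 ≤ a := by positivity
    have hab : a ≤ b := by rw [ha, hb]; gcongr; linarith
    have hba : b - a = t / 2 ^ n := by rw [ha, hb]; ring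
    have hd : 0 ≤ lam * (t / 2 ^ n) := by positivity
    have hI := fun x y => psgn_sub_intble hY (measurable_rpt t n) x y
    rw [← intervalIntegral.integral_add_adjacent_intervals (hI 0 a) (hI a b)]
    simp only [eul]
    push_cast
    rw [← ha, ← hb]
    set e := eul (lam * (t / 2 ^ n)) (Y 0) (fun i => W (t * i / 2 ^ n)) i
    have h1 := rsv_psgn hd (Y b)
    calc |rsv (lam * (t / 2 ^ n)) (e + (W b - W a)) - Y b|
        = |rsv (lam * (t / 2 ^ n)) (e + (W b - W a))
            - rsv (lam * (t / 2 ^ n)) (Y b + lam * (t / 2 ^ n) * psgn (Y b))| := by rw [h1]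
      _ ≤ |(e + (W b - W a)) - (Y b + lam * (t / 2 ^ n) * psgn (Y b))| := rsv_lip hd _ _
      _ = |(e - Y a) + lam * ((∫ u in a..b, psgn (Y u)) - (t / 2 ^ n) * psgn (Y b))| := by
          rw [hinc a b ha0 hab]; congr 1; ring_nf
      _ ≤ |e - Y a| + lam * |(∫ u in a..b, psgn (Y u)) - (t / 2 ^ n) * psgn (Y b)| := by
          refine (abs_add_le _ _).trans ?_
          rw [abs_mul, abs_of_nonneg hl]
      _ ≤ |e - Y a| + lam * ∫ u in a..b, |psgn (Y u) - psgn (Y (rpt t n u))| := by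
          gcongr
          have h2 : (t / 2 ^ n) * psgn (Y b) = ∫ u in a..b, psgn (Y b) := by
            rw [intervalIntegral.integral_const, hba, smul_eq_mul]
          rw [h2, ← intervalIntegral.integral_sub (psgn_intble hY a b) intervalIntegrable_const]
          refine (intervalIntegral.abs_integral_le_integral_abs hab).trans (le_of_eq ?_)
          apply intervalIntegral.integral_congr_ae
          rw [uIoc_of_le hab]
          refine Eventually.of_forall fun u hu => ?_
          rw [rpt_cell ht n i hu.1 hu.2]
      _ ≤ _ := by
          rw [mul_add]; gcongr

lemma psgn_continuousAt {y : ℝ} (hy : y ≠ 0) : ContinuousAt psgn y := by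
  rcases lt_or_gt_of_ne hy with h | h
  · have : psgn =ᶠ[nhds y] fun _ => -1 := by
      filter_upwards [Iio_mem_nhds h] with x hx
      have : ¬ 0 < x := not_lt.2 (le_of_lt hx)
      simp [psgn, this]
    exact continuousAt_const.congr this.symm
  · have : psgn =ᶠ[nhds y] fun _ => 1 := by
      filter_upwards [Ioi_mem_nhds h] with x hx
      have : 0 < x := hx
      simp [psgn, this]
    exact continuousAt_const.congr this.symm

lemma eul_tendsto {lam t : ℝ} (hl : 0 ≤ lam) (ht : 0 < t) {Y W : ℝ → ℝ} (hY : Continuous Y)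
    (hinc : ∀ s t : ℝ, 0 ≤ s → s ≤ t → Y t = Y s - lam * (∫ u in s..t, psgn (Y u)) + (W t - W s))
    (hnull : ∀ᵐ u ∂(volume.restrict (Ioi (0:ℝ))), Y u ≠ 0) :
    Tendsto (fun n : ℕ => eul (lam * (t / 2 ^ n)) (Y 0) (fun i => W (t * i / 2 ^ n)) (2 ^ n)) atTop
      (nhds (Y t)) := by
  have h1 : Tendsto (fun n : ℕ => ∫ u in (0:ℝ)..t, |psgn (Y u) - psgn (Y (rpt t n u))|) atTop
      (nhds (∫ u in (0:ℝ)..t, 0)) := by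
    refine intervalIntegral.tendsto_integral_filter_of_dominated_convergence (fun _ => 2) ?_ ?_ ?_ ?_
    · refine Eventually.of_forall fun n => ?_
      have h1 : Measurable fun u => psgn (Y u) := measurable_psgn.comp hY.measurable
      have h2 : Measurable fun u => psgn (Y (rpt t n u)) :=
        measurable_psgn.comp (hY.measurable.comp (measurable_rpt t n))
      exact (h1.sub h2).norm.aestronglyMeasurable
    · refine Eventually.of_forall fun n => Eventually.of_forall fun u _ => ?_
      simpa using abs_psgn_sub_le _ _
    · exact intervalIntegrable_const
    · rw [ae_restrict_iff' measurableSet_Ioi] at hnull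
      filter_upwards [hnull] with u hu hmem
      rw [uIoc_of_le ht.le] at hmem
      have h2 := (psgn_continuousAt (hu hmem.1)).tendsto.comp
        ((hY.tendsto u).comp (tendsto_rpt ht hmem.1))
      have h3 := (tendsto_const_nhds (x := psgn (Y u))).sub h2
      rw [sub_self] at h3
      have h4 := h3.abs
      rwa [abs_zero] at h4
  rw [intervalIntegral.integral_zero] at h1
  have h2 := h1.const_mul lam
  rw [mul_zero] at h2
  rw [tendsto_iff_norm_sub_tendsto_zero]
  refine tendsto_of_tendsto_of_tendsto_of_le_of_le tendsto_const_nhds h2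
    (fun _ => norm_nonneg _) ?_
  intro n
  have h3 := eul_err hl ht hY hinc n (2 ^ n)
  have h4 : t * ((2 ^ n : ℕ) : ℝ) / 2 ^ n = t := by push_cast; field_simp
  rw [h4] at h3
  exact h3

/-- the solution functional -/
def Phi (lam y t : ℝ) (w : ℝ → ℝ) : ℝ :=
  limsup (fun n : ℕ => eul (lam * (t / 2 ^ n)) y (fun i => w (t * i / 2 ^ n)) (2 ^ n)) atTop

lemma measurable_rsv (d : ℝ) : Measurable (rsv d) := by unfold rsv; fun_prop

lemma eul_measurable {α : Type*} {ma : MeasurableSpace α} (d y : ℝ) (w : ℕ → α → ℝ) (k : ℕ)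
    (hw : ∀ i ≤ k, Measurable (w i)) : Measurable (fun a => eul d y (fun i => w i a) k) := by
  induction k with
  | zero => exact measurable_const
  | succ k ih =>
    simp only [eul]
    exact (measurable_rsv d).comp ((ih fun i hi => hw i (by omega)).add
      ((hw _ le_rfl).sub (hw k (by omega))))

lemma Phi_measurable {α : Type*} {ma : MeasurableSpace α} (lam y : ℝ) {t : ℝ} (ht : 0 ≤ t)
    (w : ℝ → α → ℝ) (hw : ∀ s ∈ Icc 0 t, Measurable (w s)) :
    Measurable (fun a => Phi lam y t (fun s => w s a)) := by
  unfold Phi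
  apply Measurable.limsup
  intro n
  apply eul_measurable (w := fun i a => w (t * i / 2 ^ n) a)
  intro i hi
  exact hw _ ⟨by positivity, grid_le ht hi⟩

lemma BB.strong {μ : Measure Ω} [IsProbabilityMeasure μ] {F : ℝ → MeasurableSpace Ω}
    {lam y : ℝ} {W Y : ℝ → Ω → ℝ} (S : BB μ F lam y W Y) {t : ℝ} (ht : 0 ≤ t) :
    ∀ᵐ ω ∂μ, Phi lam y t (fun s => W s ω) = Y t ω := by
  filter_upwards [S.cY, S.inc, S.eq, S.hW.init, S.ae_null] with ω hc hinc heq h0 hnull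
  have hY0 : Y 0 ω = y := by
    have := heq 0 le_rfl
    rw [this, h0]; simp
  unfold Phi
  apply Tendsto.limsup_eq
  rcases ht.eq_or_lt with rfl | ht
  · have : ∀ d, ∀ k : ℕ, d = 0 → eul d y (fun i => W (0 * (i:ℝ) / 2 ^ 0) ω) k = y := by
      intro d k hd
      subst hd
      induction k with
      | zero => rfl
      | succ k ih =>
        simp only [eul]
        rw [ih]
        unfold rsv
        simp
    have h2 : ∀ n : ℕ, eul (lam * (0 / 2 ^ n)) y (fun i => W (0 * (i:ℝ) / 2 ^ n) ω) (2 ^ n) = y := by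
      intro n
      have := this (lam * (0 / 2 ^ n)) (2 ^ n) (by simp)
      simpa using this
    simp only [h2]
    rw [hY0]; exact tendsto_const_nhds
  · have := eul_tendsto S.hl ht hc hinc hnull
    rwa [hY0] at this

lemma natSA_mono {W : ℝ → Ω → ℝ} {s t : ℝ} (hst : s ≤ t) : natSA W s ≤ natSA W t := by
  unfold natSA
  exact iSup₂_le fun u hu => le_iSup₂_of_le u ⟨hu.1, hu.2.trans hst⟩ le_rfl

lemma aug_of_ae {Ω : Type*} (m' : MeasurableSpace Ω) [m : MeasurableSpace Ω] {μ : Measure Ω} {f g : Ω → ℝ} (hf : Measurable[m'] f)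
    (h : ∀ᵐ ω ∂μ, f ω = g ω) : MeasurableSpace.comap g inferInstance ≤ augSA μ m' := by
  rintro _ ⟨A, hA, rfl⟩
  have h1 : MeasurableSet[augSA μ m'] (f ⁻¹' A) := by
    have : m' ≤ augSA μ m' := le_sup_left
    exact this _ (hf hA)
  have hn : ∀ N : Set Ω, μ N = 0 → MeasurableSet[augSA μ m'] N := by
    intro N hN
    have : MeasurableSpace.generateFrom {A : Set Ω | μ A = 0} ≤ augSA μ m' := le_sup_right
    exact this _ (MeasurableSpace.measurableSet_generateFrom hN)
  have hz : μ {ω | ¬ f ω = g ω} = 0 := h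
  have e : g ⁻¹' A = (f ⁻¹' A \ {ω | ¬ f ω = g ω}) ∪ (g ⁻¹' A ∩ {ω | ¬ f ω = g ω}) := by
    ext ω
    by_cases hω : f ω = g ω
    · simp [hω]
    · simp [hω]
  rw [e]
  exact MeasurableSet.union (MeasurableSet.diff h1 (hn _ hz))
    (hn _ (measure_mono_null inter_subset_right hz))

lemma BB.natFilt_le {μ : Measure Ω} [IsProbabilityMeasure μ] {F : ℝ → MeasurableSpace Ω}
    {lam y : ℝ} {W Y : ℝ → Ω → ℝ} (S : BB μ F lam y W Y) (t : ℝ) :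
    natFilt μ Y t ≤ natFilt μ W t := by
  unfold natFilt
  refine sup_le ?_ le_sup_right
  refine iSup₂_le fun s hs => ?_
  refine aug_of_ae _ (f := fun ω => Phi lam y s (fun r => W r ω)) ?_ (S.strong hs.1)
  apply Phi_measurable lam y hs.1 W
  intro r hr
  refine measurable_iff_comap_le.2 ?_
  unfold natSA
  exact le_iSup₂_of_le (f := fun (u : ℝ) (_ : u ∈ Icc (0:ℝ) t) =>
    MeasurableSpace.comap (W u) inferInstance) r ⟨hr.1, hr.2.trans hs.2⟩ le_rfl

lemma BB.indep {μ : Measure Ω} [IsProbabilityMeasure μ] {F : ℝ → MeasurableSpace Ω}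
    {lam y : ℝ} {W Y Q : ℝ → Ω → ℝ} (S : BB μ F lam y W Y) (hclip : ∀ t, Y t = Y (max t 0))
    (h : IndepFun (fun ω => (fun t => Q t ω)) (fun ω => (fun t => W t ω)) μ) :
    IndepFun (fun ω => (fun t => Q t ω)) (fun ω => (fun t => Y t ω)) μ := by
  have hψ : Measurable (fun (w : ℝ → ℝ) (t : ℝ) => Phi lam y (max t 0) w) := by
    refine measurable_pi_lambda _ fun t => ?_
    exact Phi_measurable lam y (le_max_right t 0) (fun s (w : ℝ → ℝ) => w s)
      (fun s _ => measurable_pi_apply s)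
  have h1 := h.comp (measurable_id (α := ℝ → ℝ)) hψ
  · refine IndepFun.process_congr_right (X := fun t ω => Phi lam y (max t 0) (fun s => W s ω)) h1 ?_
    intro t
    filter_upwards [S.strong (le_max_right t 0)] with ω hω
    rw [hω, hclip t]

-- Moments of elementary martingale sums

lemma memLp_bdd_mul {μ : Measure Ω} {ξ f : Ω → ℝ} {C : ℝ} {p : ENNReal} (hξ : Measurable ξ)
    (hC : ∀ ω, |ξ ω| ≤ C) (hf : MemLp f p μ) : MemLp (fun ω => ξ ω * f ω) p μ :=
  MemLp.mul (p := ⊤) (q := p) (r := p) hf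
    (memLp_top_of_bound hξ.aestronglyMeasurable C (Eventually.of_forall hC))

/-- martingale increment built from a function of a Brownian increment -/
def mart (B : ℝ → Ω → ℝ) (g : ℕ → ℝ → ℝ) (c : ℕ → ℝ) (ξ : ℕ → Ω → ℝ) (k : ℕ) (ω : Ω) : ℝ :=
  ∑ i ∈ Finset.range k, ξ i ω * g i (B (c (i + 1)) ω - B (c i) ω)

lemma mart_meas {μ : Measure Ω} {F : ℝ → MeasurableSpace Ω}
    {B : ℝ → Ω → ℝ} (h : IsBM μ F B) {g : ℕ → ℝ → ℝ} (hg : ∀ i, Measurable (g i)) {c : ℕ → ℝ}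
    (hc : Monotone c) (hc0 : 0 ≤ c 0) {ξ : ℕ → Ω → ℝ} (hξ : ∀ i, Measurable[F (c i)] (ξ i)) (k : ℕ) :
    Measurable[F (c k)] (mart B g c ξ k) := by
  have c0 : ∀ j, 0 ≤ c j := fun j => hc0.trans (hc (Nat.zero_le j))
  refine @Finset.measurable_fun_sum _ _ _ _ _ _ (F (c k)) _ _ fun j hj => ?_
  have hj' := Finset.mem_range.1 hj
  exact ((hξ j).mono (h.mono (hc hj'.le)) le_rfl).mul
    ((hg j).comp (h.inc_meas (c0 _) (c0 _) (hc hj'.le) (hc hj')))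

lemma mart_memLp {μ : Measure Ω} {F : ℝ → MeasurableSpace Ω}
    {B : ℝ → Ω → ℝ} (h : IsBM μ F B) {g : ℕ → ℝ → ℝ} {c : ℕ → ℝ} {p : ENNReal}
    (hgp : ∀ i, MemLp (fun ω => g i (B (c (i + 1)) ω - B (c i) ω)) p μ)
    {ξ : ℕ → Ω → ℝ} (hξ : ∀ i, Measurable[F (c i)] (ξ i)) {C : ℝ} (hC : ∀ i ω, |ξ i ω| ≤ C) (k : ℕ) :
    MemLp (mart B g c ξ k) p μ := by
  have : MemLp (fun ω => ∑ i ∈ Finset.range k, ξ i ω * g i (B (c (i + 1)) ω - B (c i) ω)) p μ := by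
    apply memLp_finsetSum
    intro i _
    exact memLp_bdd_mul ((hξ i).mono (h.le _) le_rfl) (hC i) (hgp i)
  exact this

lemma mart_sq {μ : Measure Ω} [IsProbabilityMeasure μ] {F : ℝ → MeasurableSpace Ω}
    {B : ℝ → Ω → ℝ} (h : IsBM μ F B) {g : ℕ → ℝ → ℝ} (hg : ∀ i, Measurable (g i)) {c : ℕ → ℝ}
    (hc : Monotone c) (hc0 : 0 ≤ c 0)
    (hgp : ∀ i, MemLp (fun ω => g i (B (c (i + 1)) ω - B (c i) ω)) 2 μ)
    (hg0 : ∀ i, ∫ ω, g i (B (c (i + 1)) ω - B (c i) ω) ∂μ = 0)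
    {ξ : ℕ → Ω → ℝ} (hξ : ∀ i, Measurable[F (c i)] (ξ i)) {C : ℝ} (hC : ∀ i ω, |ξ i ω| ≤ C) (k : ℕ) :
    ∫ ω, (mart B g c ξ k ω) ^ 2 ∂μ
      ≤ C ^ 2 * ∑ i ∈ Finset.range k, ∫ ω, (g i (B (c (i + 1)) ω - B (c i) ω)) ^ 2 ∂μ := by
  have c0 : ∀ j, 0 ≤ c j := fun j => hc0.trans (hc (Nat.zero_le j))
  induction k with
  | zero => simp [mart]
  | succ k ih =>
    rw [Finset.sum_range_succ, mul_add]
    have hM := mart_memLp h hgp hξ hC k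
    have hMm := mart_meas h hg hc hc0 hξ k
    set M := mart B g c ξ k with hMd
    set D : Ω → ℝ := fun ω => g k (B (c (k + 1)) ω - B (c k) ω) with hD
    have hstep : ∀ ω, (mart B g c ξ (k + 1) ω) ^ 2
        = M ω ^ 2 + 2 * ((M ω * ξ k ω) * D ω) + ξ k ω ^ 2 * D ω ^ 2 := by
      intro ω
      have : mart B g c ξ (k + 1) ω = M ω + ξ k ω * D ω := by
        rw [hMd, hD]; unfold mart; rw [Finset.sum_range_succ]
      rw [this]; ring
    simp_rw [hstep]
    have hξm : Measurable (ξ k) := (hξ k).mono (h.le _) le_rfl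
    have i1 : Integrable (fun ω => M ω ^ 2) μ := hM.integrable_sq
    have i2 : Integrable (fun ω => 2 * ((M ω * ξ k ω) * D ω)) μ := by
      refine Integrable.const_mul ?_ 2
      have h1 := MemLp.integrable_mul (p := 2) (q := 2) hM (memLp_bdd_mul hξm (hC k) (hgp k))
      refine h1.congr (Eventually.of_forall fun ω => ?_)
      simp only [Pi.mul_apply, hD]; ring
    have i3 : Integrable (fun ω => ξ k ω ^ 2 * D ω ^ 2) μ := by
      have h1 := (memLp_bdd_mul hξm (hC k) (hgp k)).integrable_sq
      refine h1.congr (Eventually.of_forall fun ω => ?_)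
      simp only [hD]; ring
    rw [integral_add (by exact i1.add i2) i3, integral_add i1 i2, integral_const_mul]
    have e2 : ∫ ω, (M ω * ξ k ω) * D ω ∂μ = 0 := by
      have := h.integral_mul (c0 k) (hc (Nat.le_succ k)) (ξ := fun ω => M ω * ξ k ω)
        (hMm.mul (hξ k)) (hg k)
      rw [this, hg0 k, mul_zero]
    rw [e2, mul_zero, add_zero]
    refine add_le_add ih ?_
    rw [← integral_const_mul]
    refine integral_mono i3 ((hgp k).integrable_sq.const_mul _) fun ω => ?_
    have := sq_le_sq' (abs_le.1 (hC k ω)).1 (abs_le.1 (hC k ω)).2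
    exact mul_le_mul_of_nonneg_right this (sq_nonneg _)

lemma four_ineq (M x d : ℝ) (h : x ^ 2 ≤ d ^ 2) :
    (M + x) ^ 4 ≤ M ^ 4 + 4 * (M ^ 3 * x) + 8 * (M ^ 2 * d ^ 2) + 3 * d ^ 4 := by
  have h1 : (M + x) ^ 4 ≤ M ^ 4 + 4 * (M ^ 3 * x) + 8 * (M ^ 2 * x ^ 2) + 3 * x ^ 4 := by
    nlinarith [sq_nonneg (M * x - x ^ 2)]
  have h2 : M ^ 2 * x ^ 2 ≤ M ^ 2 * d ^ 2 := by gcongr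
  have h3 : x ^ 4 ≤ d ^ 4 := by
    have : (x ^ 2) ^ 2 ≤ (d ^ 2) ^ 2 := by gcongr
    nlinarith
  linarith

lemma memLp_four_int {μ : Measure Ω} {f : Ω → ℝ} (hf : MemLp f 4 μ) :
    Integrable (fun ω => f ω ^ 4) μ := by
  have := hf.integrable_norm_pow (p := 4) (by norm_num)
  refine this.congr (Eventually.of_forall fun ω => ?_)
  simp only [Real.norm_eq_abs]
  exact Even.pow_abs (by decide) _

lemma mart_four {μ : Measure Ω} [IsProbabilityMeasure μ] {F : ℝ → MeasurableSpace Ω}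
    {B : ℝ → Ω → ℝ} (h : IsBM μ F B) {c : ℕ → ℝ}
    (hc : Monotone c) (hc0 : 0 ≤ c 0)
    {ξ : ℕ → Ω → ℝ} (hξ : ∀ i, Measurable[F (c i)] (ξ i)) (hC : ∀ i ω, |ξ i ω| ≤ 1) (k : ℕ) :
    ∫ ω, (mart B (fun _ x => x) c ξ k ω) ^ 4 ∂μ ≤ (4 + 3 * m4) * (c k - c 0) ^ 2 := by
  have c0 : ∀ j, 0 ≤ c j := fun j => hc0.trans (hc (Nat.zero_le j))
  have hinc : ∀ i, c i ≤ c (i + 1) := fun i => hc (Nat.le_succ i)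
  have hgm : ∀ i : ℕ, Measurable ((fun (_ : ℕ) (x : ℝ) => x) i) := fun i => measurable_id
  have hgp : ∀ i, MemLp (fun ω => (fun (_ : ℕ) (x : ℝ) => x) i (B (c (i + 1)) ω - B (c i) ω)) 4 μ :=
    fun i => h.memLp_inc (c0 i) (hinc i) (by norm_num)
  have hgp2 : ∀ i, MemLp (fun ω => (fun (_ : ℕ) (x : ℝ) => x) i (B (c (i + 1)) ω - B (c i) ω)) 2 μ :=
    fun i => h.memLp_inc (c0 i) (hinc i) (by norm_num)
  have hM2 : ∀ k, ∫ ω, (mart B (fun _ x => x) c ξ k ω) ^ 2 ∂μ ≤ c k - c 0 := by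
    intro k
    refine (mart_sq h hgm hc hc0 hgp2 (fun i => h.integral_inc_one (c0 i) (hinc i)) hξ hC k).trans ?_
    simp only [h.integral_inc_sq (c0 _) (hinc _)]
    rw [Finset.sum_range_sub c]; simp
  induction k with
  | zero => simp [mart]
  | succ k ih =>
    have hM := mart_memLp h (g := fun _ x => x) hgp hξ hC k
    have hM' := mart_memLp h (g := fun _ x => x) hgp hξ hC (k + 1)
    have hMm := mart_meas h hgm hc hc0 hξ k
    have h2k := hM2 k
    set M := mart B (fun _ x => x) c ξ k with hMd
    set D : Ω → ℝ := fun ω => B (c (k + 1)) ω - B (c k) ω with hD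
    have hDp : MemLp D 4 μ := hgp k
    have hξm : Measurable (ξ k) := (hξ k).mono (h.le _) le_rfl
    have hMm' : Measurable M := hMm.mono (h.le _) le_rfl
    have hDm : Measurable D := h.inc_meas' (c0 _) (c0 _)
    have hstep : ∀ ω, (mart B (fun _ x => x) c ξ (k + 1) ω) ^ 4
        ≤ M ω ^ 4 + 4 * ((M ω ^ 3 * ξ k ω) * D ω) + 8 * (M ω ^ 2 * D ω ^ 2) + 3 * D ω ^ 4 := by
      intro ω
      have e : mart B (fun _ x => x) c ξ (k + 1) ω = M ω + ξ k ω * D ω := by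
        rw [hMd, hD]; unfold mart; rw [Finset.sum_range_succ]
      rw [e, mul_assoc (M ω ^ 3)]
      apply four_ineq
      rw [mul_pow]
      have : ξ k ω ^ 2 ≤ 1 := by
        have := sq_le_sq' (abs_le.1 (hC k ω)).1 (abs_le.1 (hC k ω)).2
        simpa using this
      nlinarith [sq_nonneg (D ω)]
    have i1 : Integrable (fun ω => M ω ^ 4) μ := memLp_four_int hM
    have i4 : Integrable (fun ω => D ω ^ 4) μ := memLp_four_int hDp
    have i3 : Integrable (fun ω => M ω ^ 2 * D ω ^ 2) μ := by
      refine (i1.add i4).mono' (by fun_prop) (Eventually.of_forall fun ω => ?_)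
      rw [Real.norm_eq_abs, abs_of_nonneg (by positivity)]
      simp only [Pi.add_apply]
      nlinarith [sq_nonneg (M ω ^ 2 - D ω ^ 2), sq_nonneg (M ω ^ 2 + D ω ^ 2)]
    have i2 : Integrable (fun ω => (M ω ^ 3 * ξ k ω) * D ω) μ := by
      refine (i1.add i3).mono' (by fun_prop) (Eventually.of_forall fun ω => ?_)
      rw [Real.norm_eq_abs, abs_mul, abs_mul]
      simp only [Pi.add_apply]
      have h1 := hC k ω
      have h3 : |M ω ^ 3| * |ξ k ω| * |D ω| ≤ |M ω ^ 3| * 1 * |D ω| := by gcongr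
      refine h3.trans ?_
      rw [mul_one, ← abs_mul]
      refine abs_le.2 ⟨?_, ?_⟩
      · nlinarith [sq_nonneg (M ω ^ 2 + M ω * D ω), sq_nonneg (M ω ^ 2), sq_nonneg (M ω * D ω)]
      · nlinarith [sq_nonneg (M ω ^ 2 - M ω * D ω), sq_nonneg (M ω ^ 2), sq_nonneg (M ω * D ω)]
    have hI := integral_mono (memLp_four_int hM')
      (((i1.add (i2.const_mul 4)).add (i3.const_mul 8)).add (i4.const_mul 3)) hstep
    refine hI.trans ?_
    simp only [Pi.add_apply]
    rw [integral_add (by exact (i1.add (i2.const_mul 4)).add (i3.const_mul 8)) (i4.const_mul 3),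
      integral_add (by exact i1.add (i2.const_mul 4)) (i3.const_mul 8),
      integral_add i1 (i2.const_mul 4), integral_const_mul, integral_const_mul, integral_const_mul]
    have e2 : ∫ ω, (M ω ^ 3 * ξ k ω) * D ω ∂μ = 0 := by
      have := h.integral_mul (c0 k) (hinc k) (ξ := fun ω => M ω ^ 3 * ξ k ω)
        ((hMm.pow_const 3).mul (hξ k)) (g := fun x => x) measurable_id
      rw [this, h.integral_inc_one (c0 k) (hinc k), mul_zero]
    have e3 : ∫ ω, M ω ^ 2 * D ω ^ 2 ∂μ = (∫ ω, M ω ^ 2 ∂μ) * (c (k + 1) - c k) := by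
      have := h.integral_mul (c0 k) (hinc k) (ξ := fun ω => M ω ^ 2)
        (hMm.pow_const 2) (g := fun x => x ^ 2) (by fun_prop)
      rw [this, h.integral_inc_sq (c0 k) (hinc k)]
    have e4 : ∫ ω, D ω ^ 4 ∂μ = m4 * (c (k + 1) - c k) ^ 2 := h.integral_inc_four (c0 k) (hinc k)
    rw [e2, e3, e4]
    have hd : 0 ≤ c (k + 1) - c k := sub_nonneg.2 (hinc k)
    have hT : 0 ≤ c k - c 0 := sub_nonneg.2 (hc (Nat.zero_le k))
    have hm := m4_nonneg
    have := mul_le_mul_of_nonneg_right h2k hd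
    have e : c (k + 1) - c 0 = (c k - c 0) + (c (k + 1) - c k) := by ring
    rw [e]
    nlinarith [mul_nonneg hm (mul_nonneg hT hd)]

/-- squared increments -/
lemma mart_qv {μ : Measure Ω} [IsProbabilityMeasure μ] {F : ℝ → MeasurableSpace Ω}
    {B : ℝ → Ω → ℝ} (h : IsBM μ F B) {c : ℕ → ℝ} {δ : ℝ} (hδ : 0 ≤ δ)
    (hcδ : ∀ i, c (i + 1) - c i = δ) (hc0 : 0 ≤ c 0)
    {ξ : ℕ → Ω → ℝ} (hξ : ∀ i, Measurable[F (c i)] (ξ i)) {C : ℝ} (hC : ∀ i ω, |ξ i ω| ≤ C) (k : ℕ) :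
    MemLp (mart B (fun _ x => x ^ 2 - δ) c ξ k) 2 μ ∧
    ∫ ω, (mart B (fun _ x => x ^ 2 - δ) c ξ k ω) ^ 2 ∂μ ≤ C ^ 2 * (k * ((m4 + 1) * δ ^ 2)) := by
  have hinc : ∀ i, c i ≤ c (i + 1) := fun i => by linarith [hcδ i]
  have hc : Monotone c := monotone_nat_of_le_succ hinc
  have c0 : ∀ j, 0 ≤ c j := fun j => hc0.trans (hc (Nat.zero_le j))
  have hgm : ∀ i : ℕ, Measurable ((fun (_ : ℕ) (x : ℝ) => x ^ 2 - δ) i) := fun i => by fun_prop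
  have i4 : ∀ i, Integrable (fun ω => (B (c (i + 1)) ω - B (c i) ω) ^ 4) μ := fun i =>
    memLp_four_int (h.memLp_inc (c0 i) (hinc i) (by norm_num))
  have i2 : ∀ i, Integrable (fun ω => (B (c (i + 1)) ω - B (c i) ω) ^ 2) μ := fun i =>
    (h.memLp_inc (c0 i) (hinc i) (p := 2) (by norm_num)).integrable_sq
  have hgp : ∀ i, MemLp (fun ω => (fun (_ : ℕ) (x : ℝ) => x ^ 2 - δ) i (B (c (i + 1)) ω - B (c i) ω)) 2 μ := by
    intro i
    have h1 : MemLp (fun ω => (B (c (i + 1)) ω - B (c i) ω) ^ 2) 2 μ := by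
      have hm := h.inc_meas' (c0 i) (c0 (i + 1))
      rw [memLp_two_iff_integrable_sq (hm.pow_const 2).aestronglyMeasurable]
      refine (i4 i).congr (Eventually.of_forall fun ω => ?_)
      ring
    exact h1.sub (memLp_const δ)
  refine ⟨mart_memLp h hgp hξ hC k, ?_⟩
  have hg0 : ∀ i, ∫ ω, (fun (_ : ℕ) (x : ℝ) => x ^ 2 - δ) i (B (c (i + 1)) ω - B (c i) ω) ∂μ = 0 := by
    intro i
    change ∫ ω, ((B (c (i + 1)) ω - B (c i) ω) ^ 2 - δ) ∂μ = 0
    rw [integral_sub (i2 i) (integrable_const δ), h.integral_inc_sq (c0 i) (hinc i), hcδ]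
    simp
  refine (mart_sq h hgm hc hc0 hgp hg0 hξ hC k).trans ?_
  refine mul_le_mul_of_nonneg_left ?_ (sq_nonneg C)
  have hb : ∀ i ∈ Finset.range k, ∫ ω, ((fun (_ : ℕ) (x : ℝ) => x ^ 2 - δ) i
      (B (c (i + 1)) ω - B (c i) ω)) ^ 2 ∂μ ≤ (m4 + 1) * δ ^ 2 := by
    intro i _
    have h1 : ∫ ω, ((B (c (i + 1)) ω - B (c i) ω) ^ 2 - δ) ^ 2 ∂μ
        ≤ ∫ ω, ((B (c (i + 1)) ω - B (c i) ω) ^ 4 + δ ^ 2) ∂μ := by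
      refine integral_mono ((hgp i).integrable_sq) ((i4 i).add (integrable_const _)) fun ω => ?_
      beta_reduce
      nlinarith [mul_nonneg hδ (sq_nonneg (B (c (i + 1)) ω - B (c i) ω))]
    refine h1.trans (le_of_eq ?_)
    rw [integral_add (i4 i) (integrable_const _), h.integral_inc_four (c0 i) (hinc i), hcδ]
    simp; ring
  refine (Finset.sum_le_sum hb).trans (le_of_eq ?_)
  rw [Finset.sum_const, Finset.card_range, nsmul_eq_mul]

-- An Itô formula along dyadic partitions

lemma TIM.of_abs_le {μ : Measure Ω} [IsFiniteMeasure μ] {ι : Type*} {l : Filter ι} {f g : ι → Ω → ℝ}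
    (hg : ∀ i, Integrable (g i) μ) (h : ∀ i, ∀ᵐ ω ∂μ, |f i ω| ≤ g i ω)
    (hC : Tendsto (fun i => ∫ ω, g i ω ∂μ) l (nhds 0)) :
    TendstoInMeasure μ f l (fun _ => 0) := by
  rw [tendstoInMeasure_iff_measureReal_norm]
  intro ε hε
  have h1 := hC.const_mul ε⁻¹
  rw [mul_zero] at h1
  refine tendsto_of_tendsto_of_tendsto_of_le_of_le tendsto_const_nhds h1
    (fun _ => measureReal_nonneg) ?_
  intro i
  have h2 := mul_meas_ge_le_integral_of_nonneg (μ := μ) (f := g i)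
    (by filter_upwards [h i] with ω hω using (abs_nonneg _).trans hω) (hg i) ε
  have h3 : μ.real {ω | ε ≤ ‖f i ω - 0‖} ≤ μ.real {ω | ε ≤ g i ω} := by
    unfold Measure.real
    apply ENNReal.toReal_mono (measure_ne_top _ _)
    apply measure_mono_ae
    filter_upwards [h i] with ω hω h4
    change ε ≤ ‖f i ω - 0‖ at h4
    rw [sub_zero, Real.norm_eq_abs] at h4
    exact h4.trans hω
  refine h3.trans ?_
  change _ ≤ ε⁻¹ * ∫ ω, g i ω ∂μ
  rw [← div_eq_inv_mul, le_div_iff₀ hε]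
  linarith

lemma taylor2 {f f1 f2 : ℝ → ℝ} (hf : ∀ x, HasDerivAt f (f1 x) x) (hf1 : ∀ x, HasDerivAt f1 (f2 x) x)
    {K : ℝ} (hK : ∀ x y, |f2 x - f2 y| ≤ K * |x - y|) (x y : ℝ) :
    |f y - f x - f1 x * (y - x) - f2 x * (y - x) ^ 2 / 2| ≤ K * |y - x| ^ 3 := by
  have hK0 : 0 ≤ K := by
    have := (abs_nonneg _).trans (hK 1 0)
    simpa using this
  have hseg : ∀ z ∈ uIcc x y, |z - x| ≤ |y - x| := fun z hz => abs_sub_left_of_mem_uIcc hz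
  have h1 : ∀ z ∈ uIcc x y, |f1 z - f1 x - f2 x * (z - x)| ≤ K * |y - x| * |y - x| := by
    intro z hz
    have hd : ∀ w ∈ uIcc x y, HasDerivWithinAt (fun w => f1 w - f2 x * w) (f2 w - f2 x * 1) (uIcc x y) w :=
      fun w _ => ((hf1 w).sub ((hasDerivAt_id w).const_mul _)).hasDerivWithinAt
    have := (convex_uIcc x y).norm_image_sub_le_of_norm_hasDerivWithin_le (C := K * |y - x|) hd
      (fun w hw => by
        rw [mul_one, Real.norm_eq_abs]
        refine (hK w x).trans ?_
        have := hseg w hw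
        gcongr) left_mem_uIcc hz
    rw [Real.norm_eq_abs, Real.norm_eq_abs] at this
    have e : f1 z - f1 x - f2 x * (z - x) = f1 z - f2 x * z - (f1 x - f2 x * x) := by ring
    rw [e]
    refine this.trans ?_
    have := hseg z hz
    gcongr
  have hd : ∀ w ∈ uIcc x y, HasDerivWithinAt (fun w => f w - f1 x * w - f2 x / 2 * (w - x) ^ 2)
      (f1 w - f1 x * 1 - f2 x / 2 * (2 * (w - x) ^ 1 * 1)) (uIcc x y) w := by
    intro w _
    exact (((hf w).sub ((hasDerivAt_id w).const_mul _)).sub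
      ((((hasDerivAt_id w).sub_const x).pow 2).const_mul _)).hasDerivWithinAt
  have := (convex_uIcc x y).norm_image_sub_le_of_norm_hasDerivWithin_le (C := K * |y - x| * |y - x|) hd
    (fun w hw => by
      rw [Real.norm_eq_abs]
      refine le_trans (le_of_eq ?_) (h1 w hw)
      congr 1; ring) left_mem_uIcc right_mem_uIcc
  rw [Real.norm_eq_abs, Real.norm_eq_abs] at this
  have e : f y - f x - f1 x * (y - x) - f2 x * (y - x) ^ 2 / 2
      = f y - f1 x * y - f2 x / 2 * (y - x) ^ 2 - (f x - f1 x * x - f2 x / 2 * (x - x) ^ 2) := by ring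
  rw [e]
  refine this.trans (le_of_eq ?_)
  ring

lemma lpt_cell {t : ℝ} (ht : 0 < t) (n i : ℕ) {u : ℝ} (h1 : t * i / 2 ^ n < u)
    (h2 : u ≤ t * (i + 1) / 2 ^ n) : lpt t n u = t * i / 2 ^ n := by
  unfold lpt
  have : ⌈2 ^ n * u / t⌉₊ = i + 1 := by
    rw [Nat.ceil_eq_iff (by omega)]
    rw [div_lt_iff₀ (by positivity)] at h1
    rw [le_div_iff₀ (by positivity)] at h2
    constructor
    · rw [lt_div_iff₀ ht, Nat.add_sub_cancel]; linarith
    · rw [div_le_iff₀ ht]; push_cast; linarith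
  rw [this, Nat.add_sub_cancel]

lemma riem {t : ℝ} (ht : 0 < t) {v ψ : ℝ → ℝ} (hv : Continuous v) {C : ℝ} (hC : ∀ u, |v u| ≤ C)
    (hψ : Measurable ψ) (hψ1 : ∀ u, |ψ u| ≤ 1) :
    Tendsto (fun n : ℕ => ∑ i ∈ Finset.range (2 ^ n), v (t * i / 2 ^ n) *
        ∫ u in (t * i / 2 ^ n)..(t * (i + 1) / 2 ^ n), ψ u) atTop
      (nhds (∫ u in (0:ℝ)..t, v u * ψ u)) := by
  have hm : ∀ n, Measurable (fun u => v (lpt t n u) * ψ u) := fun n =>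
    (hv.measurable.comp (measurable_lpt t n)).mul hψ
  have hb : ∀ n u, ‖v (lpt t n u) * ψ u‖ ≤ C := by
    intro n u
    rw [norm_mul, Real.norm_eq_abs, Real.norm_eq_abs]
    calc |v (lpt t n u)| * |ψ u| ≤ C * 1 :=
          mul_le_mul (hC _) (hψ1 u) (abs_nonneg _) ((abs_nonneg _).trans (hC 0))
      _ = C := mul_one C
  have hintb : ∀ n a b, IntervalIntegrable (fun u => v (lpt t n u) * ψ u) volume a b := by
    intro n a b
    refine IntervalIntegrable.mono_fun (f := fun _ : ℝ => C) intervalIntegrable_const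
      (hm n).aestronglyMeasurable (Eventually.of_forall fun u => ?_)
    exact (hb n u).trans (le_abs_self C)
  have e : ∀ n : ℕ, ∑ i ∈ Finset.range (2 ^ n), v (t * i / 2 ^ n) *
        (∫ u in (t * i / 2 ^ n)..(t * (i + 1) / 2 ^ n), ψ u) = ∫ u in (0:ℝ)..t, v (lpt t n u) * ψ u := by
    intro n
    have h1 := intervalIntegral.sum_integral_adjacent_intervals (f := fun u => v (lpt t n u) * ψ u)
      (μ := volume) (a := fun i : ℕ => t * i / 2 ^ n) (n := 2 ^ n) (fun k _ => hintb n _ _)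
    have h2 : t * ((2 ^ n : ℕ) : ℝ) / 2 ^ n = t := by push_cast; field_simp
    simp only [Nat.cast_zero, mul_zero, zero_div] at h1
    rw [h2] at h1
    rw [← h1]
    refine Finset.sum_congr rfl fun i _ => ?_
    rw [← intervalIntegral.integral_const_mul]
    push_cast
    apply intervalIntegral.integral_congr_ae
    rw [uIoc_of_le (by gcongr; linarith)]
    refine Eventually.of_forall fun u hu => ?_
    rw [lpt_cell ht n i hu.1 hu.2]
  simp_rw [e]
  refine intervalIntegral.tendsto_integral_filter_of_dominated_convergence (fun _ => C) ?_ ?_ ?_ ?_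
  · exact Eventually.of_forall fun n => (hm n).aestronglyMeasurable
  · exact Eventually.of_forall fun n => Eventually.of_forall fun u _ => hb n u
  · exact intervalIntegrable_const
  · refine Eventually.of_forall fun u hu => ?_
    rw [uIoc_of_le ht.le] at hu
    exact ((hv.tendsto u).comp (tendsto_lpt ht hu.1 hu.2)).mul tendsto_const_nhds

lemma cube_bd {e x D lam : ℝ} (he : 0 < e) (hl : 0 ≤ lam) (hD : |D| ≤ lam * e ^ 2) :
    |x + D| ^ 3 ≤ 2 * (e * x ^ 2 + x ^ 4 / e) + 4 * lam ^ 3 * e ^ 6 := by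
  have h1 : |x + D| ≤ |x| + lam * e ^ 2 := (abs_add_le x D).trans (by linarith)
  set a := |x| with ha
  have ha0 : 0 ≤ a := abs_nonneg x
  set b := lam * e ^ 2 with hb
  have hb0 : 0 ≤ b := by positivity
  have h2 : |x + D| ^ 3 ≤ (a + b) ^ 3 := by gcongr
  have h3 : (a + b) ^ 3 ≤ 4 * (a ^ 3 + b ^ 3) := by
    nlinarith [mul_nonneg (add_nonneg ha0 hb0) (sq_nonneg (a - b))]
  have h4 : a ^ 3 * 2 ≤ e * x ^ 2 + x ^ 4 / e := by
    have hx2 : x ^ 2 = a ^ 2 := (sq_abs x).symm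
    have hx4 : x ^ 4 = a ^ 4 := by rw [show x ^ 4 = (x ^ 2) ^ 2 by ring, hx2]; ring
    rw [hx2, hx4]
    have : e * a ^ 2 + a ^ 4 / e - a ^ 3 * 2 = a ^ 2 * (e - a) ^ 2 / e := by field_simp; ring
    have h5 : 0 ≤ a ^ 2 * (e - a) ^ 2 / e := by positivity
    linarith
  have h6 : b ^ 3 = lam ^ 3 * e ^ 6 := by rw [hb]; ring
  linarith

lemma sq_bd {e x D lam : ℝ} (he : 0 < e) (hl : 0 ≤ lam) (hD : |D| ≤ lam * e ^ 2) :
    |(x + D) ^ 2 - x ^ 2| ≤ lam * (lam * e ^ 4 + e ^ 3 + e * x ^ 2) := by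
  have h0 : (x + D) ^ 2 - x ^ 2 = D * (D + 2 * x) := by ring
  rw [h0, abs_mul]
  have h1 : |D + 2 * x| ≤ lam * e ^ 2 + 2 * |x| := by
    refine (abs_add_le _ _).trans ?_
    rw [abs_mul, abs_two]; linarith
  have h2 : |D| * |D + 2 * x| ≤ (lam * e ^ 2) * (lam * e ^ 2 + 2 * |x|) := by gcongr
  refine h2.trans ?_
  have h3 : 2 * |x| * e ≤ e ^ 2 + x ^ 2 := by nlinarith [sq_nonneg (e - |x|), sq_abs x]
  have h4 : lam * e * (2 * |x| * e) ≤ lam * e * (e ^ 2 + x ^ 2) := by gcongr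
  nlinarith

lemma BB.ito {μ : Measure Ω} [IsProbabilityMeasure μ] {F : ℝ → MeasurableSpace Ω}
    {lam y : ℝ} {W Y : ℝ → Ω → ℝ} (S : BB μ F lam y W Y) {f f1 f2 : ℝ → ℝ}
    (hf : ∀ x, HasDerivAt f (f1 x) x) (hf1 : ∀ x, HasDerivAt f1 (f2 x) x)
    {K C : ℝ} (hK : ∀ x y, |f2 x - f2 y| ≤ K * |x - y|) (hC : ∀ x, |f2 x| ≤ C)
    (hC1 : ∀ x, |f1 x| ≤ 1) {t : ℝ} (ht : 0 < t) :
    TendstoInMeasure μ (fun n => rsum (fun s ω => f1 (Y s ω)) W t n) atTop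
      (fun ω => f (Y t ω) - f (Y 0 ω) + lam * (∫ u in (0:ℝ)..t, f1 (Y u ω) * psgn (Y u ω))
        - 1 / 2 * ∫ u in (0:ℝ)..t, f2 (Y u ω)) := by
  have hK0 : 0 ≤ K := by
    have := (abs_nonneg _).trans (hK 1 0)
    simpa using this
  have hC0 : 0 ≤ C := (abs_nonneg _).trans (hC 0)
  have hl := S.hl
  have cf : Continuous f := continuous_iff_continuousAt.2 fun x => (hf x).continuousAt
  have cf1 : Continuous f1 := continuous_iff_continuousAt.2 fun x => (hf1 x).continuousAt
  have cf2 : Continuous f2 := by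
    have : LipschitzWith K.toNNReal f2 := by
      apply LipschitzWith.of_dist_le_mul
      intro x y
      rw [Real.dist_eq, Real.dist_eq, Real.coe_toNNReal _ hK0]
      exact hK x y
    exact this.continuous
  have hg : ∀ n i : ℕ, 0 ≤ t * i / 2 ^ n := fun n i => by positivity
  have hg' : ∀ n i : ℕ, 0 ≤ t * (i + 1) / 2 ^ n := fun n i => by positivity
  have hgg : ∀ n i : ℕ, t * i / 2 ^ n ≤ t * (i + 1) / 2 ^ n := fun n i => by gcongr; linarith
  have hδ : ∀ n i : ℕ, t * (i + 1) / 2 ^ n - t * i / 2 ^ n = t / 2 ^ n := fun n i => by ring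
  -- drift part
  have T1 : TendstoInMeasure μ (fun n ω => ∑ i ∈ Finset.range (2 ^ n), f1 (Y (t * i / 2 ^ n) ω) *
      ((W (t * (i + 1) / 2 ^ n) ω - W (t * i / 2 ^ n) ω)
        - (Y (t * (i + 1) / 2 ^ n) ω - Y (t * i / 2 ^ n) ω))) atTop
      (fun ω => lam * ∫ u in (0:ℝ)..t, f1 (Y u ω) * psgn (Y u ω)) := by
    refine tendstoInMeasure_of_tendsto_ae (fun n => ?_) ?_
    · apply Measurable.aestronglyMeasurable
      refine Finset.measurable_fun_sum _ fun i _ => ?_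
      exact (cf1.measurable.comp (S.mY _)).mul ((S.hW.inc_meas' (hg n i) (hg' n i)).sub
        ((S.mY _).sub (S.mY _)))
    · filter_upwards [S.cY, S.inc] with ω hc hinc
      have := (riem ht (cf1.comp hc) (fun u => hC1 _) (measurable_psgn.comp hc.measurable)
        (fun u => (abs_psgn _).le)).const_mul lam
      refine this.congr fun n => ?_
      rw [Finset.mul_sum]
      refine Finset.sum_congr rfl fun i _ => ?_
      rw [hinc _ _ (hg n i) (hgg n i)]
      simp only [Function.comp_apply]
      ring
  -- second order part
  have T2 : TendstoInMeasure μ (fun n ω => ∑ i ∈ Finset.range (2 ^ n), f2 (Y (t * i / 2 ^ n) ω) *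
      (t / 2 ^ n)) atTop (fun ω => ∫ u in (0:ℝ)..t, f2 (Y u ω)) := by
    refine tendstoInMeasure_of_tendsto_ae (fun n => ?_) ?_
    · apply Measurable.aestronglyMeasurable
      refine Finset.measurable_fun_sum _ fun i _ => ?_
      exact (cf2.measurable.comp (S.mY _)).mul measurable_const
    · filter_upwards [S.cY] with ω hc
      have := riem ht (cf2.comp hc) (fun u => hC _) (ψ := fun _ => 1) measurable_const (by simp)
      simp only [mul_one, Function.comp_apply] at this
      refine this.congr fun n => ?_
      refine Finset.sum_congr rfl fun i _ => ?_
      rw [intervalIntegral.integral_const, hδ]; simp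
  -- quadratic variation part
  have T3 : TendstoInMeasure μ (fun n ω => mart W (fun _ x => x ^ 2 - t / 2 ^ n)
      (fun i => t * i / 2 ^ n) (fun i ω => f2 (Y (t * i / 2 ^ n) ω)) (2 ^ n) ω) atTop (fun _ => 0) := by
    have hq := fun n : ℕ => mart_qv S.hW (c := fun i => t * i / 2 ^ n) (δ := t / 2 ^ n) (by positivity)
      (fun i => by push_cast; exact hδ n i) (by simp)
      (ξ := fun i ω => f2 (Y (t * i / 2 ^ n) ω)) (fun i => cf2.measurable.comp (S.adY _ (hg n i)))
      (C := C) (fun i ω => hC _) (2 ^ n)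
    refine TIM.of_sq (fun n => (hq n).1) ?_
    have hlim : Tendsto (fun n : ℕ => C ^ 2 * ((m4 + 1) * t ^ 2) * (1 / 2 : ℝ) ^ n) atTop
        (nhds (C ^ 2 * ((m4 + 1) * t ^ 2) * 0)) :=
      (tendsto_pow_atTop_nhds_zero_of_lt_one (by norm_num) (by norm_num)).const_mul _
    rw [mul_zero] at hlim
    refine tendsto_of_tendsto_of_tendsto_of_le_of_le tendsto_const_nhds hlim
      (fun n => integral_nonneg fun ω => sq_nonneg _) fun n => ?_
    refine ((hq n).2).trans (le_of_eq ?_)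
    push_cast
    rw [one_div, inv_pow]
    field_simp
  -- error part
  have T4 : TendstoInMeasure μ (fun n ω => ∑ i ∈ Finset.range (2 ^ n),
      ((f (Y (t * (i + 1) / 2 ^ n) ω) - f (Y (t * i / 2 ^ n) ω)
        - f1 (Y (t * i / 2 ^ n) ω) * (Y (t * (i + 1) / 2 ^ n) ω - Y (t * i / 2 ^ n) ω)
        - f2 (Y (t * i / 2 ^ n) ω) * (Y (t * (i + 1) / 2 ^ n) ω - Y (t * i / 2 ^ n) ω) ^ 2 / 2)
      + f2 (Y (t * i / 2 ^ n) ω) * ((Y (t * (i + 1) / 2 ^ n) ω - Y (t * i / 2 ^ n) ω) ^ 2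
        - (W (t * (i + 1) / 2 ^ n) ω - W (t * i / 2 ^ n) ω) ^ 2) / 2)) atTop (fun _ => 0) := by
    set ee : ℕ → ℝ := fun n => Real.sqrt (t / 2 ^ n) with hee
    have hep : ∀ n, 0 < ee n := fun n => Real.sqrt_pos.2 (by positivity)
    have he2 : ∀ n, ee n ^ 2 = t / 2 ^ n := fun n => Real.sq_sqrt (by positivity)
    set G : ℕ → ℝ → ℝ := fun n x => K * (2 * (ee n * x ^ 2 + x ^ 4 / ee n) + 4 * lam ^ 3 * ee n ^ 6)
      + C * (lam * (lam * ee n ^ 4 + ee n ^ 3 + ee n * x ^ 2)) / 2 with hG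
    have i2 : ∀ n i : ℕ, Integrable (fun ω => (W (t * (i + 1) / 2 ^ n) ω - W (t * i / 2 ^ n) ω) ^ 2) μ :=
      fun n i => (S.hW.memLp_inc (hg n i) (hgg n i) (p := 2) (by norm_num)).integrable_sq
    have i4 : ∀ n i : ℕ, Integrable (fun ω => (W (t * (i + 1) / 2 ^ n) ω - W (t * i / 2 ^ n) ω) ^ 4) μ :=
      fun n i => memLp_four_int (S.hW.memLp_inc (hg n i) (hgg n i) (by norm_num))
    have hGe : ∀ n x, G n x = (2 * K * ee n + C * lam * ee n / 2) * x ^ 2 + (2 * K / ee n) * x ^ 4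
        + (4 * K * lam ^ 3 * ee n ^ 6 + C * (lam * (lam * ee n ^ 4 + ee n ^ 3)) / 2) := by
      intro n x; simp only [hG]; ring
    have iG : ∀ n i : ℕ, Integrable (fun ω => G n (W (t * (i + 1) / 2 ^ n) ω - W (t * i / 2 ^ n) ω)) μ := by
      intro n i
      simp only [hGe]
      exact (((i2 n i).const_mul _).add ((i4 n i).const_mul _)).add (integrable_const _)
    have eG : ∀ n i : ℕ, ∫ ω, G n (W (t * (i + 1) / 2 ^ n) ω - W (t * i / 2 ^ n) ω) ∂μ
        = (t / 2 ^ n) * (2 * K * (1 + m4) * ee n + 4 * K * lam ^ 3 * ee n ^ 4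
          + C * lam * (lam * ee n ^ 2 + 2 * ee n) / 2) := by
      intro n i
      simp only [hGe]
      rw [integral_add (by exact ((i2 n i).const_mul _).add ((i4 n i).const_mul _)) (integrable_const _),
        integral_add ((i2 n i).const_mul _) ((i4 n i).const_mul _), integral_const_mul,
        integral_const_mul, S.hW.integral_inc_sq (hg n i) (hgg n i),
        S.hW.integral_inc_four (hg n i) (hgg n i), hδ, ← he2]
      have := (hep n).ne'
      simp only [integral_const, probReal_univ, one_smul]
      field_simp
      ring
    refine TIM.of_abs_le (g := fun n ω => ∑ i ∈ Finset.range (2 ^ n),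
      G n (W (t * (i + 1) / 2 ^ n) ω - W (t * i / 2 ^ n) ω))
      (fun n => integrable_finsetSum _ fun i _ => iG n i) ?_ ?_
    · intro n
      filter_upwards [S.inc] with ω hinc
      refine (Finset.abs_sum_le_sum_abs _ _).trans (Finset.sum_le_sum fun i _ => ?_)
      set x := W (t * (i + 1) / 2 ^ n) ω - W (t * i / 2 ^ n) ω with hx
      set D := - lam * ∫ u in (t * i / 2 ^ n)..(t * (i + 1) / 2 ^ n), psgn (Y u ω) with hD
      have hYD : Y (t * (i + 1) / 2 ^ n) ω - Y (t * i / 2 ^ n) ω = x + D := by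
        rw [hinc _ _ (hg n i) (hgg n i), hx, hD]; ring
      have hDb : |D| ≤ lam * ee n ^ 2 := by
        rw [hD, abs_mul, abs_neg, abs_of_nonneg hl, he2, ← hδ n i]
        gcongr
        exact abs_psgn_int _ (hgg n i)
      have h1 := taylor2 hf hf1 hK (Y (t * i / 2 ^ n) ω) (Y (t * (i + 1) / 2 ^ n) ω)
      rw [hYD] at h1 ⊢
      have h2 := cube_bd (x := x) (hep n) hl hDb
      have h3 := sq_bd (x := x) (hep n) hl hDb
      refine (abs_add_le _ _).trans ?_
      refine add_le_add (h1.trans (mul_le_mul_of_nonneg_left h2 hK0)) ?_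
      rw [abs_div, abs_mul, abs_two]
      have := hC (Y (t * i / 2 ^ n) ω)
      gcongr
    · have hs : ∀ n : ℕ, ∫ ω, ∑ i ∈ Finset.range (2 ^ n),
          G n (W (t * (i + 1) / 2 ^ n) ω - W (t * i / 2 ^ n) ω) ∂μ
          = t * (2 * K * (1 + m4) * ee n + 4 * K * lam ^ 3 * ee n ^ 4
          + C * lam * (lam * ee n ^ 2 + 2 * ee n) / 2) := by
        intro n
        rw [integral_finsetSum _ fun i _ => iG n i]
        simp only [eG]
        rw [Finset.sum_const, Finset.card_range, nsmul_eq_mul]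
        push_cast
        field_simp
      simp_rw [hs]
      have h0 : Tendsto ee atTop (nhds 0) := by
        have h1 : Tendsto (fun n : ℕ => t / 2 ^ n) atTop (nhds 0) := by
          have := (tendsto_pow_atTop_nhds_zero_of_lt_one (r := (1/2 : ℝ)) (by norm_num) (by norm_num)).const_mul t
          simpa [div_eq_mul_inv] using this
        have := (Real.continuous_sqrt.tendsto 0).comp h1
        rwa [Real.sqrt_zero] at this
      have hcont : Continuous (fun e : ℝ => t * (2 * K * (1 + m4) * e + 4 * K * lam ^ 3 * e ^ 4
          + C * lam * (lam * e ^ 2 + 2 * e) / 2)) := by fun_prop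
      have h5 := (hcont.tendsto 0).comp h0
      have e0 : t * (2 * K * (1 + m4) * (0 : ℝ) + 4 * K * lam ^ 3 * (0 : ℝ) ^ 4
          + C * lam * (lam * (0 : ℝ) ^ 2 + 2 * 0) / 2) = 0 := by ring
      beta_reduce at h5
      rw [e0] at h5
      exact h5
  have TT := TIM.sub (TIM.sub (TIM.sub (TIM.add (TIM.const (μ := μ) (l := (atTop : Filter ℕ))
    (fun ω => f (Y t ω) - f (Y 0 ω))) T1) (TIM.const_mul T2 (1 / 2))) (TIM.const_mul T3 (1 / 2))) T4
  refine TIM.of_eq TT ?_ (Eventually.of_forall fun ω => ?_)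
  · intro n ω
    have htel : f (Y t ω) - f (Y 0 ω) = ∑ i ∈ Finset.range (2 ^ n),
        (f (Y (t * (i + 1) / 2 ^ n) ω) - f (Y (t * i / 2 ^ n) ω)) := by
      have := Finset.sum_range_sub (fun i : ℕ => f (Y (t * i / 2 ^ n) ω)) (2 ^ n)
      push_cast at this
      rw [this]
      simp
    rw [htel]
    unfold mart rsum
    rw [Finset.mul_sum, Finset.mul_sum, ← Finset.sum_add_distrib, ← Finset.sum_sub_distrib,
      ← Finset.sum_sub_distrib, ← Finset.sum_sub_distrib]
    refine Finset.sum_congr rfl fun i _ => ?_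
    push_cast
    ring
  · simp


lemma exists_lim_of_cauchy {μ : Measure Ω} [IsProbabilityMeasure μ] {f : ℕ → Ω → ℝ}
    (hf : ∀ n, MemLp (f n) 2 μ)
    (h : Tendsto (fun p : ℕ × ℕ => ∫ ω, (f p.1 ω - f p.2 ω) ^ 2 ∂μ) atTop (nhds 0)) :
    ∃ N : Ω → ℝ, Measurable N ∧ TendstoInMeasure μ f atTop N := by
  have hc : CauchySeq fun n => (hf n).toLp (f n) := by
    rw [cauchySeq_iff_tendsto_dist_atTop_0]
    have h1 := (Real.continuous_sqrt.tendsto 0).comp h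
    rw [Real.sqrt_zero] at h1
    refine h1.congr fun p => ?_
    rw [dist_edist, Lp.edist_toLp_toLp, 
      MemLp.eLpNorm_eq_integral_rpow_norm (by norm_num) (by norm_num) ((hf p.1).sub (hf p.2)),
      ENNReal.toReal_ofReal (by positivity), Function.comp_apply, Real.sqrt_eq_rpow]
    congr 1
    · congr 1
      ext ω
      simp
    · simp
  obtain ⟨g, hg⟩ := cauchySeq_tendsto_of_complete hc
  refine ⟨g, (Lp.stronglyMeasurable g).measurable, ?_⟩
  exact (tendstoInMeasure_of_tendsto_Lp hg).congr (fun n => (hf n).coeFn_toLp) (Eventually.of_forall fun _ => rfl)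

lemma BB.exists_N {μ : Measure Ω} [IsProbabilityMeasure μ] {F : ℝ → MeasurableSpace Ω}
    {lam y : ℝ} {W Y : ℝ → Ω → ℝ} (S : BB μ F lam y W Y) :
    ∃ N : ℝ → Ω → ℝ, (∀ t, Measurable (N t)) ∧ ∀ t, 0 ≤ t →
      TendstoInMeasure μ (fun n => rsum (fun s ω => if Y s ω ≤ 0 then (0:ℝ) else 1) W t n) atTop (N t) := by
  have key : ∀ t : ℝ, ∃ N : Ω → ℝ, Measurable N ∧ (0 ≤ t → 
      TendstoInMeasure μ (fun n => rsum (fun s ω => if Y s ω ≤ 0 then (0:ℝ) else 1) W t n) atTop N) := by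
    intro t
    rcases lt_trichotomy t 0 with ht | rfl | ht
    · exact ⟨fun _ => 0, measurable_const, fun h => absurd h (not_le.2 ht)⟩
    · refine ⟨fun _ => 0, measurable_const, fun _ => ?_⟩
      refine TIM.of_eq (TIM.const (fun _ => 0)) (fun n ω => ?_) (Eventually.of_forall fun _ => rfl)
      unfold rsum; simp
    · obtain ⟨Z, hZc, hZm0, hZY⟩ := exists_contMod S.mY S.cY
      have hZm : Measurable (Function.uncurry Z) :=
        measurable_uncurry_of_continuous_of_measurable hZc hZm0
      have hM : ∀ n, MemLp (rsum (fun s ω => if Y s ω ≤ 0 then (0:ℝ) else 1) W t n) 2 μ := by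
        intro n
        have h1 := csum_memLp S.hW (H := fun s ω => if Y s ω ≤ 0 then (0:ℝ) else 1)
          (fun u hu => coef_meas S.adY 0 1 u hu) (fun u ω => coef_bdd 0 1 (Y u ω)) ht.le ht.le n
        exact (memLp_congr_ae (Eventually.of_forall fun ω => csum_self ht.le n ω)).1 h1
      obtain ⟨N, hN, hN'⟩ := exists_lim_of_cauchy hM (by
        rw [tendsto_zero_iff_enorm_tendsto_zero]
        have hk := S.kap_tendsto hZc hZm0 hZY ht
        have h2 : Tendsto (fun p : ℕ × ℕ => ENNReal.ofReal ((0 - 1) ^ 2) * (kap μ Z t p.1 + kap μ Z t p.2))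
            atTop (nhds (ENNReal.ofReal ((0 - 1) ^ 2) * (0 + 0))) := by
          apply ENNReal.Tendsto.const_mul _ (Or.inr ENNReal.ofReal_ne_top)
          rw [← prod_atTop_atTop_eq]
          exact (hk.comp tendsto_fst).add (hk.comp tendsto_snd)
        rw [add_zero, mul_zero] at h2
        refine tendsto_of_tendsto_of_tendsto_of_le_of_le tendsto_const_nhds h2 (fun _ => zero_le) ?_
        intro p
        refine le_trans (le_of_eq ?_) (kap_sub_le hZm hZY 0 1 (le_refl t) (le_refl t) p.1 p.2)
        rw [← csum_diff_sq S.hW (H := fun s ω => if Y s ω ≤ 0 then (0:ℝ) else 1)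
          (H' := fun s ω => if Y s ω ≤ 0 then (0:ℝ) else 1)
          (fun u hu => coef_meas S.adY 0 1 u hu) (fun u hu => coef_meas S.adY 0 1 u hu)
          (fun u ω => coef_bdd 0 1 (Y u ω)) (fun u ω => coef_bdd 0 1 (Y u ω)) ht ht ht.le le_rfl le_rfl]
        simp_rw [csum_self ht.le])
      exact ⟨N, hN, fun _ => hN'⟩
  choose N hN using key
  exact ⟨N, fun t => (hN t).1, fun t => (hN t).2⟩

lemma BB.N_four {μ : Measure Ω} [IsProbabilityMeasure μ] {F : ℝ → MeasurableSpace Ω}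
    {lam y : ℝ} {W Y N : ℝ → Ω → ℝ} (S : BB μ F lam y W Y)
    (hN : ∀ t, 0 ≤ t →
      TendstoInMeasure μ (fun n => rsum (fun s ω => if Y s ω ≤ 0 then (0:ℝ) else 1) W t n) atTop (N t))
    {s t : ℝ} (hs : 0 ≤ s) (hst : s ≤ t) :
    ∫⁻ ω, ENNReal.ofReal ((N t ω - N s ω) ^ 4) ∂μ ≤ ENNReal.ofReal ((4 + 3 * m4) * (t - s) ^ 2) := by
  rcases (hs.trans hst).eq_or_lt with h0 | ht
  · have : s = t := le_antisymm hst (h0 ▸ hs)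
    subst this
    simp
  have h1 := TIM.sub (hN t ht.le) (S.csum_tendsto S.hW 0 1 hN hs hst ht)
  set c : ℕ → ℕ → ℝ := fun n i => max s (t * i / 2 ^ n) with hcd
  set ξ : ℕ → ℕ → Ω → ℝ := fun n i ω => if Y (t * i / 2 ^ n) ω ≤ 0 then (0:ℝ) else 1 with hξd
  have he : ∀ n ω, rsum (fun s ω => if Y s ω ≤ 0 then (0:ℝ) else 1) W t n ω
      - csum (fun s ω => if Y s ω ≤ 0 then (0:ℝ) else 1) W t n s ω
      = mart W (fun _ x => x) (c n) (ξ n) (2 ^ n) ω := by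
    intro n ω
    rw [rsum_sub_csum ht.le]
    unfold mart
    refine Finset.sum_congr rfl fun i _ => ?_
    simp only [hcd, hξd]
    push_cast
    rfl
  have h2 := TIM.of_eq h1 he (Eventually.of_forall fun _ => rfl)
  have hcm : ∀ n, Monotone (c n) := by
    intro n i j hij
    simp only [hcd]
    have : (i : ℝ) ≤ j := by exact_mod_cast hij
    gcongr
  have hc0 : ∀ n, c n 0 = s := by intro n; simp [hcd, hs]
  have hck : ∀ n, c n (2 ^ n) = t := by intro n; simp [hcd, hst]
  have hξ : ∀ n i, Measurable[F (c n i)] (ξ n i) := by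
    intro n i
    exact (coef_meas S.adY 0 1 (t * i / 2 ^ n) (by positivity)).mono (S.hW.mono (le_max_right _ _)) le_rfl
  have hξ1 : ∀ n i ω, |ξ n i ω| ≤ 1 := by
    intro n i ω
    exact (coef_bdd 0 1 _).trans (by norm_num)
  have hmem : ∀ n, MemLp (mart W (fun _ x => x) (c n) (ξ n) (2 ^ n)) 4 μ := by
    intro n
    refine mart_memLp S.hW (g := fun _ x => x) (fun i => ?_) (hξ n) (hξ1 n) _
    exact S.hW.memLp_inc (hs.trans (le_max_left _ _)) (hcm n (Nat.le_succ i)) (by norm_num)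
  refine TIM.fatou (fun n => (hmem n).aestronglyMeasurable.aemeasurable) h2
    (φ := fun x => ENNReal.ofReal (x ^ 4)) (ENNReal.continuous_ofReal.comp (by fun_prop))
    (C := fun _ => ENNReal.ofReal ((4 + 3 * m4) * (t - s) ^ 2)) (fun n => ?_) tendsto_const_nhds
  rw [← ofReal_integral_eq_lintegral_ofReal (memLp_four_int (hmem n)) (Eventually.of_forall fun ω => by positivity)]
  apply ENNReal.ofReal_le_ofReal
  have := mart_four S.hW (hcm n) (by rw [hc0]; exact hs) (hξ n) (hξ1 n) (2 ^ n)
  rwa [hc0, hck] at this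


/-- trapezoidal bump -/
def trap (a b x : ℝ) : ℝ := max 0 (min 1 ((b - |x|) / (b - a)))

lemma trap_nonneg (a b x : ℝ) : 0 ≤ trap a b x := le_max_left _ _

lemma trap_le_one (a b x : ℝ) : trap a b x ≤ 1 := max_le zero_le_one (min_le_left _ _)

lemma trap_one {a b x : ℝ} (hab : a < b) (hx : |x| ≤ a) : trap a b x = 1 := by
  unfold trap
  rw [min_eq_left, max_eq_right zero_le_one]
  rw [le_div_iff₀ (by linarith)]
  linarith

lemma trap_zero {a b x : ℝ} (hab : a < b) (hx : b ≤ |x|) : trap a b x = 0 := by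
  unfold trap
  apply max_eq_left
  refine (min_le_right _ _).trans ?_
  apply div_nonpos_of_nonpos_of_nonneg <;> linarith

lemma trap_lip {a b : ℝ} (hab : a < b) (x y : ℝ) :
    |trap a b x - trap a b y| ≤ (b - a)⁻¹ * |x - y| := by
  unfold trap
  refine (abs_max_sub_max_le_max _ _ _ _).trans ?_
  refine max_le (by rw [sub_self, abs_zero]; have := sub_pos.2 hab; positivity) ?_
  refine (abs_min_sub_min_le_max _ _ _ _).trans ?_
  refine max_le (by rw [sub_self, abs_zero]; have := sub_pos.2 hab; positivity) ?_
  rw [← sub_div, abs_div, abs_of_pos (sub_pos.2 hab), div_eq_inv_mul]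
  have h1 := sub_pos.2 hab
  have : |b - |x| - (b - |y|)| ≤ |x - y| := by
    rw [show b - |x| - (b - |y|) = |y| - |x| by ring, abs_sub_comm x y]
    exact abs_abs_sub_abs_le _ _
  gcongr

lemma trap_cont (a b : ℝ) : Continuous (trap a b) := by
  unfold trap; fun_prop

lemma exists_test {a b : ℝ} (ha : 0 < a) (hab : a < b) :
    ∃ (f f1 f2 : ℝ → ℝ) (K C c : ℝ), (∀ x, HasDerivAt f (f1 x) x) ∧ (∀ x, HasDerivAt f1 (f2 x) x) ∧
      (∀ x y, |f2 x - f2 y| ≤ K * |x - y|) ∧ (∀ x, |f2 x| ≤ C) ∧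
      (∀ x, 0 ≤ f1 x) ∧ (∀ x, f1 x ≤ 1) ∧ (∀ x, x ≤ -b → f1 x = 0) ∧ (∀ x, b ≤ x → f1 x = 1) ∧
      (∀ x, |f x - max x 0| ≤ 3 * b) ∧ 2 * a ≤ c ∧ c ≤ 2 * b ∧
      (∀ x, f2 x = trap a b x / c) := by
  have hb : 0 < b := ha.trans hab
  have hT := trap_cont a b
  have hTi : ∀ u v, IntervalIntegrable (trap a b) volume u v := fun u v => hT.intervalIntegrable u v
  set c : ℝ := ∫ x in (-b)..b, trap a b x with hc
  have hc1 : 2 * a ≤ c := by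
    have h1 : ∫ x in (-a)..a, (1:ℝ) ≤ c := by
      rw [hc, ← intervalIntegral.integral_add_adjacent_intervals (hTi (-b) (-a)) (hTi (-a) b),
        ← intervalIntegral.integral_add_adjacent_intervals (hTi (-a) a) (hTi a b)]
      have e1 : 0 ≤ ∫ x in (-b)..(-a), trap a b x :=
        intervalIntegral.integral_nonneg (by linarith) fun u _ => trap_nonneg _ _ _
      have e2 : 0 ≤ ∫ x in a..b, trap a b x :=
        intervalIntegral.integral_nonneg (by linarith) fun u _ => trap_nonneg _ _ _
      have e3 : ∫ x in (-a)..a, (1:ℝ) = ∫ x in (-a)..a, trap a b x := by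
        apply intervalIntegral.integral_congr
        intro x hx
        rw [uIcc_of_le (by linarith)] at hx
        exact (trap_one hab (abs_le.2 hx)).symm
      linarith
    simp at h1
    linarith
  have hc2 : c ≤ 2 * b := by
    have h1 : c ≤ ∫ x in (-b)..b, (1:ℝ) := by
      apply intervalIntegral.integral_mono_on (by linarith) (hTi _ _) (by simp)
      intro x _
      exact trap_le_one _ _ _
    simp at h1
    linarith
  have hc0 : 0 < c := by linarith
  have hf2 : Continuous fun x => trap a b x / c := by fun_prop
  have h2i : ∀ u v, IntervalIntegrable (fun x => trap a b x / c) volume u v :=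
    fun u v => hf2.intervalIntegrable u v
  have h2n : ∀ x, 0 ≤ trap a b x / c := fun x => div_nonneg (trap_nonneg _ _ _) hc0.le
  set f1 : ℝ → ℝ := fun x => ∫ u in (-b)..x, trap a b u / c with hf1d
  have hf1 : ∀ x, HasDerivAt f1 (trap a b x / c) x := fun x =>
    intervalIntegral.integral_hasDerivAt_right (h2i _ _) (hf2.stronglyMeasurableAtFilter _ _) hf2.continuousAt
  have cf1 : Continuous f1 := continuous_iff_continuousAt.2 fun x => (hf1 x).continuousAt
  have h1i : ∀ u v, IntervalIntegrable f1 volume u v := fun u v => cf1.intervalIntegrable u v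
  have hmono : Monotone f1 := by
    intro x z hxz
    have h := intervalIntegral.integral_add_adjacent_intervals (h2i (-b) x) (h2i x z)
    have : 0 ≤ ∫ u in x..z, trap a b u / c := intervalIntegral.integral_nonneg hxz fun u _ => h2n u
    simp only [hf1d]
    linarith
  have hz : ∀ x, x ≤ -b → f1 x = 0 := by
    intro x hx
    have : ∫ u in (-b)..x, trap a b u / c = ∫ u in (-b)..x, (0:ℝ) := by
      apply intervalIntegral.integral_congr
      intro u hu
      rw [uIcc_of_ge hx] at hu
      simp only
      rw [trap_zero hab (by rw [abs_of_nonpos (by linarith [hu.2])]; linarith [hu.2]), zero_div]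
    simp only [hf1d]
    rw [this]; simp
  have hbb : f1 b = 1 := by
    simp only [hf1d]
    rw [intervalIntegral.integral_div, ← hc, div_self hc0.ne']
  have ho : ∀ x, b ≤ x → f1 x = 1 := by
    intro x hx
    have h := intervalIntegral.integral_add_adjacent_intervals (h2i (-b) b) (h2i b x)
    have : ∫ u in b..x, trap a b u / c = ∫ u in b..x, (0:ℝ) := by
      apply intervalIntegral.integral_congr
      intro u hu
      rw [uIcc_of_le hx] at hu
      simp only
      rw [trap_zero hab (by rw [abs_of_nonneg (by linarith [hu.1])]; exact hu.1), zero_div]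
    rw [this] at h
    simp only [hf1d] at hbb ⊢
    rw [← h, hbb]; simp
  have hn : ∀ x, 0 ≤ f1 x := by
    intro x
    rw [← hz (min x (-b)) (min_le_right _ _)]
    exact hmono (min_le_left _ _)
  have hl : ∀ x, f1 x ≤ 1 := by
    intro x
    rw [← ho (max x b) (le_max_right _ _)]
    exact hmono (le_max_left _ _)
  set f : ℝ → ℝ := fun x => ∫ u in (-b)..x, f1 u with hfd
  have hf : ∀ x, HasDerivAt f (f1 x) x := fun x =>
    intervalIntegral.integral_hasDerivAt_right (h1i _ _) (cf1.stronglyMeasurableAtFilter _ _) cf1.continuousAt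
  refine ⟨f, f1, fun x => trap a b x / c, (b - a)⁻¹ / c, 1 / c, c, hf, hf1, ?_, ?_, hn, hl, hz, ho, ?_,
    hc1, hc2, fun x => rfl⟩
  · intro x z
    rw [← sub_div, abs_div, abs_of_pos hc0]
    have := trap_lip hab x z
    calc _ ≤ (b - a)⁻¹ * |x - z| / c := by gcongr
      _ = _ := by ring
  · intro x
    rw [abs_div, abs_of_pos hc0, abs_of_nonneg (trap_nonneg _ _ _)]
    have := trap_le_one a b x
    gcongr
  · have hbd : ∀ x, -b ≤ x → x ≤ b → |f x| ≤ 2 * b := by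
      intro x h1 h2
      have : ‖∫ u in (-b)..x, f1 u‖ ≤ 1 * |x - -b| := by
        apply intervalIntegral.norm_integral_le_of_norm_le_const
        intro u _
        rw [Real.norm_eq_abs, abs_of_nonneg (hn u)]
        exact hl u
      rw [Real.norm_eq_abs, abs_of_nonneg (by linarith : 0 ≤ x - -b)] at this
      simp only [hfd]
      linarith
    intro x
    rcases le_total x (-b) with h1 | h1
    · have : ∫ u in (-b)..x, f1 u = ∫ u in (-b)..x, (0:ℝ) := by
        apply intervalIntegral.integral_congr
        intro u hu
        rw [uIcc_of_ge h1] at hu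
        exact hz u hu.2
      simp only [hfd]
      rw [this, max_eq_right (by linarith)]
      simp [hb.le]
    rcases le_total x b with h2 | h2
    · have e1 := abs_le.1 (hbd x h1 h2)
      have e2 : max x 0 ≤ b := max_le h2 hb.le
      have e3 : 0 ≤ max x 0 := le_max_right _ _
      rw [abs_le]; constructor <;> linarith
    · have h := intervalIntegral.integral_add_adjacent_intervals (h1i (-b) b) (h1i b x)
      have : ∫ u in b..x, f1 u = ∫ u in b..x, (1:ℝ) := by
        apply intervalIntegral.integral_congr
        intro u hu
        rw [uIcc_of_le h2] at hu
        exact ho u hu.1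
      rw [this] at h
      have e1 := abs_le.1 (hbd b (by linarith) le_rfl)
      simp only [hfd] at e1 ⊢
      simp at h
      rw [max_eq_left (by linarith), ← h, abs_le]
      constructor <;> linarith


lemma bdd_intble {g : ℝ → ℝ} (hg : Measurable g) {C : ℝ} (hC : ∀ u, |g u| ≤ C) (a b : ℝ) :
    IntervalIntegrable g volume a b := by
  refine IntervalIntegrable.mono_fun (g := g) (f := fun _ : ℝ => C)
    intervalIntegrable_const hg.aestronglyMeasurable ?_
  refine Eventually.of_forall fun u => ?_
  simp only [Real.norm_eq_abs]
  exact (hC u).trans (le_abs_self C)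

lemma BB.time_bd {μ : Measure Ω} [IsProbabilityMeasure μ] {F : ℝ → MeasurableSpace Ω}
    {lam y : ℝ} {W Y : ℝ → Ω → ℝ} (S : BB μ F lam y W Y) {t b δ : ℝ} (ht : 0 < t) (hb : 0 < b)
    (hδ : 0 ≤ δ) {φ : ℝ → ℝ} (hφ : ∀ u, 0 < u → u ≤ t → u - δ ≤ φ u) :
    ∫⁻ u in Ioc 0 t, μ {ω | |Y (φ u) ω| ≤ b} ≤ ENNReal.ofReal (b + δ + t * ((1 + lam) * Real.sqrt b)) := by
  have hl := S.hl
  calc ∫⁻ u in Ioc 0 t, μ {ω | |Y (φ u) ω| ≤ b}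
      ≤ ∫⁻ u in Ioc 0 t, ((Iic (b + δ)).indicator (fun _ => 1) u + ENNReal.ofReal ((1 + lam) * Real.sqrt b)) := by
        refine setLIntegral_mono' measurableSet_Ioc fun u hu => ?_
        by_cases h : b ≤ φ u
        · exact (S.small_ball hb h).trans le_add_self
        · have h1 := hφ u hu.1 hu.2
          have h2 : u ∈ Iic (b + δ) := by
            push Not at h
            simp only [mem_Iic]; linarith
          rw [indicator_of_mem h2]
          exact prob_le_one.trans le_self_add
    _ ≤ ENNReal.ofReal (b + δ) + ENNReal.ofReal (t * ((1 + lam) * Real.sqrt b)) := by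
        rw [lintegral_add_right _ measurable_const]
        apply add_le_add
        · rw [lintegral_indicator measurableSet_Iic, setLIntegral_const, one_mul,
            Measure.restrict_apply measurableSet_Iic]
          calc volume (Iic (b + δ) ∩ Ioc 0 t) ≤ volume (Ioc 0 (b + δ)) :=
                measure_mono fun x hx => ⟨hx.2.1, hx.1⟩
            _ = _ := by rw [Real.volume_Ioc, sub_zero]
        · rw [setLIntegral_const, Real.volume_Ioc, sub_zero, ← ENNReal.ofReal_mul (by positivity), mul_comm]
    _ = _ := (ENNReal.ofReal_add (by positivity) (by positivity)).symm

lemma meas_le_ind (b : ℝ) : Measurable (fun x : ℝ => if |x| ≤ b then (1:ℝ) else 0) :=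
  Measurable.ite (measurableSet_le measurable_id.abs measurable_const) measurable_const measurable_const

lemma BB.occ {μ : Measure Ω} [IsProbabilityMeasure μ] {F : ℝ → MeasurableSpace Ω}
    {lam y : ℝ} {W Y : ℝ → Ω → ℝ} (S : BB μ F lam y W Y) {t b : ℝ} (ht : 0 < t) (hb : 0 < b) :
    ∫⁻ ω, ENNReal.ofReal (∫ u in (0:ℝ)..t, if |Y u ω| ≤ b then (1:ℝ) else 0) ∂μ
      ≤ ENNReal.ofReal (b + t * ((1 + lam) * Real.sqrt b)) := by
  obtain ⟨Z, hZc, hZm0, hZY⟩ := exists_contMod S.mY S.cY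
  have hZm : Measurable (Function.uncurry Z) :=
    measurable_uncurry_of_continuous_of_measurable hZc hZm0
  have e1 : ∫⁻ ω, ENNReal.ofReal (∫ u in (0:ℝ)..t, if |Y u ω| ≤ b then (1:ℝ) else 0) ∂μ
      = ∫⁻ ω, (∫⁻ u in Ioc 0 t, ENNReal.ofReal (if |Z u ω| ≤ b then (1:ℝ) else 0)) ∂μ := by
    refine lintegral_congr_ae ?_
    filter_upwards [hZY] with ω hω
    simp_rw [← hω]
    rw [intervalIntegral.integral_of_le ht.le]
    refine ofReal_integral_eq_lintegral_ofReal ?_ (Eventually.of_forall fun u => ?_)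
    · have h1 := bdd_intble (g := fun u => if |Z u ω| ≤ b then (1:ℝ) else 0)
        ((meas_le_ind b).comp (hZc ω).measurable) (C := 1) (fun u => by beta_reduce; split_ifs <;> simp) 0 t
      exact (intervalIntegrable_iff_integrableOn_Ioc_of_le ht.le).1 h1
    · simp only [Pi.zero_apply]; split_ifs <;> simp
  rw [e1, lintegral_lintegral_swap]
  · refine le_trans (le_of_eq ?_) ((S.time_bd ht hb le_rfl (φ := fun u => u) (fun u _ _ => by simp)).trans
      (le_of_eq (by rw [add_zero])))
    refine lintegral_congr fun u => ?_
    have hs : MeasurableSet {ω | |Y u ω| ≤ b} := measurableSet_le (S.mY u).abs measurable_const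
    rw [← lintegral_indicator_one hs]
    refine lintegral_congr_ae ?_
    filter_upwards [hZY] with ω hω
    rw [hω u]
    by_cases h : |Y u ω| ≤ b
    · rw [if_pos h, indicator_of_mem (by exact h)]; simp
    · rw [if_neg h, indicator_of_notMem (by exact h)]; simp
  · apply Measurable.aemeasurable
    apply Measurable.ennreal_ofReal
    exact (meas_le_ind b).comp (hZm.comp measurable_swap)

lemma BB.M_sq {μ : Measure Ω} [IsProbabilityMeasure μ] {F : ℝ → MeasurableSpace Ω}
    {lam y : ℝ} {W Y : ℝ → Ω → ℝ} (S : BB μ F lam y W Y) {t b : ℝ} (ht : 0 < t) (hb : 0 < b)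
    {f1 : ℝ → ℝ} (hf1 : Measurable f1) (hn : ∀ x, 0 ≤ f1 x) (hl : ∀ x, f1 x ≤ 1)
    (hz : ∀ x, x ≤ -b → f1 x = 0) (ho : ∀ x, b ≤ x → f1 x = 1) (n : ℕ) :
    ∫⁻ ω, ENNReal.ofReal ((rsum (fun s ω => f1 (Y s ω)) W t n ω
      - rsum (fun s ω => if Y s ω ≤ 0 then (0:ℝ) else 1) W t n ω) ^ 2) ∂μ
      ≤ ENNReal.ofReal (b + t / 2 ^ n + t * ((1 + lam) * Real.sqrt b)) := by
  have m1 : ∀ u, 0 ≤ u → Measurable[F u] (fun ω => f1 (Y u ω)) := fun u hu => hf1.comp (S.adY u hu)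
  have b1 : ∀ u ω, |f1 (Y u ω)| ≤ 1 := fun u ω => by rw [abs_of_nonneg (hn _)]; exact hl _
  have b2 : ∀ u ω, |if Y u ω ≤ 0 then (0:ℝ) else 1| ≤ 1 := fun u ω => by split_ifs <;> simp
  have M1 := csum_memLp S.hW (H := fun s ω => f1 (Y s ω)) m1 b1 ht.le ht.le n
  have M2 := csum_memLp S.hW (H := fun s ω => if Y s ω ≤ 0 then (0:ℝ) else 1)
    (fun u hu => coef_meas S.adY 0 1 u hu) b2 ht.le ht.le n
  simp_rw [← csum_self ht.le]
  rw [← ofReal_integral_eq_lintegral_ofReal (by exact (M1.sub M2).integrable_sq)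
    (Eventually.of_forall fun ω => sq_nonneg _)]
  rw [csum_diff_sq S.hW m1 (fun u hu => coef_meas S.adY 0 1 u hu) b1 b2 ht ht ht.le le_rfl le_rfl]
  refine le_trans ?_ (S.time_bd ht hb (by positivity) (φ := lpt t n) (fun u h1 h2 => lpt_ge ht n h1 h2))
  refine (Real.ofReal_le_enorm _).trans ?_
  refine (enorm_integral_le_lintegral_enorm _).trans ?_
  refine lintegral_mono fun u => ?_
  refine (enorm_integral_le_lintegral_enorm _).trans ?_
  have hs : MeasurableSet {ω | |Y (lpt t n u) ω| ≤ b} := measurableSet_le (S.mY _).abs measurable_const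
  rw [← lintegral_indicator_one hs]
  refine lintegral_mono fun ω => ?_
  beta_reduce
  set v := Y (lpt t n u) ω with hv
  by_cases h : |v| ≤ b
  · rw [indicator_of_mem (by exact h)]
    rw [Real.enorm_eq_ofReal (sq_nonneg _)]
    simp only [Pi.one_apply]
    rw [ENNReal.ofReal_le_one]
    have h1 := hn v
    have h2 := hl v
    split_ifs <;> nlinarith
  · have : (f1 v - if v ≤ 0 then (0:ℝ) else 1) = 0 := by
      push Not at h
      rcases lt_abs.1 h with h | h
      · rw [ho v h.le, if_neg (by linarith)]; simp
      · rw [hz v (by linarith), if_pos (by linarith)]; simp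
    rw [this]; simp

/-- candidate local time -/
def locL (lam y : ℝ) (Y N : ℝ → Ω → ℝ) (t : ℝ) (ω : Ω) : ℝ :=
  max (Y t ω) 0 - max y 0 + lam * (∫ u in (0:ℝ)..t, if Y u ω ≤ 0 then (0:ℝ) else 1) - N t ω

lemma meas_H : Measurable (fun x : ℝ => if x ≤ 0 then (0:ℝ) else 1) :=
  Measurable.ite measurableSet_Iic measurable_const measurable_const

lemma BB.est {μ : Measure Ω} [IsProbabilityMeasure μ] {F : ℝ → MeasurableSpace Ω}
    {lam y : ℝ} {W Y N : ℝ → Ω → ℝ} (S : BB μ F lam y W Y)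
    (hN : ∀ t, 0 ≤ t →
      TendstoInMeasure μ (fun n => rsum (fun s ω => if Y s ω ≤ 0 then (0:ℝ) else 1) W t n) atTop (N t))
    {t a b : ℝ} (ht : 0 < t) (ha : 0 < a) (hab : a < b) (hb1 : b ≤ 1) :
    ∃ c, 2 * a ≤ c ∧ c ≤ 2 * b ∧ 
    ∫⁻ ω, ENNReal.ofReal ((1 / 2 * (∫ u in (0:ℝ)..t, trap a b (Y u ω) / c) - locL lam y Y N t ω) ^ 2) ∂μ
      ≤ ENNReal.ofReal ((108 + 3 * (lam ^ 2 * t + 1) * (1 + t * (1 + lam))) * Real.sqrt b) := by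
  obtain ⟨f, f1, f2, K, C, c, hf, hf1, hK, hC, hn, hl, hz, ho, hfm, hc1, hc2, hf2⟩ := exists_test ha hab
  refine ⟨c, hc1, hc2, ?_⟩
  simp_rw [← hf2]
  have hb : 0 < b := ha.trans hab
  have cf1 : Continuous f1 := continuous_iff_continuousAt.2 fun x => (hf1 x).continuousAt
  have b1 : ∀ x, |f1 x| ≤ 1 := fun x => by rw [abs_of_nonneg (hn _)]; exact hl _
  have hlam := S.hl
  set J : Ω → ℝ := fun ω => f (Y t ω) - f (Y 0 ω) + lam * (∫ u in (0:ℝ)..t, f1 (Y u ω) * psgn (Y u ω))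
        - 1 / 2 * ∫ u in (0:ℝ)..t, f2 (Y u ω) with hJ
  have T1 := TIM.sub (S.ito hf hf1 hK hC b1 ht) (hN t ht.le)
  have am : ∀ n, AEMeasurable (fun ω => rsum (fun s ω => f1 (Y s ω)) W t n ω
      - rsum (fun s ω => if Y s ω ≤ 0 then (0:ℝ) else 1) W t n ω) μ := by
    intro n
    have M1 := csum_memLp S.hW (H := fun s ω => f1 (Y s ω)) 
      (fun u hu => cf1.measurable.comp (S.adY u hu)) (fun u ω => b1 _) ht.le ht.le n
    have M2 := csum_memLp S.hW (H := fun s ω => if Y s ω ≤ 0 then (0:ℝ) else 1)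
      (fun u hu => coef_meas S.adY 0 1 u hu) (fun u ω => coef_bdd 0 1 _) ht.le ht.le n
    have := (M1.sub M2).aestronglyMeasurable.aemeasurable
    simp_rw [← csum_self ht.le]
    exact this
  have mJ : AEMeasurable (fun ω => J ω - N t ω) μ :=
    (TendstoInMeasure.aestronglyMeasurable (fun n => (am n).aestronglyMeasurable) T1).aemeasurable
  have hlim : Tendsto (fun n : ℕ => ENNReal.ofReal (b + t / 2 ^ n + t * ((1 + lam) * Real.sqrt b))) atTop
      (nhds (ENNReal.ofReal (b + 0 + t * ((1 + lam) * Real.sqrt b)))) := by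
    apply ENNReal.tendsto_ofReal
    have : Tendsto (fun n : ℕ => t / 2 ^ n) atTop (nhds 0) := by
      have := (tendsto_pow_atTop_nhds_zero_of_lt_one (r := (1/2 : ℝ)) (by norm_num) (by norm_num)).const_mul t
      simpa [div_eq_mul_inv] using this
    exact (this.const_add b).add_const _
  have E1 : ∫⁻ ω, ENNReal.ofReal ((J ω - N t ω) ^ 2) ∂μ ≤ _ := TIM.fatou am T1
    (φ := fun x => ENNReal.ofReal (x ^ 2)) (ENNReal.continuous_ofReal.comp (by fun_prop))
    (fun n => S.M_sq ht hb cf1.measurable hn hl hz ho n) hlim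
  rw [add_zero] at E1
  have E2 := S.occ ht hb
  set O : Ω → ℝ := fun ω => ∫ u in (0:ℝ)..t, if |Y u ω| ≤ b then (1:ℝ) else 0 with hO
  have key : ∀ᵐ ω ∂μ, (1 / 2 * (∫ u in (0:ℝ)..t, f2 (Y u ω)) - locL lam y Y N t ω) ^ 2
      ≤ 108 * b ^ 2 + 3 * lam ^ 2 * t * O ω + 3 * (J ω - N t ω) ^ 2 := by
    filter_upwards [S.cY, S.eq, S.hW.init] with ω hc he h0
    have hy0 : Y 0 ω = y := by rw [he 0 le_rfl, h0]; simp
    have i1 : IntervalIntegrable (fun u => f1 (Y u ω) * psgn (Y u ω)) volume 0 t :=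
      bdd_intble (g := fun u => f1 (Y u ω) * psgn (Y u ω)) ((cf1.comp hc).measurable.mul (measurable_psgn.comp hc.measurable)) (C := 1)
        (fun u => by rw [abs_mul, abs_psgn, mul_one]; exact b1 _) 0 t
    have i2 : IntervalIntegrable (fun u => if Y u ω ≤ 0 then (0:ℝ) else 1) volume 0 t :=
      bdd_intble (g := fun u => if Y u ω ≤ 0 then (0:ℝ) else 1) (meas_H.comp hc.measurable) (C := 1) (fun u => by beta_reduce; split_ifs <;> simp) 0 t
    have i3 : IntervalIntegrable (fun u => if |Y u ω| ≤ b then (1:ℝ) else 0) volume 0 t :=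
      bdd_intble (g := fun u => if |Y u ω| ≤ b then (1:ℝ) else 0) ((meas_le_ind b).comp hc.measurable) (C := 1) (fun u => by beta_reduce; split_ifs <;> simp) 0 t
    set D : ℝ := (∫ u in (0:ℝ)..t, f1 (Y u ω) * psgn (Y u ω))
      - ∫ u in (0:ℝ)..t, (if Y u ω ≤ 0 then (0:ℝ) else 1) with hD
    have hDO : |D| ≤ O ω := by
      rw [hD, ← intervalIntegral.integral_sub i1 i2]
      refine (intervalIntegral.abs_integral_le_integral_abs ht.le).trans ?_
      refine intervalIntegral.integral_mono_on ht.le (i1.sub i2).abs i3 fun u _ => ?_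
      set v := Y u ω
      have h1 := hn v
      have h2 := hl v
      by_cases h : |v| ≤ b
      · rw [if_pos h, abs_le]
        unfold psgn
        by_cases hv : v ≤ 0
        · rw [if_neg (not_lt.2 hv), if_pos hv]; constructor <;> linarith
        · rw [if_pos (not_le.1 hv), if_neg hv]; constructor <;> linarith
      · have : (f1 v * psgn v - if v ≤ 0 then (0:ℝ) else 1) = 0 := by
          push Not at h
          unfold psgn
          rcases lt_abs.1 h with h | h
          · have hv : 0 < v := by linarith
            rw [ho v h.le, if_pos hv, if_neg (not_le.2 hv)]; simp
          · have hv : v ≤ 0 := by linarith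
            rw [hz v (by linarith), if_pos hv]; simp
        rw [this, if_neg h]; simp
    have hOt : O ω ≤ t := by
      have : O ω ≤ ∫ u in (0:ℝ)..t, (1:ℝ) := by
        refine intervalIntegral.integral_mono_on ht.le i3 (by simp) fun u _ => ?_
        split_ifs <;> simp
      simpa using this
    have hO0 : 0 ≤ O ω := (abs_nonneg _).trans hDO
    have hD2 : D ^ 2 ≤ t * O ω := by
      rw [← sq_abs]
      nlinarith [abs_nonneg D]
    set p := (f (Y t ω) - max (Y t ω) 0) - (f y - max y 0) with hp
    have hp1 : |p| ≤ 6 * b := by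
      have h1 := hfm (Y t ω)
      have h2 := hfm y
      have := abs_sub (f (Y t ω) - max (Y t ω) 0) (f y - max y 0)
      linarith
    have hp2 : p ^ 2 ≤ 36 * b ^ 2 := by
      rw [← sq_abs]
      nlinarith [abs_nonneg p]
    have hEq : 1 / 2 * (∫ u in (0:ℝ)..t, f2 (Y u ω)) - locL lam y Y N t ω
        = p + lam * D - (J ω - N t ω) := by
      rw [hJ, hp, hD]
      unfold locL
      simp only [hy0]
      ring
    rw [hEq]
    have h3 : (p + lam * D - (J ω - N t ω)) ^ 2 ≤ 3 * p ^ 2 + 3 * (lam * D) ^ 2 + 3 * (J ω - N t ω) ^ 2 := by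
      nlinarith [sq_nonneg (p - lam * D), sq_nonneg (p + (J ω - N t ω)), sq_nonneg (lam * D + (J ω - N t ω))]
    have h4 : (lam * D) ^ 2 ≤ lam ^ 2 * (t * O ω) := by
      rw [mul_pow]; gcongr
    linarith
  set R := b + t * ((1 + lam) * Real.sqrt b) with hR
  have hR0 : 0 ≤ R := by positivity
  have hsb : b ≤ Real.sqrt b := by
    apply Real.le_sqrt_of_sq_le
    nlinarith
  calc _ ≤ ∫⁻ ω, (ENNReal.ofReal (108 * b ^ 2) + ENNReal.ofReal (3 * lam ^ 2 * t) * ENNReal.ofReal (O ω)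
        + ENNReal.ofReal 3 * ENNReal.ofReal ((J ω - N t ω) ^ 2)) ∂μ := by
        refine lintegral_mono_ae ?_
        filter_upwards [key] with ω hω
        refine (ENNReal.ofReal_le_ofReal hω).trans ?_
        rw [← ENNReal.ofReal_mul (by positivity), ← ENNReal.ofReal_mul (by positivity)]
        refine ENNReal.ofReal_add_le.trans ?_
        gcongr
        exact ENNReal.ofReal_add_le
    _ ≤ ENNReal.ofReal (108 * b ^ 2) + ENNReal.ofReal (3 * lam ^ 2 * t) * ENNReal.ofReal R
        + ENNReal.ofReal 3 * ENNReal.ofReal R := by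
        rw [lintegral_add_right' _ ((mJ.pow_const 2).ennreal_ofReal.const_mul _),
          lintegral_add_left measurable_const, lintegral_const_mul' _ _ ENNReal.ofReal_ne_top,
          lintegral_const_mul' _ _ ENNReal.ofReal_ne_top, lintegral_const, measure_univ, mul_one]
        gcongr
    _ = ENNReal.ofReal (108 * b ^ 2 + 3 * lam ^ 2 * t * R + 3 * R) := by
        rw [ENNReal.ofReal_add (p := 108 * b ^ 2 + 3 * lam ^ 2 * t * R) (by positivity) (by positivity),
          ENNReal.ofReal_add (p := 108 * b ^ 2) (by positivity) (by positivity),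
          ENNReal.ofReal_mul (q := R) (by positivity), ENNReal.ofReal_mul (q := R) (by positivity)]
    _ ≤ _ := by
        apply ENNReal.ofReal_le_ofReal
        have h1 : R ≤ (1 + t * (1 + lam)) * Real.sqrt b := by rw [hR]; nlinarith
        have h2 : b ^ 2 ≤ Real.sqrt b := by nlinarith
        calc _ ≤ 108 * Real.sqrt b + 3 * lam ^ 2 * t * ((1 + t * (1 + lam)) * Real.sqrt b)
              + 3 * ((1 + t * (1 + lam)) * Real.sqrt b) := by gcongr
          _ = _ := by ring


lemma ae_tendsto_zero_of_tsum {μ : Measure Ω} {G : ℕ → Ω → ENNReal} (hG : ∀ k, AEMeasurable (G k) μ)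
    {C : ℕ → ENNReal} (h : ∀ k, ∫⁻ ω, G k ω ∂μ ≤ C k) (hC : ∑' k, C k ≠ ⊤) :
    ∀ᵐ ω ∂μ, Tendsto (fun k => G k ω) atTop (nhds 0) := by
  have h1 : ∫⁻ ω, ∑' k, G k ω ∂μ ≠ ⊤ := by
    rw [lintegral_tsum hG]
    exact ne_top_of_le_ne_top hC (ENNReal.tsum_le_tsum h)
  have h2 := ae_lt_top' (AEMeasurable.ennreal_tsum hG) h1
  filter_upwards [h2] with ω hω
  exact ENNReal.tendsto_atTop_zero_of_tsum_ne_top hω.ne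

lemma tendsto_of_ofReal_pow {x : ℕ → ℝ} {p : ℕ} (hp : Even p) (hp0 : p ≠ 0)
    (h : Tendsto (fun k => ENNReal.ofReal ((x k) ^ p)) atTop (nhds 0)) : Tendsto x atTop (nhds 0) := by
  have h1 : Tendsto (fun k => (x k) ^ p) atTop (nhds 0) := by
    have := (ENNReal.tendsto_toReal (a := 0) (by simp)).comp h
    simp only [ENNReal.toReal_zero] at this
    refine this.congr fun k => ?_
    simp [ENNReal.toReal_ofReal (hp.pow_nonneg _)]
  rw [Metric.tendsto_atTop] at h1 ⊢
  intro ε hε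
  obtain ⟨n, hn⟩ := h1 (ε ^ p) (by positivity)
  refine ⟨n, fun k hk => ?_⟩
  have h2 := hn k hk
  rw [dist_zero_right, norm_pow] at h2
  rw [dist_zero_right]
  exact lt_of_pow_lt_pow_left₀ p hε.le h2

lemma BB.aem_int {μ : Measure Ω} [IsProbabilityMeasure μ] {F : ℝ → MeasurableSpace Ω}
    {lam y : ℝ} {W Y : ℝ → Ω → ℝ} (S : BB μ F lam y W Y) {φ : ℝ → ℝ} (hφ : Measurable φ) {t : ℝ} (ht : 0 ≤ t) :
    AEMeasurable (fun ω => ∫ u in (0:ℝ)..t, φ (Y u ω)) μ := by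
  obtain ⟨Z, hZc, hZm0, hZY⟩ := exists_contMod S.mY S.cY
  have hZm : Measurable (Function.uncurry Z) :=
    measurable_uncurry_of_continuous_of_measurable hZc hZm0
  refine ⟨fun ω => ∫ u in (0:ℝ)..t, φ (Z u ω), ?_, ?_⟩
  · simp_rw [intervalIntegral.integral_of_le ht]
    exact (StronglyMeasurable.integral_prod_right' (ν := volume.restrict (Ioc 0 t))
      (f := fun p : Ω × ℝ => φ (Z p.2 p.1))
      (hφ.comp (hZm.comp measurable_swap)).stronglyMeasurable).measurable
  · filter_upwards [hZY] with ω hω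
    simp_rw [hω]

/-- occupation quotient -/
def occq (v : ℝ → ℝ) (t ε : ℝ) : ℝ := (4 * ε)⁻¹ * ∫ s in (0:ℝ)..t, (if |v s| < ε then (1:ℝ) else 0)

lemma lt_ind_intble {v : ℝ → ℝ} (hv : Continuous v) (ε a b : ℝ) :
    IntervalIntegrable (fun u => if |v u| < ε then (1:ℝ) else 0) volume a b := by
  refine bdd_intble (g := fun u => if |v u| < ε then (1:ℝ) else 0) (C := 1) ?_ (fun u => ?_) a b
  · exact Measurable.ite (measurableSet_lt hv.measurable.abs measurable_const) measurable_const measurable_const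
  · beta_reduce; split_ifs <;> simp

lemma squeeze_r {v : ℝ → ℝ} (hv : Continuous v) {t r ℓ : ℝ} (ht : 0 ≤ t) (hr0 : 0 < r) (hr1 : r < 1)
    {c : ℕ → ℝ} (hc1 : ∀ k, 2 * r ^ (k + 1) ≤ c k) (hc2 : ∀ k, c k ≤ 2 * r ^ k)
    (hA : Tendsto (fun k : ℕ => 1 / 2 * ∫ u in (0:ℝ)..t, trap (r ^ (k + 1)) (r ^ k) (v u) / c k) atTop (nhds ℓ))
    {δ : ℝ} (hδ : 0 < δ) :
    ∀ᶠ ε in nhdsWithin 0 (Ioi 0), r ^ 2 * (ℓ - δ) ≤ occq v t ε ∧ occq v t ε ≤ (r ^ 2)⁻¹ * (ℓ + δ) := by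
  set A : ℕ → ℝ := fun k => 1 / 2 * ∫ u in (0:ℝ)..t, trap (r ^ (k + 1)) (r ^ k) (v u) / c k with hAd
  set O : ℝ → ℝ := fun ε => ∫ s in (0:ℝ)..t, (if |v s| < ε then (1:ℝ) else 0) with hOd
  have hc0 : ∀ k, 0 < c k := fun k => lt_of_lt_of_le (by positivity) (hc1 k)
  have hlt : ∀ k : ℕ, r ^ (k + 1) < r ^ k := fun k => pow_lt_pow_right_of_lt_one₀ hr0 hr1 (Nat.lt_succ_self k)
  have iT : ∀ k : ℕ, IntervalIntegrable (fun u => trap (r ^ (k + 1)) (r ^ k) (v u)) volume 0 t :=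
    fun k => ((trap_cont _ _).comp hv).intervalIntegrable _ _
  have hAe : ∀ k, ∫ u in (0:ℝ)..t, trap (r ^ (k + 1)) (r ^ k) (v u) = 2 * c k * A k := by
    intro k
    simp only [hAd]
    rw [intervalIntegral.integral_div]
    have := (hc0 k).ne'
    field_simp
  have hA0 : ∀ k, 0 ≤ A k := by
    intro k
    have h1 : 0 ≤ ∫ u in (0:ℝ)..t, trap (r ^ (k + 1)) (r ^ k) (v u) :=
      intervalIntegral.integral_nonneg ht fun u _ => trap_nonneg _ _ _
    rw [hAe] at h1
    have := hc0 k
    by_contra h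
    push Not at h
    nlinarith
  have hlo : ∀ k : ℕ, O (r ^ (k + 1)) ≤ 2 * c k * A k := by
    intro k
    rw [← hAe]
    refine intervalIntegral.integral_mono_on ht (lt_ind_intble hv _ _ _) (iT k) fun u _ => ?_
    by_cases h : |v u| < r ^ (k + 1)
    · rw [if_pos h, trap_one (hlt k) h.le]
    · rw [if_neg h]; exact trap_nonneg _ _ _
  have hhi : ∀ k : ℕ, 2 * c k * A k ≤ O (r ^ k) := by
    intro k
    rw [← hAe]
    refine intervalIntegral.integral_mono_on ht (iT k) (lt_ind_intble hv _ _ _) fun u _ => ?_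
    by_cases h : |v u| < r ^ k
    · rw [if_pos h]; exact trap_le_one _ _ _
    · rw [if_neg h, trap_zero (hlt k) (not_lt.1 h)]
  have hOm : Monotone O := by
    intro e e' hee
    refine intervalIntegral.integral_mono_on ht (lt_ind_intble hv _ _ _) (lt_ind_intble hv _ _ _) fun u _ => ?_
    by_cases h : |v u| < e
    · rw [if_pos h, if_pos (h.trans_le hee)]
    · rw [if_neg h]; split_ifs <;> simp
  have hev : ∀ᶠ k in atTop, ℓ - δ ≤ A k ∧ A k ≤ ℓ + δ := by
    have h1 := hA.eventually (Icc_mem_nhds (sub_lt_self ℓ hδ) (lt_add_of_pos_right ℓ hδ))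
    filter_upwards [h1] with k hk
    exact hk
  obtain ⟨k0, hk0⟩ := eventually_atTop.1 hev
  have hsm : ∀ᶠ ε in nhdsWithin (0:ℝ) (Ioi 0), ε ≤ r ^ (k0 + 2) :=
    nhdsWithin_le_nhds (Iic_mem_nhds (by positivity))
  filter_upwards [hsm, self_mem_nhdsWithin] with ε hε hε0
  have hε0 : 0 < ε := hε0
  obtain ⟨n, hn1, hn2⟩ := exists_nat_pow_near_of_lt_one hε0 (hε.trans (pow_le_one₀ hr0.le hr1.le)) hr0 hr1
  have hn : k0 + 2 < n + 1 := by
    by_contra hcon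
    push Not at hcon
    have := pow_le_pow_of_le_one hr0.le hr1.le hcon
    linarith
  obtain ⟨j, rfl⟩ : ∃ j, n = j + 1 := ⟨n - 1, by omega⟩
  have hj : k0 ≤ j := by omega
  have hocc : occq v t ε = (4 * ε)⁻¹ * O ε := rfl
  rw [hocc]
  constructor
  · have h1 := (hk0 (j + 2) (by omega)).1
    have h2 : O (r ^ (j + 2)) ≤ O ε := hOm (by exact hn1.le)
    have h3 := hhi (j + 2)
    have h4 := hc1 (j + 2)
    have h5 := hA0 (j + 2)
    rw [le_inv_mul_iff₀ (by positivity)]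
    calc 4 * ε * (r ^ 2 * (ℓ - δ)) ≤ 4 * ε * (r ^ 2 * A (j + 2)) := by gcongr
      _ ≤ 4 * r ^ (j + 1) * (r ^ 2 * A (j + 2)) := by gcongr
      _ = 2 * (2 * r ^ (j + 2 + 1)) * A (j + 2) := by ring
      _ ≤ 2 * c (j + 2) * A (j + 2) := by gcongr
      _ ≤ O ε := h3.trans h2
  · have h1 := (hk0 j hj).2
    have h2 : O ε ≤ O (r ^ (j + 1)) := hOm hn2
    have h3 := hlo j
    have h4 := hc2 j
    have h5 := hA0 j
    rw [inv_mul_le_iff₀ (by positivity)]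
    calc O ε ≤ 2 * c j * A j := h2.trans h3
      _ ≤ 2 * (2 * r ^ j) * A j := by gcongr
      _ = 4 * r ^ (j + 1 + 1) * ((r ^ 2)⁻¹ * A j) := by field_simp; ring
      _ ≤ 4 * ε * ((r ^ 2)⁻¹ * A j) := by gcongr
      _ ≤ _ := by gcongr

lemma squeeze_all {G : ℝ → ℝ} {ℓ : ℝ} (h : ∀ j : ℕ, ∀ᶠ ε in nhdsWithin 0 (Ioi 0),
    (1 - 1 / ((j:ℝ) + 2)) ^ 2 * (ℓ - 1 / ((j:ℝ) + 1)) ≤ G ε ∧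
      G ε ≤ ((1 - 1 / ((j:ℝ) + 2)) ^ 2)⁻¹ * (ℓ + 1 / ((j:ℝ) + 1))) :
    Tendsto G (nhdsWithin 0 (Ioi 0)) (nhds ℓ) := by
  have h1 : Tendsto (fun j : ℕ => 1 / ((j:ℝ) + 1)) atTop (nhds 0) := tendsto_one_div_add_atTop_nhds_zero_nat
  have h2 : Tendsto (fun j : ℕ => 1 / ((j:ℝ) + 2)) atTop (nhds 0) := by
    have := (tendsto_add_atTop_iff_nat (f := fun j : ℕ => 1 / ((j:ℝ) + 1)) 1).2 h1
    refine this.congr fun j => ?_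
    push_cast; congr 1; ring
  have h3 : Tendsto (fun j : ℕ => (1 - 1 / ((j:ℝ) + 2)) ^ 2) atTop (nhds 1) := by
    simpa using (h2.const_sub 1).pow 2
  have hlo : Tendsto (fun j : ℕ => (1 - 1 / ((j:ℝ) + 2)) ^ 2 * (ℓ - 1 / ((j:ℝ) + 1))) atTop (nhds ℓ) := by
    simpa using h3.mul (h1.const_sub ℓ)
  have hhi : Tendsto (fun j : ℕ => ((1 - 1 / ((j:ℝ) + 2)) ^ 2)⁻¹ * (ℓ + 1 / ((j:ℝ) + 1))) atTop (nhds ℓ) := by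
    simpa using (h3.inv₀ one_ne_zero).mul (h1.const_add ℓ)
  refine tendsto_order.2 ⟨fun a ha => ?_, fun a ha => ?_⟩
  · obtain ⟨j, hj⟩ := (hlo.eventually_const_lt ha).exists
    filter_upwards [h j] with ε hε
    exact hj.trans_le hε.1
  · obtain ⟨j, hj⟩ := (hhi.eventually_lt_const ha).exists
    filter_upwards [h j] with ε hε
    exact hε.2.trans_lt hj

lemma BB.loc_fixed {μ : Measure Ω} [IsProbabilityMeasure μ] {F : ℝ → MeasurableSpace Ω}
    {lam y : ℝ} {W Y N : ℝ → Ω → ℝ} (S : BB μ F lam y W Y) (hNm : ∀ t, Measurable (N t))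
    (hN : ∀ t, 0 ≤ t →
      TendstoInMeasure μ (fun n => rsum (fun s ω => if Y s ω ≤ 0 then (0:ℝ) else 1) W t n) atTop (N t))
    {t : ℝ} (ht : 0 < t) :
    ∀ᵐ ω ∂μ, Tendsto (occq (fun s => Y s ω) t) (nhdsWithin 0 (Ioi 0)) (nhds (locL lam y Y N t ω)) := by
  have hlam := S.hl
  have key : ∀ j : ℕ, ∀ᵐ ω ∂μ, ∀ᶠ ε in nhdsWithin 0 (Ioi 0),
      (1 - 1 / ((j:ℝ) + 2)) ^ 2 * (locL lam y Y N t ω - 1 / ((j:ℝ) + 1)) ≤ occq (fun s => Y s ω) t ε ∧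
      occq (fun s => Y s ω) t ε ≤ ((1 - 1 / ((j:ℝ) + 2)) ^ 2)⁻¹ * (locL lam y Y N t ω + 1 / ((j:ℝ) + 1)) := by
    intro j
    set r : ℝ := 1 - 1 / ((j:ℝ) + 2) with hr
    have hr0 : 0 < r := by
      rw [hr, sub_pos, div_lt_one (by positivity)]
      have : (0:ℝ) ≤ j := by positivity
      linarith
    have hr1 : r < 1 := by
      rw [hr]
      have : 0 < 1 / ((j:ℝ) + 2) := by positivity
      linarith
    have hlt : ∀ k : ℕ, r ^ (k + 1) < r ^ k := fun k => pow_lt_pow_right_of_lt_one₀ hr0 hr1 (Nat.lt_succ_self k)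
    choose c hc1 hc2 hc using fun k : ℕ => S.est hN ht (by positivity : 0 < r ^ (k + 1)) (hlt k)
      (pow_le_one₀ hr0.le hr1.le)
    set A : ℕ → Ω → ℝ := fun k ω => 1 / 2 * (∫ u in (0:ℝ)..t, trap (r ^ (k + 1)) (r ^ k) (Y u ω) / c k)
      - locL lam y Y N t ω with hA
    have mA : ∀ k, AEMeasurable (A k) μ := by
      intro k
      refine ((S.aem_int (φ := fun x => trap (r ^ (k + 1)) (r ^ k) x / c k)
        ((trap_cont _ _).measurable.div_const _) ht.le).const_mul _).sub ?_
      unfold locL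
      refine AEMeasurable.sub (AEMeasurable.add ?_ ((S.aem_int meas_H ht.le).const_mul _)) (hNm t).aemeasurable
      exact (((S.mY t).max measurable_const).sub measurable_const).aemeasurable
    have hlim : ∀ᵐ ω ∂μ, Tendsto (fun k => ENNReal.ofReal ((A k ω) ^ 2)) atTop (nhds 0) := by
      refine ae_tendsto_zero_of_tsum (fun k => ((mA k).pow_const 2).ennreal_ofReal) hc ?_
      have hs : Summable fun k : ℕ =>
          (108 + 3 * (lam ^ 2 * t + 1) * (1 + t * (1 + lam))) * Real.sqrt (r ^ k) := by
        have e : ∀ k : ℕ, Real.sqrt (r ^ k) = (Real.sqrt r) ^ k := by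
          intro k
          rw [← Real.sqrt_sq (by positivity : 0 ≤ (Real.sqrt r) ^ k), ← pow_mul, mul_comm, pow_mul,
            Real.sq_sqrt hr0.le]
        simp_rw [e]
        apply Summable.mul_left
        apply summable_geometric_of_lt_one (Real.sqrt_nonneg _)
        rw [Real.sqrt_lt' one_pos]; simpa using hr1
      exact hs.tsum_ofReal_ne_top
    filter_upwards [hlim, S.cY] with ω hω hcω
    have h1 := tendsto_of_ofReal_pow even_two two_ne_zero hω
    have h2 : Tendsto (fun k : ℕ => 1 / 2 * ∫ u in (0:ℝ)..t, trap (r ^ (k + 1)) (r ^ k) (Y u ω) / c k) atTop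
        (nhds (locL lam y Y N t ω)) := by
      have := h1.add_const (locL lam y Y N t ω)
      simpa [hA] using this
    exact squeeze_r hcω ht.le hr0 hr1 hc1 hc2 h2 (by positivity)
  filter_upwards [ae_all_iff.2 key] with ω hω
  exact squeeze_all hω


lemma no_jump {G : ℝ → ℝ → ℝ} (hG : ∀ ε, 0 < ε → ∀ s t, 0 ≤ s → s ≤ t → G s ε ≤ G t ε) {ℓ : ℝ → ℝ}
    (hℓ : ∀ n i : ℕ, Tendsto (G ((i:ℝ) / 2 ^ n)) (nhdsWithin 0 (Ioi 0)) (nhds (ℓ ((i:ℝ) / 2 ^ n))))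
    (hj : ∀ T : ℕ, ∀ η : ℝ, 0 < η → ∃ n : ℕ, ∀ i : ℕ, i < T * 2 ^ n →
      ℓ (((i + 1 : ℕ):ℝ) / 2 ^ n) - ℓ ((i:ℝ) / 2 ^ n) ≤ η) :
    ∃ L : ℝ → ℝ, (∀ t, 0 ≤ t → Tendsto (G t) (nhdsWithin 0 (Ioi 0)) (nhds (L t))) ∧
      ContinuousOn L (Ici 0) ∧ ∀ n i : ℕ, L ((i:ℝ) / 2 ^ n) = ℓ ((i:ℝ) / 2 ^ n) := by
  have hmono : ∀ n i n' i' : ℕ, (i:ℝ) / 2 ^ n ≤ (i':ℝ) / 2 ^ n' → ℓ ((i:ℝ) / 2 ^ n) ≤ ℓ ((i':ℝ) / 2 ^ n') := by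
    intro n i n' i' h
    refine le_of_tendsto_of_tendsto (hℓ n i) (hℓ n' i') ?_
    filter_upwards [self_mem_nhdsWithin] with ε hε
    exact hG ε hε _ _ (by positivity) h
  set D : ℝ → Set ℝ := fun t : ℝ => {x | ∃ n i : ℕ, (i:ℝ) / 2 ^ n ≤ t ∧ x = ℓ ((i:ℝ) / 2 ^ n)} with hD
  have hbdd : ∀ (t : ℝ) (n i : ℕ), t ≤ (i:ℝ) / 2 ^ n → ∀ x ∈ D t, x ≤ ℓ ((i:ℝ) / 2 ^ n) := by
    rintro t n i hti x ⟨n', i', h1, rfl⟩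
    exact hmono _ _ _ _ (h1.trans hti)
  have hfl : ∀ t : ℝ, 0 ≤ t → ∀ n : ℕ, ∃ i : ℕ, (i:ℝ) / 2 ^ n ≤ t ∧ t ≤ ((i + 1 : ℕ):ℝ) / 2 ^ n := by
    intro t ht n
    refine ⟨⌊t * 2 ^ n⌋₊, ?_, ?_⟩
    · rw [div_le_iff₀ (by positivity)]
      exact Nat.floor_le (by positivity)
    · rw [le_div_iff₀ (by positivity)]
      push_cast
      exact (Nat.lt_floor_add_one _).le
  have hbd : ∀ t, 0 ≤ t → BddAbove (D t) := by
    intro t ht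
    obtain ⟨i, _, hi⟩ := hfl t ht 0
    exact ⟨_, hbdd t 0 (i + 1) hi⟩
  set L : ℝ → ℝ := fun t => sSup (D t) with hL
  have hle : ∀ t, 0 ≤ t → ∀ n i : ℕ, (i:ℝ) / 2 ^ n ≤ t → ℓ ((i:ℝ) / 2 ^ n) ≤ L t := by
    intro t ht n i h
    exact le_csSup (hbd t ht) ⟨n, i, h, rfl⟩
  have hge : ∀ t, 0 ≤ t → ∀ n i : ℕ, t ≤ (i:ℝ) / 2 ^ n → L t ≤ ℓ ((i:ℝ) / 2 ^ n) := by
    intro t ht n i h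
    exact csSup_le ⟨ℓ (((0:ℕ):ℝ) / 2 ^ 0), 0, 0, by simpa using ht, rfl⟩ (hbdd t n i h)
  have hLm : ∀ s t, 0 ≤ s → s ≤ t → L s ≤ L t := by
    intro s t hs hst
    refine csSup_le_csSup (hbd t (hs.trans hst)) ⟨ℓ (((0:ℕ):ℝ) / 2 ^ 0), 0, 0, by simpa using hs, rfl⟩ ?_
    rintro x ⟨n, i, h, rfl⟩
    exact ⟨n, i, h.trans hst, rfl⟩
  have hiT : ∀ (T n i : ℕ), (i:ℝ) / 2 ^ n < T → i < T * 2 ^ n := by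
    intro T n i h
    rw [div_lt_iff₀ (by positivity)] at h
    exact_mod_cast h
  refine ⟨L, ?_, ?_, ?_⟩
  · intro t ht
    rw [Metric.tendsto_nhds]
    intro η hη
    obtain ⟨T, hT⟩ := exists_nat_gt t
    obtain ⟨n, hn⟩ := hj T (η / 3) (by positivity)
    obtain ⟨i, h1, h2⟩ := hfl t ht n
    have h3 := hn i (hiT T n i (h1.trans_lt hT))
    have e1 := (Metric.tendsto_nhds.1 (hℓ n i)) (η / 3) (by positivity)
    have e2 := (Metric.tendsto_nhds.1 (hℓ n (i + 1))) (η / 3) (by positivity)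
    filter_upwards [e1, e2, self_mem_nhdsWithin] with ε d1 d2 hε
    have g1 := hG ε hε _ t (by positivity) h1
    have g2 := hG ε hε t _ ht h2
    have l1 := hle t ht n i h1
    have l2 := hge t ht n (i + 1) h2
    rw [Real.dist_eq, abs_lt] at *
    constructor <;> linarith [d1.1, d1.2, d2.1, d2.2]
  · have hcl : ∀ (T n : ℕ) (η : ℝ), (∀ i : ℕ, i < T * 2 ^ n →
        ℓ (((i + 1 : ℕ):ℝ) / 2 ^ n) - ℓ ((i:ℝ) / 2 ^ n) ≤ η) → ∀ s t : ℝ, 0 ≤ s → s ≤ t → t ≤ s + 1 / 2 ^ n →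
        s + 1 < T → L t - L s ≤ 2 * η := by
      intro T n η hn s t hs hst hts hsT
      obtain ⟨i, h1, h2⟩ := hfl s hs n
      have h3 := hn i (hiT T n i (by linarith))
      have hp : (1:ℝ) / 2 ^ n ≤ 1 := by
        rw [div_le_one (by positivity)]; exact one_le_pow₀ (by norm_num)
      have h4 := hn (i + 1) (hiT T n (i + 1) (by
        push_cast
        rw [add_div]; linarith))
      have h5 := hge t (hs.trans hst) n (i + 1 + 1) (by
        push_cast at h2 ⊢
        rw [add_div]; linarith)
      have h6 := hle s hs n i h1
      linarith
    intro t ht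
    have ht : 0 ≤ t := ht
    rw [Metric.continuousWithinAt_iff]
    intro η hη
    obtain ⟨T, hT⟩ := exists_nat_gt (t + 2)
    obtain ⟨n, hn⟩ := hj T (η / 3) (by positivity)
    refine ⟨1 / 2 ^ n, by positivity, ?_⟩
    intro s hs hst
    have hs : 0 ≤ s := hs
    have hp : (1:ℝ) / 2 ^ n ≤ 1 := by
      rw [div_le_one (by positivity)]; exact one_le_pow₀ (by norm_num)
    rw [Real.dist_eq, abs_lt] at hst ⊢
    rcases le_total s t with h | h
    · have h1 := hcl T n _ hn s t hs h (by linarith) (by linarith)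
      have h2 := hLm s t hs h
      constructor <;> linarith
    · have h1 := hcl T n _ hn t s ht h (by linarith) (by linarith)
      have h2 := hLm t s ht h
      constructor <;> linarith
  · intro n i
    exact le_antisymm (hge _ (by positivity) n i le_rfl) (hle _ (by positivity) n i le_rfl)

lemma BB.N_jump {μ : Measure Ω} [IsProbabilityMeasure μ] {F : ℝ → MeasurableSpace Ω}
    {lam y : ℝ} {W Y N : ℝ → Ω → ℝ} (S : BB μ F lam y W Y) (hNm : ∀ t, Measurable (N t))
    (hN : ∀ t, 0 ≤ t →
      TendstoInMeasure μ (fun n => rsum (fun s ω => if Y s ω ≤ 0 then (0:ℝ) else 1) W t n) atTop (N t)) :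
    ∀ᵐ ω ∂μ, ∀ T : ℕ, ∀ η : ℝ, 0 < η → ∀ᶠ n : ℕ in atTop, ∀ i : ℕ, i < T * 2 ^ n →
      |N (((i + 1 : ℕ):ℝ) / 2 ^ n) ω - N ((i:ℝ) / 2 ^ n) ω| ≤ η := by
  rw [ae_all_iff]
  intro T
  set G : ℕ → Ω → ENNReal := fun n ω => ∑ i ∈ Finset.range (T * 2 ^ n),
    ENNReal.ofReal ((N (((i + 1 : ℕ):ℝ) / 2 ^ n) ω - N ((i:ℝ) / 2 ^ n) ω) ^ 4) with hG
  have mG : ∀ n i : ℕ, Measurable fun ω =>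
      ENNReal.ofReal ((N (((i + 1 : ℕ):ℝ) / 2 ^ n) ω - N ((i:ℝ) / 2 ^ n) ω) ^ 4) := by
    intro n i
    exact (((hNm _).sub (hNm _)).pow_const 4).ennreal_ofReal
  have h1 : ∀ᵐ ω ∂μ, Tendsto (fun n => G n ω) atTop (nhds 0) := by
    have h0 : 0 ≤ m4 := m4_nonneg
    refine ae_tendsto_zero_of_tsum
      (C := fun n : ℕ => ENNReal.ofReal (T * (4 + 3 * m4) * (1 / 2) ^ n))
      (fun n => (Finset.measurable_fun_sum _ fun i _ => mG n i).aemeasurable) (fun n => ?_) ?_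
    · rw [hG, lintegral_finsetSum _ fun i _ => mG n i]
      calc _ ≤ ∑ i ∈ Finset.range (T * 2 ^ n), ENNReal.ofReal ((4 + 3 * m4) * (1 / 2 ^ n) ^ 2) := by
            refine Finset.sum_le_sum fun i _ => ?_
            refine (S.N_four hN (by positivity) (by gcongr; simp)).trans (le_of_eq ?_)
            congr 3
            push_cast; ring
        _ = _ := by
            rw [Finset.sum_const, Finset.card_range, nsmul_eq_mul, ← ENNReal.ofReal_natCast,
              ← ENNReal.ofReal_mul (by positivity)]
            congr 1
            push_cast
            rw [one_div_pow, one_div_pow]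
            field_simp
    · refine Summable.tsum_ofReal_ne_top ?_
      exact (summable_geometric_of_lt_one (by norm_num) (by norm_num)).mul_left _
  filter_upwards [h1] with ω hω η hη
  have h2 := hω.eventually_le_const (show (0:ENNReal) < ENNReal.ofReal (η ^ 4) by
    rw [ENNReal.ofReal_pos]; positivity)
  filter_upwards [h2] with n hn i hi
  have h3 : ENNReal.ofReal ((N (((i + 1 : ℕ):ℝ) / 2 ^ n) ω - N ((i:ℝ) / 2 ^ n) ω) ^ 4) ≤ ENNReal.ofReal (η ^ 4) :=
    (Finset.single_le_sum (f := fun i : ℕ => ENNReal.ofReal ((N (((i + 1 : ℕ):ℝ) / 2 ^ n) ω - N ((i:ℝ) / 2 ^ n) ω) ^ 4))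
      (fun _ _ => zero_le) (Finset.mem_range.2 hi)).trans hn
  rw [ENNReal.ofReal_le_ofReal_iff (by positivity)] at h3
  rw [← Even.pow_abs (by decide : Even 4)] at h3
  exact le_of_pow_le_pow_left₀ (by norm_num) hη.le h3

lemma BB.exists_L {μ : Measure Ω} [IsProbabilityMeasure μ] {F : ℝ → MeasurableSpace Ω}
    {lam y : ℝ} {W Y N : ℝ → Ω → ℝ} (S : BB μ F lam y W Y) (hNm : ∀ t, Measurable (N t))
    (hN : ∀ t, 0 ≤ t →
      TendstoInMeasure μ (fun n => rsum (fun s ω => if Y s ω ≤ 0 then (0:ℝ) else 1) W t n) atTop (N t)) :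
    ∃ L : ℝ → Ω → ℝ, IsLocalTime μ Y L ∧ ∀ᵐ ω ∂μ, ContinuousOn (fun t => L t ω) (Ici 0) ∧
      ∀ n i : ℕ, L ((i:ℝ) / 2 ^ n) ω = locL lam y Y N ((i:ℝ) / 2 ^ n) ω := by
  have hlam := S.hl
  have hN0 : ∀ᵐ ω ∂μ, N 0 ω = 0 := by
    have h1 : TendstoInMeasure μ (fun n => rsum (fun s ω => if Y s ω ≤ 0 then (0:ℝ) else 1) W 0 n) atTop
        (fun _ => 0) := by
      refine TIM.of_eq (TIM.const (fun _ => 0)) (fun n ω => ?_) (Eventually.of_forall fun _ => rfl)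
      unfold rsum; simp
    exact tendstoInMeasure_ae_unique (hN 0 le_rfl) h1
  have hd : ∀ᵐ ω ∂μ, ∀ n i : ℕ, Tendsto (occq (fun s => Y s ω) ((i:ℝ) / 2 ^ n)) (nhdsWithin 0 (Ioi 0))
      (nhds (locL lam y Y N ((i:ℝ) / 2 ^ n) ω)) := by
    rw [ae_all_iff]; intro n
    rw [ae_all_iff]; intro i
    rcases Nat.eq_zero_or_pos i with rfl | hi
    · filter_upwards [hN0, S.eq, S.hW.init] with ω h1 he h0
      have hy0 : Y 0 ω = y := by rw [he 0 le_rfl, h0]; simp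
      have : locL lam y Y N (((0:ℕ):ℝ) / 2 ^ n) ω = 0 := by
        unfold locL; simp [hy0, h1]
      rw [this]
      refine tendsto_const_nhds.congr fun ε => ?_
      unfold occq; simp
    · exact S.loc_fixed hNm hN (by positivity)
  have key : ∀ᵐ ω ∂μ, ∃ L : ℝ → ℝ, (∀ t, 0 ≤ t → Tendsto (occq (fun s => Y s ω) t) (nhdsWithin 0 (Ioi 0)) (nhds (L t))) ∧
      ContinuousOn L (Ici 0) ∧ ∀ n i : ℕ, L ((i:ℝ) / 2 ^ n) = locL lam y Y N ((i:ℝ) / 2 ^ n) ω := by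
    filter_upwards [hd, S.N_jump hNm hN, S.cY] with ω h1 h2 hc
    refine no_jump (G := occq (fun s => Y s ω)) (ℓ := fun t => locL lam y Y N t ω) ?_ h1 ?_
    · intro ε hε s t hs hst
      unfold occq
      have h3 := intervalIntegral.integral_add_adjacent_intervals (lt_ind_intble hc ε 0 s) (lt_ind_intble hc ε s t)
      have h4 : 0 ≤ ∫ u in s..t, if |Y u ω| < ε then (1:ℝ) else 0 :=
        intervalIntegral.integral_nonneg hst fun u _ => by split_ifs <;> simp
      have : 0 < (4 * ε)⁻¹ := by positivity
      gcongr
      linarith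
    · intro T η hη
      have hu : UniformContinuousOn (fun t => max (Y t ω) 0) (Icc 0 (T:ℝ)) :=
        isCompact_Icc.uniformContinuousOn_of_continuous (hc.max continuous_const).continuousOn
      obtain ⟨δ, hδ, hδ'⟩ := Metric.uniformContinuousOn_iff.1 hu (η / 3) (by positivity)
      have hp : Tendsto (fun n : ℕ => (1:ℝ) / 2 ^ n) atTop (nhds 0) := by
        have := tendsto_pow_atTop_nhds_zero_of_lt_one (r := (1/2 : ℝ)) (by norm_num) (by norm_num)
        simpa [div_eq_mul_inv] using this
      have hp2 : Tendsto (fun n : ℕ => lam * (1 / 2 ^ n)) atTop (nhds 0) := by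
        simpa using hp.const_mul lam
      obtain ⟨n, hn1, hn2, hn3⟩ := ((h2 T (η / 3) (by positivity)).and
        ((hp.eventually_lt_const hδ).and (hp2.eventually_lt_const (show 0 < η / 3 by positivity)))).exists
      refine ⟨n, fun i hi => ?_⟩
      have q1 := abs_le.1 (hn1 i hi)
      have hd0 : ((i + 1 : ℕ):ℝ) / 2 ^ n - (i:ℝ) / 2 ^ n = 1 / 2 ^ n := by push_cast; ring
      have hmem : ∀ j : ℕ, j ≤ T * 2 ^ n → (j:ℝ) / 2 ^ n ∈ Icc 0 (T:ℝ) := by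
        intro j hj
        refine ⟨by positivity, ?_⟩
        rw [div_le_iff₀ (by positivity)]
        exact_mod_cast hj
      have q2 := hδ' _ (hmem (i + 1) hi) _ (hmem i hi.le) (by
        rw [Real.dist_eq, hd0, abs_of_pos (by positivity)]; exact hn2)
      rw [Real.dist_eq, abs_lt] at q2
      have iH : ∀ a b : ℝ, IntervalIntegrable (fun u => if Y u ω ≤ 0 then (0:ℝ) else 1) volume a b := fun a b =>
        bdd_intble (g := fun u => if Y u ω ≤ 0 then (0:ℝ) else 1) (meas_H.comp hc.measurable) (C := 1)
          (fun u => by beta_reduce; split_ifs <;> simp) a b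
      have q3 := intervalIntegral.integral_add_adjacent_intervals (iH 0 ((i:ℝ) / 2 ^ n))
        (iH ((i:ℝ) / 2 ^ n) (((i + 1 : ℕ):ℝ) / 2 ^ n))
      have q4 : ∫ u in ((i:ℝ) / 2 ^ n)..(((i + 1 : ℕ):ℝ) / 2 ^ n), (if Y u ω ≤ 0 then (0:ℝ) else 1) ≤ 1 / 2 ^ n := by
        have : ∫ u in ((i:ℝ) / 2 ^ n)..(((i + 1 : ℕ):ℝ) / 2 ^ n), (if Y u ω ≤ 0 then (0:ℝ) else 1)
            ≤ ∫ u in ((i:ℝ) / 2 ^ n)..(((i + 1 : ℕ):ℝ) / 2 ^ n), (1:ℝ) := by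
          refine intervalIntegral.integral_mono_on (by gcongr; simp) (iH _ _) (by simp) fun u _ => ?_
          split_ifs <;> simp
        rw [intervalIntegral.integral_const, hd0] at this
        simpa using this
      have q5 := mul_le_mul_of_nonneg_left q4 hlam
      unfold locL
      rw [← q3, mul_add]
      linarith [q1.1, q2.2]
  classical
  refine ⟨fun t ω => if h : ∃ L : ℝ → ℝ, (∀ t, 0 ≤ t →
      Tendsto (occq (fun s => Y s ω) t) (nhdsWithin 0 (Ioi 0)) (nhds (L t))) ∧
      ContinuousOn L (Ici 0) ∧ ∀ n i : ℕ, L ((i:ℝ) / 2 ^ n) = locL lam y Y N ((i:ℝ) / 2 ^ n) ω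
      then h.choose t else 0, ?_, ?_⟩
  · unfold IsLocalTime
    filter_upwards [key] with ω h t ht
    rw [dif_pos h]
    exact h.choose_spec.1 t ht
  · filter_upwards [key] with ω h
    simp only [dif_pos h]
    exact h.choose_spec.2


/-- continuous approximations of `psgn` -/
def apsgn (k : ℕ) (y : ℝ) : ℝ := 2 * min 1 ((k:ℝ) * max y 0) - 1

lemma apsgn_cont (k : ℕ) : Continuous (apsgn k) := by unfold apsgn; fun_prop

lemma apsgn_abs (k : ℕ) (y : ℝ) : |apsgn k y| ≤ 1 := by
  unfold apsgn
  have h1 : 0 ≤ min 1 ((k:ℝ) * max y 0) := le_min (by norm_num) (by positivity)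
  have h2 : min 1 ((k:ℝ) * max y 0) ≤ 1 := min_le_left _ _
  rw [abs_le]
  constructor <;> linarith

lemma apsgn_tendsto (y : ℝ) : Tendsto (fun k => apsgn k y) atTop (nhds (psgn y)) := by
  unfold psgn
  by_cases hy : 0 < y
  · rw [if_pos hy]
    refine tendsto_const_nhds.congr' ?_
    obtain ⟨K, hK⟩ := exists_nat_gt (1 / y)
    filter_upwards [eventually_ge_atTop K] with k hk
    unfold apsgn
    have h1 : 1 ≤ (k:ℝ) * max y 0 := by
      rw [max_eq_left hy.le]
      have h2 : (K:ℝ) ≤ k := by exact_mod_cast hk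
      have h3 : 1 / y ≤ k := hK.le.trans h2
      rwa [div_le_iff₀ hy] at h3
    rw [min_eq_left h1]; norm_num
  · rw [if_neg hy]
    refine tendsto_const_nhds.congr fun k => ?_
    unfold apsgn
    rw [max_eq_right (not_lt.1 hy)]; norm_num

lemma exists_D {μ : Measure Ω} {F : ℝ → MeasurableSpace Ω} (hmono : Monotone F) {Y : ℝ → Ω → ℝ}
    (adY : ∀ u, 0 ≤ u → Measurable[F u] (Y u)) (cY : ∀ᵐ ω ∂μ, Continuous fun t => Y t ω) :
    ∃ D : ℝ → Ω → ℝ, (∀ t, 0 ≤ t → Measurable[F t] (D t)) ∧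
      ∀ᵐ ω ∂μ, ∀ t, 0 ≤ t → D t ω = ∫ s in (0:ℝ)..t, psgn (Y s ω) := by
  refine ⟨fun t ω => limsup (fun k : ℕ => limsup (fun n : ℕ => ∑ i ∈ Finset.range (2 ^ n),
    apsgn k (Y (t * i / 2 ^ n) ω) * (t / 2 ^ n)) atTop) atTop, ?_, ?_⟩
  · intro t ht
    refine Measurable.limsup (mδ := F t) fun k => ?_
    refine Measurable.limsup (mδ := F t) fun n => ?_
    refine Finset.measurable_fun_sum (m := F t) _ fun i hi => ?_
    have hi' : (i:ℝ) ≤ 2 ^ n := by exact_mod_cast (Finset.mem_range.1 hi).le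
    have h1 : t * i / 2 ^ n ≤ t := by
      rw [div_le_iff₀ (by positivity)]
      exact mul_le_mul_of_nonneg_left hi' ht
    have h2 : Measurable[F t] (Y (t * i / 2 ^ n)) :=
      (adY _ (by positivity)).mono (hmono h1) le_rfl
    exact ((apsgn_cont k).measurable.comp h2).mul_const _
  · filter_upwards [cY] with ω hω t ht
    rcases ht.eq_or_lt with rfl | ht
    · simp
    have h1 : ∀ k, limsup (fun n : ℕ => ∑ i ∈ Finset.range (2 ^ n),
        apsgn k (Y (t * i / 2 ^ n) ω) * (t / 2 ^ n)) atTop = ∫ s in (0:ℝ)..t, apsgn k (Y s ω) := by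
      intro k
      have h2 := riem ht (v := fun s => apsgn k (Y s ω)) (ψ := fun _ => 1) ((apsgn_cont k).comp hω)
        (C := 1) (fun u => apsgn_abs k _) measurable_const (by simp)
      refine Tendsto.limsup_eq ?_
      simp only [intervalIntegral.integral_const, smul_eq_mul, mul_one] at h2
      refine h2.congr fun n => Finset.sum_congr rfl fun i _ => ?_
      ring
    simp only [h1]
    refine Tendsto.limsup_eq ?_
    refine intervalIntegral.tendsto_integral_filter_of_dominated_convergence (fun _ => (1:ℝ)) ?_ ?_ ?_ ?_
    · exact Eventually.of_forall fun k => ((apsgn_cont k).comp hω).aestronglyMeasurable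
    · exact Eventually.of_forall fun k => ae_of_all _ fun u _ => by
        rw [Real.norm_eq_abs]; exact apsgn_abs _ _
    · exact intervalIntegrable_const
    · exact ae_of_all _ fun u _ => apsgn_tendsto _

lemma int_two {v : ℝ → ℝ} (hv : Continuous v) (p q t : ℝ) :
    ∫ u in (0:ℝ)..t, (if v u ≤ 0 then p else q) =
      p * t + (q - p) * ∫ u in (0:ℝ)..t, (if v u ≤ 0 then (0:ℝ) else 1) := by
  have h1 : ∀ u, (if v u ≤ 0 then p else q) = p + (q - p) * (if v u ≤ 0 then (0:ℝ) else 1) := by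
    intro u; split_ifs <;> ring
  have h2 : IntervalIntegrable (fun u => if v u ≤ 0 then (0:ℝ) else 1) volume 0 t :=
    bdd_intble (g := fun u => if v u ≤ 0 then (0:ℝ) else 1) (meas_H.comp hv.measurable) (C := 1)
      (fun u => by split_ifs <;> simp) 0 t
  simp only [h1]
  rw [intervalIntegral.integral_add intervalIntegrable_const (h2.const_mul _),
    intervalIntegral.integral_const, intervalIntegral.integral_const_mul]
  simp only [smul_eq_mul, sub_zero]; ring

lemma rsum_one (B : ℝ → Ω → ℝ) (t : ℝ) (n : ℕ) (ω : Ω) :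
    rsum (fun _ _ => 1) B t n ω = B t ω - B 0 ω := by
  unfold rsum
  have h := Finset.sum_range_sub (fun i : ℕ => B (t * i / 2 ^ n) ω) (2 ^ n)
  simp only [one_mul]
  push_cast at h
  rw [h]
  congr 2
  · field_simp
  · simp

lemma BB.rep_N {μ : Measure Ω} [IsProbabilityMeasure μ] {F : ℝ → MeasurableSpace Ω} {ρ σ lam y : ℝ}
    {B₁ B₂ Y I₁ I₂ W Q N : ℝ → Ω → ℝ} (S : BB μ F lam y W Y) (T : Sys μ F ρ σ B₁ B₂ Y I₁ I₂ W Q)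
    (hN : ∀ t, 0 ≤ t →
      TendstoInMeasure μ (fun n => rsum (fun s ω => if Y s ω ≤ 0 then (0:ℝ) else 1) W t n) atTop (N t))
    {t : ℝ} (ht : 0 ≤ t) :
    ∀ᵐ ω ∂μ, (ρ ^ 2 - σ ^ 2) * N t ω =
      (ρ + σ) * (ρ * I₁ t ω + σ * I₂ t ω - ρ * σ * (B₁ t ω + B₂ t ω)) := by
  obtain ⟨hB1, hB2, _⟩ := T.hB
  have K : ∀ {B I : ℝ → Ω → ℝ} (hB : IsBM μ F B) (p q : ℝ)
      (hI : ∀ t, 0 ≤ t → TendstoInMeasure μ (fun n => rsum (fun s ω => if Y s ω ≤ 0 then p else q) B t n)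
      atTop (I t)), TendstoInMeasure μ (fun n ω => rsum (fun s ω => if Y s ω ≤ 0 then 0 else 1) I t n ω -
      rsum (fun s ω => if Y s ω ≤ 0 then 0 else q) B t n ω) atTop (fun _ => 0) := by
    intro B I hB p q hI
    rcases ht.eq_or_lt with h0 | h0
    · refine TIM.of_eq (TIM.const (fun _ => (0:ℝ))) ?_ (Eventually.of_forall fun _ => rfl)
      intro n ω
      simp [rsum, ← h0]
    · exact S.lemK hB p q hI h0
  have E1 := K hB1 σ ρ T.hI1
  have E2 := K hB2 ρ σ T.hI2
  have G := TIM.add (TIM.const_mul (TIM.sub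
      (TIM.const_mul (TIM.sub (T.hI1 t ht) (TIM.const (fun ω => σ * (B₁ t ω - B₁ 0 ω)))) ρ)
      (TIM.const_mul (TIM.sub (TIM.const (fun ω => ρ * (B₂ t ω - B₂ 0 ω))) (T.hI2 t ht)) σ)) (ρ + σ))
    (TIM.const_mul (TIM.sub E1 E2) (ρ ^ 2 - σ ^ 2))
  have Nn := TIM.const_mul (hN t ht) (ρ ^ 2 - σ ^ 2)
  have Wg : ∀ᵐ ω ∂μ, ∀ n i : ℕ, W (t * i / 2 ^ n) ω = I₁ (t * i / 2 ^ n) ω - I₂ (t * i / 2 ^ n) ω := by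
    rw [ae_all_iff]; intro n
    rw [ae_all_iff]; intro i
    exact T.hW _ (by positivity)
  have G' := G.congr (f' := fun n ω => (ρ ^ 2 - σ ^ 2) *
      rsum (fun s ω => if Y s ω ≤ 0 then (0:ℝ) else 1) W t n ω) (g' := _) (fun n => by
    filter_upwards [Wg] with ω hω
    rw [← rsum_one B₁ t n ω, ← rsum_one B₂ t n ω]
    unfold rsum
    simp only [Finset.mul_sum, ← Finset.sum_sub_distrib, ← Finset.sum_add_distrib]
    refine Finset.sum_congr rfl fun i _ => ?_
    have e1 := hω n i
    have e2 := hω n (i + 1)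
    push_cast at e2
    rw [e1, e2]
    by_cases hY : Y (t * i / 2 ^ n) ω ≤ 0
    · simp only [if_pos hY]; ring
    · simp only [if_neg hY]; ring) (Eventually.of_forall fun _ => rfl)
  have U := tendstoInMeasure_ae_unique Nn G'
  filter_upwards [U, hB1.init, hB2.init] with ω hω h1 h2
  rw [hω, h1, h2]; ring

lemma eq_of_dyadic {f : ℝ → ℝ} (hf : ContinuousOn f (Ici 0)) (h : ∀ n i : ℕ, f ((i:ℝ) / 2 ^ n) = 0)
    {t : ℝ} (ht : 0 ≤ t) : f t = 0 := by
  have h1 : Tendsto (fun n : ℕ => ((⌊t * 2 ^ n⌋₊ : ℕ) : ℝ) / 2 ^ n) atTop (nhds t) :=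
    (tendsto_nat_floor_mul_div_atTop ht).comp (tendsto_pow_atTop_atTop_of_one_lt (by norm_num : (1:ℝ) < 2))
  have h2 : Tendsto (fun n : ℕ => ((⌊t * 2 ^ n⌋₊ : ℕ) : ℝ) / 2 ^ n) atTop (nhdsWithin t (Ici 0)) :=
    tendsto_nhdsWithin_iff.2 ⟨h1, Eventually.of_forall fun n => by
      simp only [mem_Ici]; positivity⟩
  have h3 := (hf t ht).tendsto.comp h2
  have h4 : Tendsto (fun _ : ℕ => (0:ℝ)) atTop (nhds (f t)) := h3.congr fun n => by
    simp [h]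
  exact tendsto_nhds_unique h4 tendsto_const_nhds

/-- skew representation, (2.23)-(2.24) of the paper. Any weak
solution of the system (1.1)-(1.2) can be written, with `μ₀ = gρ² − hσ²`,
`γ = ρ² − σ²`, `λ = g + h` and `y = x₁ − x₂`, as
`X₁(t) = x₁ + μ₀ t + ρ²(Y⁺(t) − y⁺) − σ²(Y⁻(t) − y⁻) − γ L^Y(t) + ρσ Q(t)`,
`X₂(t) = x₂ + μ₀ t − σ²(Y⁺(t) − y⁺) + ρ²(Y⁻(t) − y⁻) − γ L^Y(t) + ρσ Q(t)`,
where `Y` is the pathwise unique strong solution of the bang-bang equation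
`Y(t) = y − λ ∫₀ᵗ sgn(Y(s)) ds + W(t)` driven by a standard Brownian motion `W`,
`L^Y` is the local time of `Y` at the origin, and `Q` is a standard Brownian motion
independent of `W` (hence of `Y`). -/
theorem skew_representation
    (g h ρ σ : ℝ) (hg : 0 ≤ g) (hh : 0 ≤ h) (hρ : 0 ≤ ρ) (hσ : 0 ≤ σ)
    (hnorm : ρ ^ 2 + σ ^ 2 = 1) (hgh : 0 < g + h) (x₁ x₂ : ℝ)
    {Ω : Type*} [mΩ : MeasurableSpace Ω] (μ : Measure Ω) [IsProbabilityMeasure μ]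
    (F : ℝ → MeasurableSpace Ω) (B₁ B₂ X₁ X₂ : ℝ → Ω → ℝ)
    (hBM : IsPlanarBM μ F B₁ B₂)
    (hsol : Solves11 μ F g h ρ σ x₁ x₂ B₁ B₂ X₁ X₂) :
    ∃ W Q Y L : ℝ → Ω → ℝ,
      IsBM μ F W ∧ IsBM μ F Q ∧
      IndepFun (fun ω => (fun t => Q t ω)) (fun ω => (fun t => W t ω)) μ ∧
      IndepFun (fun ω => (fun t => Q t ω)) (fun ω => (fun t => Y t ω)) μ ∧
      (∀ᵐ ω ∂μ, Continuous fun t => Y t ω) ∧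
      (∀ᵐ ω ∂μ, ∀ t : ℝ, 0 ≤ t →
        Y t ω = (x₁ - x₂) - (g + h) * (∫ s in (0:ℝ)..t, psgn (Y s ω)) + W t ω) ∧
      (∀ t : ℝ, 0 ≤ t → natFilt μ Y t ≤ natFilt μ W t) ∧
      IsLocalTime μ Y L ∧
      (∀ᵐ ω ∂μ, ∀ t : ℝ, 0 ≤ t →
        X₁ t ω = x₁ + (g * ρ ^ 2 - h * σ ^ 2) * t
            + ρ ^ 2 * (max (Y t ω) 0 - max (x₁ - x₂) 0)
            - σ ^ 2 * (max (-Y t ω) 0 - max (-(x₁ - x₂)) 0)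
            - (ρ ^ 2 - σ ^ 2) * L t ω + ρ * σ * Q t ω ∧
        X₂ t ω = x₂ + (g * ρ ^ 2 - h * σ ^ 2) * t
            - σ ^ 2 * (max (Y t ω) 0 - max (x₁ - x₂) 0)
            + ρ ^ 2 * (max (-Y t ω) 0 - max (-(x₁ - x₂)) 0)
            - (ρ ^ 2 - σ ^ 2) * L t ω + ρ * σ * Q t ω) := by

  obtain ⟨hB1, hB2, hB12⟩ := id hBM
  obtain ⟨adX, cX, I₁, I₂, ⟨hI10, hI1⟩, ⟨hI20, hI2⟩, hX⟩ := hsol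
  have hmono := hB1.mono
  have adX1 : ∀ t, 0 ≤ t → Measurable[F t] (X₁ t) := fun t ht =>
    (@measurable_fst ℝ ℝ _ _).comp (measurable_iff_comap_le.2 (adX t ht))
  have adX2 : ∀ t, 0 ≤ t → Measurable[F t] (X₂ t) := fun t ht =>
    (@measurable_snd ℝ ℝ _ _).comp (measurable_iff_comap_le.2 (adX t ht))
  set Y : ℝ → Ω → ℝ := fun t ω => X₁ (max t 0) ω - X₂ (max t 0) ω with hY
  have hYp : ∀ t, 0 ≤ t → ∀ ω, Y t ω = X₁ t ω - X₂ t ω := by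
    intro t ht ω; simp only [hY, max_eq_left ht]
  have hYiff : ∀ t, 0 ≤ t → ∀ ω, (X₁ t ω ≤ X₂ t ω ↔ Y t ω ≤ 0) := by
    intro t ht ω; rw [hYp t ht, sub_nonpos]
  have adY : ∀ u, 0 ≤ u → Measurable[F u] (Y u) := by
    intro u hu
    have e : Y u = fun ω => X₁ u ω - X₂ u ω := funext (hYp u hu)
    rw [e]
    exact (adX1 u hu).sub (adX2 u hu)
  have hclip : ∀ t, Y t = Y (max t 0) := by
    intro t; funext ω; simp only [hY, max_eq_left (le_max_right t (0:ℝ))]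
  have mY : ∀ u, Measurable (Y u) := by
    intro u
    rw [hclip u]
    exact (adY _ (le_max_right u 0)).mono (hB1.le _) le_rfl
  have cm : Continuous fun t : ℝ => max t 0 := continuous_id.max continuous_const
  have cY : ∀ᵐ ω ∂μ, Continuous fun t => Y t ω := by
    filter_upwards [cX] with ω hω
    exact (hω.1.comp cm).sub (hω.2.comp cm)
  obtain ⟨D, adD, hD⟩ := exists_D (μ := μ) hmono adY cY
  set W : ℝ → Ω → ℝ := fun t ω => Y t ω - (x₁ - x₂) + (g + h) * D (max t 0) ω with hWd
  set Q0 : ℝ → Ω → ℝ := fun t ω => (ρ + σ) * (B₁ t ω + B₂ t ω) -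
    (X₁ t ω + X₂ t ω - x₁ - x₂ - (g - h) * t) with hQ0
  set Q : ℝ → Ω → ℝ := fun t ω => Q0 (max t 0) ω with hQd
  -- drift identities
  have hdr : ∀ᵐ ω ∂μ, ∀ t, 0 ≤ t →
      X₁ t ω = x₁ + (g * t + (-h - g) * ∫ u in (0:ℝ)..t, (if Y u ω ≤ 0 then (0:ℝ) else 1)) + I₁ t ω ∧
      X₂ t ω = x₂ + (-h * t + (g - -h) * ∫ u in (0:ℝ)..t, (if Y u ω ≤ 0 then (0:ℝ) else 1)) + I₂ t ω ∧
      ∫ s in (0:ℝ)..t, psgn (Y s ω) =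
        -1 * t + (1 - -1) * ∫ u in (0:ℝ)..t, (if Y u ω ≤ 0 then (0:ℝ) else 1) := by
    filter_upwards [hX, cY] with ω hω hc t ht
    obtain ⟨e1, e2⟩ := hω t ht
    have hpt : ∀ s ∈ uIcc 0 t, 0 ≤ s := fun s hs => by
      rw [uIcc_of_le ht] at hs; exact hs.1
    refine ⟨?_, ?_, ?_⟩
    · rw [e1, ← int_two hc g (-h) t]
      congr 2
      refine intervalIntegral.integral_congr fun s hs => ?_
      simp only [hYiff s (hpt s hs) ω]
    · rw [e2, ← int_two hc (-h) g t]
      congr 2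
      refine intervalIntegral.integral_congr fun s hs => ?_
      simp only [hYiff s (hpt s hs) ω]
    · rw [← int_two hc (-1) 1 t]
      refine intervalIntegral.integral_congr fun s hs => ?_
      simp only [psgn]
      by_cases h0 : Y s ω ≤ 0
      · rw [if_pos h0, if_neg (not_lt.2 h0)]
      · rw [if_neg h0, if_pos (not_le.1 h0)]
  have T : Sys μ F ρ σ B₁ B₂ Y I₁ I₂ W Q := by
    refine ⟨hnorm, hBM, adY, mY, cY, ?_, ?_, ?_, ?_, ?_, ?_, ?_, ?_⟩
    · intro t ht
      refine TIM.of_eq (hI1 t ht) (fun n ω => ?_) (Eventually.of_forall fun _ => rfl)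
      unfold rsum
      refine Finset.sum_congr rfl fun i _ => ?_
      simp only [hYiff (t * i / 2 ^ n) (by positivity) ω]
    · intro t ht
      refine TIM.of_eq (hI2 t ht) (fun n ω => ?_) (Eventually.of_forall fun _ => rfl)
      unfold rsum
      refine Finset.sum_congr rfl fun i _ => ?_
      simp only [hYiff (t * i / 2 ^ n) (by positivity) ω]
    · intro u hu
      simp only [hWd, max_eq_left hu]
      exact ((adY u hu).sub_const _).add ((adD u hu).const_mul _)
    · intro u hu
      simp only [hQd, hQ0, max_eq_left hu]
      exact (((hB1.meas hu le_rfl).add (hB2.meas hu le_rfl)).const_mul _).sub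
        (((((adX1 u hu).add (adX2 u hu)).sub_const _).sub_const _).sub_const _)
    · filter_upwards [cY, hD] with ω hc hd
      have e : (fun t => W t ω) = fun t => Y t ω - (x₁ - x₂) +
          (g + h) * ∫ s in (0:ℝ)..(max t 0), psgn (Y s ω) := by
        funext t
        simp only [hWd, hd _ (le_max_right t (0:ℝ))]
      rw [e]
      have c1 : Continuous fun t => ∫ s in (0:ℝ)..t, psgn (Y s ω) :=
        intervalIntegral.continuous_primitive (fun a b => psgn_intble hc a b) 0
      exact (hc.sub continuous_const).add (continuous_const.mul (c1.comp cm))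
    · filter_upwards [cX, hB1.cont, hB2.cont] with ω hc h1 h2
      have c0 : Continuous fun t => Q0 t ω :=
        (continuous_const.mul (h1.add h2)).sub ((((hc.1.add hc.2).sub continuous_const).sub
          continuous_const).sub (continuous_const.mul continuous_id))
      exact c0.comp cm
    · intro t ht
      filter_upwards [hdr, hD] with ω hd hd'
      obtain ⟨e1, e2, e3⟩ := hd t ht
      simp only [hWd, max_eq_left ht]
      rw [hd' t ht, e3, hYp t ht, e1, e2]; ring
    · intro t ht
      filter_upwards [hdr] with ω hd
      obtain ⟨e1, e2, e3⟩ := hd t ht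
      simp only [hQd, hQ0, max_eq_left ht]
      rw [e1, e2]; ring
  have W0 : ∀ᵐ ω ∂μ, W 0 ω = 0 := by
    filter_upwards [T.hW 0 le_rfl, hI10, hI20] with ω e1 e2 e3
    rw [e1, e2, e3, sub_zero]
  have Q00 : ∀ᵐ ω ∂μ, Q 0 ω = 0 := by
    filter_upwards [T.hQ 0 le_rfl, hI10, hI20, hB1.init, hB2.init] with ω e1 e2 e3 e4 e5
    rw [e1, e2, e3, e4, e5]; ring
  have bW := T.isBM_W W0
  have bQ := T.isBM_Q Q00
  have S : BB μ F (g + h) (x₁ - x₂) W Y := by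
    refine ⟨hgh.le, bW, adY, mY, cY, ?_⟩
    filter_upwards [hD] with ω hd t ht
    simp only [hWd, max_eq_left ht]
    rw [hd t ht]; ring
  have Wcl : ∀ t, W t = W (max t 0) := by
    intro t; funext ω
    simp only [hWd]
    rw [hclip t, max_eq_left (le_max_right t (0:ℝ))]
  have Qcl : ∀ t, Q t = Q (max t 0) := by
    intro t; funext ω
    simp only [hQd]
    rw [max_eq_left (le_max_right t (0:ℝ))]
  have ind : IndepFun (fun ω => (fun t => Q t ω)) (fun ω => (fun t => W t ω)) μ := by
    have h1 := (T.jointCF.indepFun bW bQ).symm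
    have hψ : Measurable fun (f : {t : ℝ // 0 ≤ t} → ℝ) (t : ℝ) => f ⟨max t 0, le_max_right t 0⟩ :=
      measurable_pi_lambda _ fun t => measurable_pi_apply _
    have h2 := h1.comp hψ hψ
    have eQ : (fun ω => (fun t => Q t ω)) = (fun (f : {t : ℝ // 0 ≤ t} → ℝ) (t : ℝ) =>
        f ⟨max t 0, le_max_right t 0⟩) ∘ (fun ω (t : {t : ℝ // 0 ≤ t}) => Q t.1 ω) := by
      funext ω t
      exact congrFun (Qcl t) ω
    have eW : (fun ω => (fun t => W t ω)) = (fun (f : {t : ℝ // 0 ≤ t} → ℝ) (t : ℝ) =>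
        f ⟨max t 0, le_max_right t 0⟩) ∘ (fun ω (t : {t : ℝ // 0 ≤ t}) => W t.1 ω) := by
      funext ω t
      exact congrFun (Wcl t) ω
    rw [eQ, eW]
    exact h2
  obtain ⟨N, hNm, hN⟩ := S.exists_N
  obtain ⟨L, hL, hLd⟩ := S.exists_L hNm hN
  refine ⟨W, Q, Y, L, bW, bQ, ind, S.indep hclip ind, cY, S.eq, fun t _ => S.natFilt_le t, hL, ?_⟩
  have dy : ∀ᵐ ω ∂μ, ∀ n i : ℕ,
      (ρ ^ 2 - σ ^ 2) * N ((i:ℝ) / 2 ^ n) ω = (ρ + σ) * (ρ * I₁ ((i:ℝ) / 2 ^ n) ω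
        + σ * I₂ ((i:ℝ) / 2 ^ n) ω - ρ * σ * (B₁ ((i:ℝ) / 2 ^ n) ω + B₂ ((i:ℝ) / 2 ^ n) ω)) ∧
      Q ((i:ℝ) / 2 ^ n) ω = (ρ + σ) * (B₁ ((i:ℝ) / 2 ^ n) ω + B₂ ((i:ℝ) / 2 ^ n) ω)
        - I₁ ((i:ℝ) / 2 ^ n) ω - I₂ ((i:ℝ) / 2 ^ n) ω := by
    rw [ae_all_iff]; intro n
    rw [ae_all_iff]; intro i
    filter_upwards [S.rep_N T hN (t := (i:ℝ) / 2 ^ n) (by positivity),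
      T.hQ ((i:ℝ) / 2 ^ n) (by positivity)] with ω e1 e2
    exact ⟨e1, e2⟩
  filter_upwards [dy, hLd, cX, cY, T.cQ, hdr] with ω hdy hLω hcX hcY hcQ hdω
  have pm : ∀ x : ℝ, max x 0 - max (-x) 0 = x := by
    intro x
    rcases le_total 0 x with h0 | h0
    · rw [max_eq_left h0, max_eq_right (by linarith)]; ring
    · rw [max_eq_right h0, max_eq_left (by linarith)]; ring
  have main : ∀ t : ℝ, 0 ≤ t → X₁ t ω - (x₁ + (g * ρ ^ 2 - h * σ ^ 2) * t
            + ρ ^ 2 * (max (Y t ω) 0 - max (x₁ - x₂) 0)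
            - σ ^ 2 * (max (-Y t ω) 0 - max (-(x₁ - x₂)) 0)
            - (ρ ^ 2 - σ ^ 2) * L t ω + ρ * σ * Q t ω) = 0 := by
    intro t ht
    refine eq_of_dyadic (f := fun t => X₁ t ω - (x₁ + (g * ρ ^ 2 - h * σ ^ 2) * t
            + ρ ^ 2 * (max (Y t ω) 0 - max (x₁ - x₂) 0)
            - σ ^ 2 * (max (-Y t ω) 0 - max (-(x₁ - x₂)) 0)
            - (ρ ^ 2 - σ ^ 2) * L t ω + ρ * σ * Q t ω)) ?_ ?_ ht
    · have c1 : Continuous fun t => X₁ t ω - (x₁ + (g * ρ ^ 2 - h * σ ^ 2) * t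
            + ρ ^ 2 * (max (Y t ω) 0 - max (x₁ - x₂) 0)
            - σ ^ 2 * (max (-Y t ω) 0 - max (-(x₁ - x₂)) 0) + ρ * σ * Q t ω) := by
        have hc1 := hcX.1
        fun_prop
      refine (c1.continuousOn.add ((continuousOn_const (c := ρ ^ 2 - σ ^ 2)).mul hLω.1)).congr fun t _ => ?_
      simp only [Pi.add_apply, Pi.mul_apply]
      ring
    · intro n i
      obtain ⟨d1, d2⟩ := hdy n i
      have d3 := hLω.2 n i
      obtain ⟨e1, e2, -⟩ := hdω ((i:ℝ) / 2 ^ n) (by positivity)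
      have e3 := hYp ((i:ℝ) / 2 ^ n) (by positivity) ω
      unfold locL at d3
      set τ : ℝ := (i:ℝ) / 2 ^ n with hτ
      set A : ℝ := ∫ u in (0:ℝ)..τ, (if Y u ω ≤ 0 then (0:ℝ) else 1) with hA
      have p1 := pm (Y τ ω)
      have p2 := pm (x₁ - x₂)
      rw [d3]
      have p1' : max (-Y τ ω) 0 = max (Y τ ω) 0 - Y τ ω := by linarith
      have p2' : max (-(x₁ - x₂)) 0 = max (x₁ - x₂) 0 - (x₁ - x₂) := by linarith
      have q1 : ρ * σ * Q τ ω = ρ ^ 2 * I₁ τ ω + σ ^ 2 * I₂ τ ω - (ρ ^ 2 - σ ^ 2) * N τ ω := by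
        rw [d1, d2]; ring
      have s1 : ρ ^ 2 = 1 - σ ^ 2 := by linarith
      rw [p1', p2', q1, e3, e1, e2, s1]
      ring
  intro t ht
  have h1 := main t ht
  refine ⟨by linarith, ?_⟩
  have p1 := pm (Y t ω)
  have p2 := pm (x₁ - x₂)
  have e3 := hYp t ht ω
  have p1' : max (-Y t ω) 0 = max (Y t ω) 0 - Y t ω := by linarith
  have p2' : max (-(x₁ - x₂)) 0 = max (x₁ - x₂) 0 - (x₁ - x₂) := by linarith
  rw [p1', p2'] at h1 ⊢
  have s1 : ρ ^ 2 = 1 - σ ^ 2 := by linarith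
  rw [s1] at h1 ⊢
  linarith

end SDEPaper
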